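/- Every frice homeomorphism g of T² is rotationally mixing: there exist an integer j ≥ 1 and a lift of g^j to ℝ² which is topologically mixing. In particular, g itself is topologically mixing. -/

import Mathlib

open Metric Filter Topology MeasureTheory Set ENNReal

noncomputable section

abbrev R2 : Type := ℝ × ℝ

abbrev Torus : Type := AddCircle (1 : ℝ) × AddCircle (1 : ℝ)

instance : Fact ((0:ℝ) < 1) := ⟨one_pos⟩

/-- The covering projection `ℝ² → T²`. -/
def proj : R2 → Torus := fun p => ((p.1 : AddCircle (1:ℝ)), (p.2 : AddCircle (1:ℝ)))

/-- `F : ℝ² → ℝ²` is a lift of `f : T² → T²` (commutes with the projection and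
with the integer translations). -/
def IsLiftFun (f : Torus → Torus) (F : R2 → R2) : Prop :=
  (∀ x : R2, proj (F x) = f (proj x)) ∧
  ∀ (x : R2) (v : ℤ × ℤ), F (x + ((v.1 : ℝ), (v.2 : ℝ))) = F x + ((v.1 : ℝ), (v.2 : ℝ))

/-- Iteration of a homeomorphism indexed by `ℤ`. -/
def iterZ {X : Type*} [TopologicalSpace X] (F : X ≃ₜ X) : ℤ → X → X
  | Int.ofNat n => (⇑F)^[n]
  | Int.negSucc n => (⇑F.symm)^[n+1]

/-- The rotation set of a lift. -/
def rotSet (F : R2 ≃ₜ R2) : Set R2 :=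
  {v | ∃ (z : ℕ → R2) (n : ℕ → ℕ), Tendsto n atTop atTop ∧
    Tendsto (fun k => ((n k : ℝ))⁻¹ • ((⇑F)^[n k] (z k) - z k)) atTop (nhds v)}

/-- A continuum: a nonempty compact connected set. -/
def IsContinuum {X : Type*} [TopologicalSpace X] (K : Set X) : Prop :=
  IsCompact K ∧ IsConnected K

/-- Dynamical diameter of a set under a homeomorphism of the plane. -/
def dynDiam (F : R2 ≃ₜ R2) (K : Set R2) : ℝ≥0∞ :=
  ⨆ j : ℤ, EMetric.diam (iterZ F j '' K)

/-- Topological mixing. -/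
def TopologicallyMixing {X : Type*} [TopologicalSpace X] (h : X → X) : Prop :=
  ∀ U V : Set X, IsOpen U → IsOpen V → U.Nonempty → V.Nonempty →
    ∃ n₀ : ℕ, ∀ n, n₀ ≤ n → ((h^[n]) '' U ∩ V).Nonempty

/-- Maximal cardinality of a `(±n, ε)`-separated subset of `K`. -/
def sepCount (g : Torus ≃ₜ Torus) (n : ℕ) (ε : ℝ) (K : Set Torus) : ℕ :=
  sSup {m : ℕ | ∃ Y : Finset Torus, ↑Y ⊆ K ∧ Y.card = m ∧
    ∀ y ∈ Y, ∀ y' ∈ Y, y ≠ y' →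
      ∃ i : ℤ, |i| ≤ (n : ℤ) ∧ ε < dist (iterZ g i y) (iterZ g i y')}

/-- The two-sided entropy `h_±(g, K)` carried by `K`. -/
def entropyPM (g : Torus ≃ₜ Torus) (K : Set Torus) : EReal :=
  ⨆ (ε : ℝ) (_ : 0 < ε),
    limsup (fun n : ℕ => ((Real.log (sepCount g n ε K) / n : ℝ) : EReal)) atTop

/-- Connected component of the `ε`-stable set of `z` containing `z`. -/
def stableComp (G : R2 ≃ₜ R2) (ε : ℝ) (z : R2) : Set R2 :=
  connectedComponentIn {z' : R2 | ∀ j : ℕ, dist ((⇑G)^[j] z') ((⇑G)^[j] z) ≤ ε} z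

/-- The stable set of `z`. -/
def stableSet (G : R2 ≃ₜ R2) (z : R2) : Set R2 := ⋃ ε > 0, stableComp G ε z

/-- Connected component of the `ε`-unstable set of `z` containing `z`. -/
def unstableComp (G : R2 ≃ₜ R2) (ε : ℝ) (z : R2) : Set R2 :=
  connectedComponentIn {z' : R2 | ∀ j : ℕ, dist ((⇑G.symm)^[j] z') ((⇑G.symm)^[j] z) ≤ ε} z

/-- The unstable set of `z`. -/
def unstableSet (G : R2 ≃ₜ R2) (z : R2) : Set R2 := ⋃ ε > 0, unstableComp G ε z

/-- Two points are dynamically related if some dynamically bounded continuum contains both. -/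
def dynRel (F : R2 ≃ₜ R2) (z z' : R2) : Prop :=
  ∃ K : Set R2, IsContinuum K ∧ z ∈ K ∧ z' ∈ K ∧ dynDiam F K ≠ ⊤

/-- The equivalence class of `z` under the dynamically-bounded relation. -/
def dynClass (F : R2 ≃ₜ R2) (z : R2) : Set R2 := {z' | dynRel F z z'}


/-! ### Combinatorics -/

theorem oneDimPer (Q : ℤ → Prop) (lo hi s : ℤ) (hs : 0 < s)
    (h : ∀ z, lo ≤ z → z + s ≤ hi → (Q z ↔ Q (z + s))) (m : ℕ) :
    ∀ z, lo ≤ z → z + m * s ≤ hi → (Q z ↔ Q (z + m * s)) := by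
  induction m with
  | zero => intro z _ _; simp
  | succ m ih =>
    intro z h1 h2
    push_cast at h2 ⊢
    have hm : (0:ℤ) ≤ m * s := by positivity
    rw [ih z h1 (by nlinarith), h (z + m * s) (by linarith) (by nlinarith)]
    ring_nf

theorem oneDimPer' (Q : ℤ → Prop) (lo hi s : ℤ) (hs : 0 < s)
    (h : ∀ z, lo ≤ z → z + s ≤ hi → (Q z ↔ Q (z + s))) (z z' : ℤ)
    (hz : lo ≤ z) (hz' : lo ≤ z') (hz1 : z ≤ hi) (hz1' : z' ≤ hi) (hd : s ∣ z' - z) (hq : Q z) :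
    Q z' := by
  obtain ⟨m, hm⟩ := hd
  rcases le_total 0 m with h0 | h0
  · lift m to ℕ using h0
    have := (oneDimPer Q lo hi s hs h m z hz (by linarith)).1 hq
    convert this using 1
    linarith
  · obtain ⟨k, hk⟩ := Int.eq_ofNat_of_zero_le (neg_nonneg.2 h0)
    have hm' : m = -(k:ℤ) := by simp [← hk]
    subst hm'
    have e : z' + k * s = z := by linarith
    refine (oneDimPer Q lo hi s hs h k z' hz' (by linarith)).2 ?_
    rw [e]; exact hq

/-- integer box -/
def bx (x : ℤ × ℤ) (l : ℤ) : Finset (ℤ × ℤ) :=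
  Finset.Icc (x.1 - l) (x.1 + l) ×ˢ Finset.Icc (x.2 - l) (x.2 + l)

theorem mem_bx {x y : ℤ × ℤ} {l : ℤ} :
    y ∈ bx x l ↔ (x.1 - l ≤ y.1 ∧ y.1 ≤ x.1 + l) ∧ (x.2 - l ≤ y.2 ∧ y.2 ≤ x.2 + l) := by
  simp [bx, Finset.mem_product]

theorem bx_card (x : ℤ × ℤ) (l : ℤ) : (bx x l).card = (2 * l + 1).toNat ^ 2 := by
  simp only [bx, Finset.card_product, Int.card_Icc]
  ring_nf

open Classical in
/-- period extraction -/
theorem periodExtract {κT : Type} [Fintype κT] (R N : ℕ)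
    (hN : Fintype.card κT * (2 * R + 1) ^ 2 ≤ N) (x d : ℤ × ℤ)
    (Wn : κT → Set (ℤ × ℤ)) (B T : Set (ℤ × ℤ))
    (H : ∀ j : ℕ, j ≤ N → ∃ p : ℤ × ℤ, ∃ κ' : κT, p ∈ bx (x + (j:ℤ) • d) R ∧
      ∀ y ∈ B, (y ∈ T ↔ y - p ∈ Wn κ')) :
    ∃ s : ℕ, 0 < s ∧ s ≤ N ∧ ∀ y ∈ B, y + (s:ℤ) • d ∈ B → (y ∈ T ↔ y + (s:ℤ) • d ∈ T) := by
  have hne : Nonempty κT := let ⟨_, k, _⟩ := H 0 (Nat.zero_le _); ⟨k⟩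
  choose! p κ' hp hT using H
  let S : Finset (κT × (ℤ × ℤ)) := Finset.univ ×ˢ bx 0 R
  have hS : S.card < (Finset.range (N+1)).card := by
    simp only [S, Finset.card_product, bx_card, Finset.card_univ, Finset.card_range]
    have : (2 * (R:ℤ) + 1).toNat = 2 * R + 1 := by omega
    rw [this]; omega
  obtain ⟨i, hi, j, hj, hij, he⟩ := Finset.exists_ne_map_eq_of_card_lt_of_maps_to
    (f := fun j : ℕ => (κ' j, p j - (x + (j:ℤ) • d))) (t := S) hS (by
      intro j hj
      have hj' : j ≤ N := by simpa [Nat.lt_succ_iff] using hj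
      have := hp j hj'
      simp only [S, Finset.coe_product, Finset.coe_univ]
      refine ⟨trivial, ?_⟩
      simp only [Finset.mem_coe, mem_bx, Prod.fst_sub, Prod.snd_sub, Prod.fst_zero, Prod.snd_zero] at this ⊢
      omega)
  wlog hlt : i < j generalizing i j
  · exact this j hj i hi hij.symm he.symm (lt_of_le_of_ne (not_lt.1 hlt) hij.symm)
  simp only [Finset.mem_range, Nat.lt_succ_iff] at hi hj
  simp only [Prod.mk.injEq] at he
  refine ⟨j - i, by omega, by omega, ?_⟩
  intro y hy hy'
  rw [hT i hi y hy, hT j hj _ hy', he.1]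
  have : ((j - i : ℕ) : ℤ) = (j:ℤ) - i := by omega
  rw [this]
  have h2 : p j = p i + ((j:ℤ) - i) • d := by
    have := he.2
    rw [sub_eq_sub_iff_add_eq_add] at this
    have h3 : p j = p i + (x + (j:ℤ) • d) - (x + (i:ℤ) • d) := by rw [this]; abel
    rw [h3, sub_smul]; abel
  rw [h2]
  have : y + ((j:ℤ) - i) • d - (p i + ((j:ℤ) - i) • d) = y - p i := by abel
  rw [this]

open Classical in
theorem combiStep {κT : Type} [Fintype κT] (R N : ℕ)
    (hN : Fintype.card κT * (2 * R + 1) ^ 2 ≤ N) (l l0 : ℕ) (hl : l0 + (R + N) ≤ l)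
    (Wn : κT → Set (ℤ × ℤ)) (W' : Set (ℤ × ℤ))
    (hR : ∀ t ∈ bx 0 (R + N + N), ∃ p κ', p ∈ bx t R ∧ ∀ q ∈ Wn κ', p + q ∈ W')
    (h2 : ∀ w : ℤ × ℤ, ∃ q ∈ W', q ∈ bx 0 l0 ∧ (N.factorial : ℤ) ∣ q.1 - w.1 ∧
      (N.factorial : ℤ) ∣ q.2 - w.2)
    (a : ℕ) (hP : ∀ κ, ∀ x ∈ bx 0 (R + N), a ≤ ((bx x l).filter (· ∈ Wn κ)).card) :
    ∀ x ∈ bx 0 (R + N), min (a + 1) ((2 * l + 1) ^ 2) ≤ ((bx x l).filter (· ∈ W')).card := by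
  intro x hx
  set T := (bx x l).filter (· ∈ W') with hT
  have key : ∀ t ∈ bx 0 (R + N + N), t ∈ bx x N → ∃ p κ', p ∈ bx t R ∧ a ≤ T.card ∧
      (T.card = a → ∀ y ∈ bx x l, (y ∈ T ↔ y - p ∈ Wn κ')) := by
    intro t ht htx
    obtain ⟨p, κ', hp, hq⟩ := hR t ht
    have hxp : x - p ∈ bx 0 (R + N) := by
      simp only [mem_bx, Prod.fst_sub, Prod.snd_sub, Prod.fst_zero, Prod.snd_zero] at *
      omega
    have h1 := hP κ' _ hxp
    have hsub : ((bx (x - p) l).filter (· ∈ Wn κ')).map (addLeftEmbedding p) ⊆ T := by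
      intro y hy
      simp only [Finset.mem_map, Finset.mem_filter, addLeftEmbedding_apply] at hy
      obtain ⟨q, ⟨hq1, hq2⟩, rfl⟩ := hy
      simp only [hT, Finset.mem_filter]
      refine ⟨?_, hq q hq2⟩
      simp only [mem_bx, Prod.fst_sub, Prod.snd_sub, Prod.fst_add, Prod.snd_add] at *
      omega
    have hc := Finset.card_le_card hsub
    rw [Finset.card_map] at hc
    refine ⟨p, κ', hp, h1.trans hc, ?_⟩
    intro hTa y hy
    have heq : ((bx (x - p) l).filter (· ∈ Wn κ')).map (addLeftEmbedding p) = T :=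
      Finset.eq_of_subset_of_card_le hsub (by rw [Finset.card_map]; omega)
    rw [← heq]
    simp only [Finset.mem_map, Finset.mem_filter, addLeftEmbedding_apply]
    constructor
    · rintro ⟨q, ⟨_, hq2⟩, rfl⟩; simpa using hq2
    · intro h
      refine ⟨y - p, ⟨?_, h⟩, by abel⟩
      simp only [mem_bx, Prod.fst_sub, Prod.snd_sub] at *
      omega
  have hxT : x ∈ bx 0 (R + N + N) := by
    simp only [mem_bx, Prod.fst_zero, Prod.snd_zero] at *; omega
  obtain ⟨_, _, _, haT, _⟩ := key x hxT (by simp [mem_bx])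
  rcases haT.lt_or_eq with hlt | heq
  · exact (min_le_left _ _).trans hlt
  -- equality case: T is the whole box
  have hper : ∀ d : ℤ × ℤ, (d = (1,0) ∨ d = (0,1)) → ∃ s : ℕ, 0 < s ∧ s ≤ N ∧
      ∀ y ∈ (bx x l : Set (ℤ × ℤ)), y + (s:ℤ) • d ∈ (bx x l : Set (ℤ × ℤ)) →
        (y ∈ (T : Set (ℤ × ℤ)) ↔ y + (s:ℤ) • d ∈ (T : Set (ℤ × ℤ))) := by
    intro d hd
    refine periodExtract R N hN x d Wn (bx x l) T ?_
    intro j hj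
    have h1 : x + (j:ℤ) • d ∈ bx 0 (R + N + N) := by
      rcases hd with rfl | rfl <;>
      · simp only [mem_bx, Prod.fst_zero, Prod.snd_zero, Prod.fst_add, Prod.snd_add,
          Prod.smul_fst, Prod.smul_snd, smul_eq_mul] at *
        omega
    have h2 : x + (j:ℤ) • d ∈ bx x N := by
      rcases hd with rfl | rfl <;>
      · simp only [mem_bx, Prod.fst_add, Prod.snd_add,
          Prod.smul_fst, Prod.smul_snd, smul_eq_mul] at *
        omega
    obtain ⟨p, κ', hp, _, h⟩ := key _ h1 h2
    exact ⟨p, κ', hp, fun y hy => h heq.symm y hy⟩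
  obtain ⟨s1, hs1, hs1N, hp1⟩ := hper (1,0) (Or.inl rfl)
  obtain ⟨s2, hs2, hs2N, hp2⟩ := hper (0,1) (Or.inr rfl)
  have hd1 : (s1:ℤ) ∣ N.factorial := by exact_mod_cast Nat.dvd_factorial hs1 hs1N
  have hd2 : (s2:ℤ) ∣ N.factorial := by exact_mod_cast Nat.dvd_factorial hs2 hs2N
  have hall : bx x l ⊆ T := by
    intro y hy
    obtain ⟨q, hqW, hq0, hq1, hq2⟩ := h2 y
    have hqT : q ∈ T := by
      rw [hT, Finset.mem_filter]
      refine ⟨?_, hqW⟩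
      simp only [mem_bx, Prod.fst_zero, Prod.snd_zero] at *
      omega
    have hqb : q ∈ bx x l := (Finset.mem_filter.1 hqT).1
    have hy' := mem_bx.1 hy
    have hqb' := mem_bx.1 hqb
    have st1 : ((y.1, q.2) : ℤ × ℤ) ∈ T := by
      refine oneDimPer' (fun z => ((z, q.2) : ℤ × ℤ) ∈ T) (x.1 - l) (x.1 + l) s1
        (by exact_mod_cast hs1) ?_ q.1 y.1 hqb'.1.1 hy'.1.1 hqb'.1.2 hy'.1.2 ?_ hqT
      · intro z h1 h2
        have hpos : (0:ℤ) < s1 := by exact_mod_cast hs1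
        have := hp1 (z, q.2) (by simp only [Finset.mem_coe, mem_bx]; omega)
          (by simp only [Finset.mem_coe, mem_bx, Prod.fst_add, Prod.snd_add,
                Prod.smul_fst, Prod.smul_snd, smul_eq_mul]; omega)
        simpa using this
      · have := (hd1.trans hq1)
        have h3 := (dvd_neg.2 this)
        simpa using h3
    have st2 : ((y.1, y.2) : ℤ × ℤ) ∈ T := by
      refine oneDimPer' (fun z => ((y.1, z) : ℤ × ℤ) ∈ T) (x.2 - l) (x.2 + l) s2
        (by exact_mod_cast hs2) ?_ q.2 y.2 hqb'.2.1 hy'.2.1 hqb'.2.2 hy'.2.2 ?_ st1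
      · intro z h1 h2
        have hpos : (0:ℤ) < s2 := by exact_mod_cast hs2
        have := hp2 (y.1, z) (by simp only [Finset.mem_coe, mem_bx]; omega)
          (by simp only [Finset.mem_coe, mem_bx, Prod.fst_add, Prod.snd_add,
                Prod.smul_fst, Prod.smul_snd, smul_eq_mul]; omega)
        simpa using this
      · have := (hd2.trans hq2)
        have h3 := (dvd_neg.2 this)
        simpa using h3
    exact st2
  have := Finset.card_le_card hall
  rw [bx_card] at this
  refine (min_le_right _ _).trans ?_
  have h3 : (2 * (l:ℤ) + 1).toNat = 2 * l + 1 := by omega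
  rwa [h3] at this

open Classical in
theorem combi {κT : Type} [Fintype κT] (W : ℝ → ℕ → κT → Set (ℤ × ℤ)) (R : ℕ) (r0 r1 : ℝ)
    (h01 : r0 < r1)
    (hmono : ∀ r r' n κ, r ≤ r' → W r n κ ⊆ W r' n κ)
    (hR : ∀ T : ℕ, ∃ I : ℕ, ∀ r r' : ℝ, r0 ≤ r → r < r' → r' ≤ r1 → ∃ ns : ℕ, ∀ n, ns ≤ n → ∀ κ,
      ∀ t ∈ bx 0 T, ∃ p κ', p ∈ bx t R ∧ ∀ q ∈ W r n κ', p + q ∈ W r' (n + I) κ)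
    (h2 : ∀ k : ℕ, 0 < k → ∃ l m0 : ℕ, ∀ m, m0 ≤ m → ∀ κ, ∀ w : ℤ × ℤ, ∃ q ∈ W r0 m κ,
      q ∈ bx 0 l ∧ (k : ℤ) ∣ q.1 - w.1 ∧ (k : ℤ) ∣ q.2 - w.2) :
    ∃ n0 : ℕ, ∀ n, n0 ≤ n → ∀ κ, 0 ∈ W r1 n κ := by
  set N := Fintype.card κT * (2 * R + 1) ^ 2 with hN
  obtain ⟨l0, m0, hl0⟩ := h2 N.factorial (Nat.factorial_pos _)
  obtain ⟨I, hI⟩ := hR (R + N + N)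
  set l := l0 + (R + N) with hl
  set f := (2 * l + 1) ^ 2 with hf
  have hfpos : 0 < f := by positivity
  let ρ : ℕ → ℝ := fun j => r0 + (r1 - r0) * (j / f)
  have hρ0 : ∀ j, r0 ≤ ρ j := by
    intro j
    have : 0 ≤ (r1 - r0) * ((j:ℝ) / f) := mul_nonneg (by linarith) (by positivity)
    simp only [ρ]; linarith
  have hρlt : ∀ j, ρ j < ρ (j+1) := by
    intro j
    simp only [ρ]
    have h1 : (j:ℝ) / f < ((j+1 : ℕ):ℝ) / f := by
      gcongr; simp
    have := mul_lt_mul_of_pos_left h1 (sub_pos.2 h01)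
    linarith
  have hρ1 : ρ f = r1 := by
    simp only [ρ]
    rw [div_self (by exact_mod_cast hfpos.ne')]; ring
  have hρm : ∀ j, j ≤ f → ρ j ≤ r1 := by
    intro j hj
    rw [← hρ1]
    exact (strictMono_nat_of_lt_succ hρlt).monotone hj
  have hex : ∀ j, ∃ ns : ℕ, j + 1 ≤ f → ∀ n, ns ≤ n → ∀ κ,
      ∀ t ∈ bx 0 (R + N + N : ℕ), ∃ p κ', p ∈ bx t R ∧ ∀ q ∈ W (ρ j) n κ', p + q ∈ W (ρ (j+1)) (n + I) κ := by
    intro j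
    by_cases hj : j + 1 ≤ f
    · obtain ⟨ns, h⟩ := hI (ρ j) (ρ (j+1)) (hρ0 j) (hρlt j) (hρm _ hj)
      exact ⟨ns, fun _ => h⟩
    · exact ⟨0, fun h => absurd h hj⟩
  choose ns hns using hex
  let nst := max m0 ((Finset.range (f+1)).sup ns)
  have hnst : ∀ j ≤ f, ns j ≤ nst := by
    intro j hj
    exact le_max_of_le_right (Finset.le_sup (f := ns) (Finset.mem_range.2 (by omega)))
  have main : ∀ j, j ≤ f → ∀ n, nst ≤ n → ∀ κ, ∀ x ∈ bx 0 (R + N),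
      j ≤ ((bx x l).filter (· ∈ W (ρ j) (n + j * I) κ)).card := by
    intro j
    induction j with
    | zero => intros; exact Nat.zero_le _
    | succ j ih =>
      intro hj n hn κ
      have ih' := ih (by omega) n hn
      have hstep := combiStep R N le_rfl l l0 le_rfl (W (ρ j) (n + j * I))
        (W (ρ (j+1)) (n + (j+1) * I) κ) ?_ ?_ j ih'
      · intro x hx
        have := hstep x hx
        rw [min_eq_left (by omega)] at this
        exact this
      · intro t ht
        have := hns j hj (n + j * I) ((hnst j (by omega)).trans (by omega)) κ t (by exact_mod_cast ht)
        rw [show n + (j+1) * I = n + j * I + I by ring]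
        exact this
      · intro w
        obtain ⟨q, hq, h⟩ := hl0 (n + (j+1) * I) ((le_max_left _ _).trans (hn.trans (by omega))) κ w
        exact ⟨q, hmono _ _ _ _ (hρ0 _) hq, h⟩
  refine ⟨nst + f * I, fun n hn κ => ?_⟩
  have h := main f le_rfl (n - f * I) (by omega) κ 0 (by simp [mem_bx]; omega)
  rw [hρ1, show n - f * I + f * I = n by omega] at h
  have hcard : (bx 0 (l:ℤ)).card = f := by
    rw [bx_card, hf]; congr 1
  have heq := Finset.eq_of_subset_of_card_le (Finset.filter_subset (· ∈ W r1 n κ) (bx 0 (l:ℤ)))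
    (by rw [hcard]; exact h)
  have h0 : (0 : ℤ × ℤ) ∈ bx 0 (l:ℤ) := by simp [mem_bx]
  rw [← heq] at h0
  exact (Finset.mem_filter.1 h0).2

/-! ### Plane topology: crossing lemma -/

theorem arg_incr (l : ℝ → ℂ) (hl : Continuous l) (u : ℂ)
    (hre : ∀ t, 0 < (Complex.exp (l t) * Complex.exp u).re)
    (h0 : (Complex.exp (l 0) * Complex.exp u).im < 0)
    (h1 : 0 < (Complex.exp (l 1) * Complex.exp u).im) : (l 0).im < (l 1).im := by
  set g : ℝ → ℝ := fun t => (l t).im + u.im with hg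
  have hgc : Continuous g := (Complex.continuous_im.comp hl).add continuous_const
  have ere : ∀ t, (Complex.exp (l t) * Complex.exp u).re =
      Real.exp ((l t).re + u.re) * Real.cos (g t) := by
    intro t; rw [← Complex.exp_add, Complex.exp_re]; simp [hg]
  have eim : ∀ t, (Complex.exp (l t) * Complex.exp u).im =
      Real.exp ((l t).re + u.re) * Real.sin (g t) := by
    intro t; rw [← Complex.exp_add, Complex.exp_im]; simp [hg]
  have hcos : ∀ t, 0 < Real.cos (g t) := by
    intro t; have := hre t; rw [ere] at this
    exact (pos_iff_pos_of_mul_pos this).1 (Real.exp_pos _)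
  have hs0 : Real.sin (g 0) < 0 := by
    rw [eim] at h0
    by_contra h
    have := mul_nonneg (Real.exp_pos ((l 0).re + u.re)).le (not_lt.1 h)
    linarith
  have hs1 : 0 < Real.sin (g 1) := by
    rw [eim] at h1
    exact (pos_iff_pos_of_mul_pos h1).1 (Real.exp_pos _)
  by_contra hcon
  have hle : g 1 ≤ g 0 := by simp only [hg]; linarith [not_lt.1 hcon]
  obtain ⟨n, hn, -⟩ := existsUnique_sub_zsmul_mem_Ioc (Real.two_pi_pos) (g 0) (-Real.pi)
  simp only [zsmul_eq_mul] at hn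
  have pi := Real.pi_pos
  have hc' : 0 < Real.cos (g 0 - n * (2*Real.pi)) := by
    rw [Real.cos_sub_int_mul_two_pi]; exact hcos 0
  have hs' : Real.sin (g 0 - n * (2*Real.pi)) < 0 := by
    rw [Real.sin_sub_int_mul_two_pi]; exact hs0
  have b1 : g 0 - n * (2*Real.pi) < 0 := by
    by_contra h
    exact absurd (Real.sin_nonneg_of_nonneg_of_le_pi (not_lt.1 h) (by linarith [hn.2])) (by linarith)
  have b2 : -(Real.pi/2) < g 0 - n * (2*Real.pi) := by
    by_contra h
    have := Real.cos_nonpos_of_pi_div_two_le_of_le (x := -(g 0 - n * (2*Real.pi))) (by linarith [not_lt.1 h])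
      (by linarith [hn.1])
    rw [Real.cos_neg] at this
    linarith
  have b3 : -(Real.pi/2) < g 1 - n * (2*Real.pi) := by
    by_contra h
    have hm : n * (2*Real.pi) - Real.pi/2 ∈ Icc (g 1) (g 0) := ⟨by linarith [not_lt.1 h], by linarith⟩
    have := intermediate_value_uIcc (a := (1:ℝ)) (b := 0) (f := g) hgc.continuousOn
    rw [uIcc_of_le hle] at this
    obtain ⟨t, -, ht⟩ := this hm
    have h2 := hcos t
    rw [ht, Real.cos_int_mul_two_pi_sub] at h2
    simp at h2
  have : Real.sin (g 1 - n * (2*Real.pi)) < 0 :=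
    Real.sin_neg_of_neg_of_neg_pi_lt (by linarith) (by linarith)
  rw [Real.sin_sub_int_mul_two_pi] at this
  linarith

theorem cross_paths (α β : ℝ → R2) (hα : Continuous α) (hβ : Continuous β)
    (h1 : ∀ t, (α 0).1 < (β t).1) (h2 : ∀ t, (β t).1 < (α 1).1)
    (h3 : ∀ s, (β 0).2 < (α s).2) (h4 : ∀ s, (α s).2 < (β 1).2) : ∃ s t, α s = β t := by
  by_contra! hne
  let f : ℝ × ℝ → ℂ := fun p => ⟨(β p.2).1 - (α p.1).1, (β p.2).2 - (α p.1).2⟩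
  have hf : Continuous f := by
    have : f = fun p : ℝ × ℝ => (((β p.2).1 - (α p.1).1 : ℝ) : ℂ) + (((β p.2).2 - (α p.1).2 : ℝ) : ℂ) * Complex.I := by
      funext p
      apply Complex.ext <;> simp [f]
    rw [this]
    fun_prop
  have hf0 : ∀ p, f p ≠ 0 := by
    intro p hp
    apply hne p.1 p.2
    have a := congrArg Complex.re hp
    have b := congrArg Complex.im hp
    simp only [f, Complex.zero_re, Complex.zero_im] at a b
    ext <;> linarith
  have hsc : IsSimplyConnected (univ : Set (ℝ×ℝ)) := by
    have : ContractibleSpace (univ : Set (ℝ×ℝ)) :=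
      (convex_univ : Convex ℝ (univ : Set (ℝ × ℝ))).contractibleSpace univ_nonempty
    exact SimplyConnectedSpace.ofContractible _
  obtain ⟨l, hl, hle⟩ := Complex.exists_continuousOn_eqOn_exp_comp hsc isOpen_univ hf.continuousOn
    (by rintro ⟨p, -, hp⟩; exact hf0 p hp)
  have hl : Continuous l := continuousOn_univ.1 hl
  have hle : ∀ p, Complex.exp (l p) = f p := fun p => hle (mem_univ p)
  have eI : Complex.exp (Complex.log (-Complex.I)) = -Complex.I := Complex.exp_log (by simp)
  have eI' : Complex.exp (Complex.log (Complex.I)) = Complex.I := Complex.exp_log (by simp)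
  have em : Complex.exp (Complex.log (-1)) = -1 := Complex.exp_log (by simp)
  have k1 := arg_incr (fun t => l (0, t)) (by fun_prop) 0
    (by intro t; simp only [hle]; simp [f]; linarith [h1 t])
    (by simp only [hle]; simp [f]; linarith [h3 0])
    (by simp only [hle]; simp [f]; linarith [h4 0])
  have k2 := arg_incr (fun t => l (t, 1)) (by fun_prop) (Complex.log (-Complex.I))
    (by intro t; simp only [hle, eI]; simp [f]; linarith [h4 t])
    (by simp only [hle, eI]; simp [f]; linarith [h1 1])
    (by simp only [hle, eI]; simp [f]; linarith [h2 1])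
  have k3 := arg_incr (fun t => l (1, 1 - t)) (by fun_prop) (Complex.log (-1))
    (by intro t; simp only [hle, em]; simp [f]; linarith [h2 (1-t)])
    (by simp only [hle, em]; simp [f]; linarith [h4 1])
    (by simp only [hle, em]; simp [f]; linarith [h3 1])
  have k4 := arg_incr (fun t => l (1 - t, 0)) (by fun_prop) (Complex.log (Complex.I))
    (by intro t; simp only [hle, eI']; simp [f]; linarith [h3 (1-t)])
    (by simp only [hle, eI']; simp [f]; linarith [h2 0])
    (by simp only [hle, eI']; simp [f]; linarith [h1 0])
  simp at k1 k2 k3 k4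
  linarith

theorem thick_joined {K : Set R2} (hK : IsPreconnected K) {δ : ℝ} (hδ : 0 < δ) {p q : R2} (hp : p ∈ K) (hq : q ∈ K) :
    ∃ α : ℝ → R2, Continuous α ∧ α 0 = p ∧ α 1 = q ∧ ∀ t, α t ∈ thickening δ K := by
  have hc : IsConnected (thickening δ K) := by
    rw [← add_ball_zero]
    exact ⟨⟨p + 0, Set.add_mem_add hp (by simp [hδ])⟩,
      by
        have := (hK.prod (convex_ball (0:R2) δ).isPreconnected).image (fun x : R2 × R2 => x.1 + x.2) (by fun_prop)
        rwa [Set.add_image_prod] at this⟩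
  have hpc := (isOpen_thickening (δ := δ) (E := K)).isConnected_iff_isPathConnected.1 hc
  obtain ⟨γ, hγ⟩ := hpc.joinedIn p (self_subset_thickening hδ K hp) q (self_subset_thickening hδ K hq)
  refine ⟨γ.extend, γ.continuous_extend, by simp, by simp, fun t => ?_⟩
  exact hγ _

theorem cross_continua (K C : Set R2) (hK : IsCompact K) (hC : IsCompact C)
    (hKc : IsPreconnected K) (hCc : IsPreconnected C)
    (h1 : ∃ p ∈ K, ∀ c ∈ C, p.1 < c.1) (h2 : ∃ p ∈ K, ∀ c ∈ C, c.1 < p.1)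
    (h3 : ∃ q ∈ C, ∀ k ∈ K, q.2 < k.2) (h4 : ∃ q ∈ C, ∀ k ∈ K, k.2 < q.2) : (K ∩ C).Nonempty := by
  by_contra hne
  have hd : Disjoint K C := Set.disjoint_iff_inter_eq_empty.2 (Set.not_nonempty_iff_eq_empty.1 hne)
  obtain ⟨δ0, hδ0, hdis⟩ := hd.exists_thickenings hK hC.isClosed
  have low : ∀ (S : Set R2) (f : R2 → ℝ), IsCompact S → Continuous f → (∀ x ∈ S, 0 < f x) →
      ∃ m : ℝ, 0 < m ∧ ∀ x ∈ S, m ≤ f x := by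
    intro S f hS hf h
    obtain ⟨m, hm, h'⟩ := hS.exists_forall_le' hf.continuousOn (a := 0) h
    exact ⟨m, hm, h'⟩
  obtain ⟨p, hp, h1⟩ := h1
  obtain ⟨p', hp', h2⟩ := h2
  obtain ⟨q, hq, h3⟩ := h3
  obtain ⟨q', hq', h4⟩ := h4
  obtain ⟨m1, m1p, h1⟩ := low C (fun c => c.1 - p.1) hC (by fun_prop) (fun c hc => by linarith [h1 c hc])
  obtain ⟨m2, m2p, h2⟩ := low C (fun c => p'.1 - c.1) hC (by fun_prop) (fun c hc => by linarith [h2 c hc])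
  obtain ⟨m3, m3p, h3⟩ := low K (fun c => c.2 - q.2) hK (by fun_prop) (fun c hc => by linarith [h3 c hc])
  obtain ⟨m4, m4p, h4⟩ := low K (fun c => q'.2 - c.2) hK (by fun_prop) (fun c hc => by linarith [h4 c hc])
  obtain ⟨δ, hδ, hle⟩ : ∃ δ > 0, δ ≤ δ0 ∧ δ ≤ m1 ∧ δ ≤ m2 ∧ δ ≤ m3 ∧ δ ≤ m4 :=
    ⟨min δ0 (min m1 (min m2 (min m3 m4))), by positivity, by simp⟩
  obtain ⟨e0, e1, e2, e3, e4⟩ := hle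
  obtain ⟨α, hα, a0, a1, ha⟩ := thick_joined hKc hδ hp hp'
  obtain ⟨β, hβ, b0, b1, hb⟩ := thick_joined hCc hδ hq hq'
  have co : ∀ x y : R2, dist x y < δ → |x.1 - y.1| < δ ∧ |x.2 - y.2| < δ := by
    intro x y h
    rw [Prod.dist_eq, max_lt_iff, Real.dist_eq, Real.dist_eq] at h
    exact h
  have hαe : ∀ s, ∃ k ∈ K, |(α s).1 - k.1| < δ ∧ |(α s).2 - k.2| < δ := by
    intro s; obtain ⟨k, hk, h⟩ := mem_thickening_iff.1 (ha s); exact ⟨k, hk, co _ _ h⟩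
  have hβe : ∀ s, ∃ k ∈ C, |(β s).1 - k.1| < δ ∧ |(β s).2 - k.2| < δ := by
    intro s; obtain ⟨k, hk, h⟩ := mem_thickening_iff.1 (hb s); exact ⟨k, hk, co _ _ h⟩
  obtain ⟨s, t, hst⟩ := cross_paths α β hα hβ
    (by intro t; obtain ⟨k, hk, h, -⟩ := hβe t; have := h1 k hk; rw [a0]; rw [abs_lt] at h; linarith)
    (by intro t; obtain ⟨k, hk, h, -⟩ := hβe t; have := h2 k hk; rw [a1]; rw [abs_lt] at h; linarith)
    (by intro t; obtain ⟨k, hk, -, h⟩ := hαe t; have := h3 k hk; rw [b0]; rw [abs_lt] at h; linarith)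
    (by intro t; obtain ⟨k, hk, -, h⟩ := hαe t; have := h4 k hk; rw [b1]; rw [abs_lt] at h; linarith)
  exact Set.disjoint_left.1 hdis (thickening_mono e0 _ (ha s)) (hst ▸ thickening_mono e0 _ (hb t))

/-- crossing lemma in curvilinear coordinates -/
theorem cross_continua' (φ : R2 → R2) (hφ : Continuous φ) (hi : Function.Injective φ)
    (K C : Set R2) (hK : IsCompact K) (hC : IsCompact C)
    (hKc : IsPreconnected K) (hCc : IsPreconnected C)
    (h1 : ∃ p ∈ K, ∀ c ∈ C, (φ p).1 < (φ c).1) (h2 : ∃ p ∈ K, ∀ c ∈ C, (φ c).1 < (φ p).1)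
    (h3 : ∃ q ∈ C, ∀ k ∈ K, (φ q).2 < (φ k).2) (h4 : ∃ q ∈ C, ∀ k ∈ K, (φ k).2 < (φ q).2) :
    (K ∩ C).Nonempty := by
  have := cross_continua (φ '' K) (φ '' C) (hK.image hφ) (hC.image hφ)
    (hKc.image _ hφ.continuousOn) (hCc.image _ hφ.continuousOn)
    (by simpa only [Set.exists_mem_image, Set.forall_mem_image] using h1)
    (by simpa only [Set.exists_mem_image, Set.forall_mem_image] using h2)
    (by simpa only [Set.exists_mem_image, Set.forall_mem_image] using h3)
    (by simpa only [Set.exists_mem_image, Set.forall_mem_image] using h4)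
  rw [← Set.image_inter hi] at this
  exact this.of_image

/-! ### boundary bumping -/

theorem bump (f : R2 → ℝ) (hf : Continuous f) (C : Set R2) (hC : IsContinuum C) (S : ℝ)
    {y z : R2} (hy : y ∈ C) (hyS : f y ≤ S) (hz : z ∈ C) (hzS : S ≤ f z) :
    ∃ Z ⊆ C, IsContinuum Z ∧ y ∈ Z ∧ (∀ x ∈ Z, f x ≤ S) ∧ ∃ x ∈ Z, f x = S := by
  set A : Set R2 := C ∩ {x | f x ≤ S} with hA
  have hAcl : IsClosed {x | f x ≤ S} := isClosed_le hf continuous_const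
  have hAc : IsCompact A := hC.1.inter_right hAcl
  have hyA : y ∈ A := ⟨hy, hyS⟩
  have : CompactSpace A := isCompact_iff_compactSpace.1 hAc
  let y' : A := ⟨y, hyA⟩
  let Z : Set R2 := Subtype.val '' connectedComponent y'
  have hZA : Z ⊆ A := by rintro _ ⟨x, -, rfl⟩; exact x.2
  refine ⟨Z, hZA.trans inter_subset_left, ⟨?_, ?_⟩, ⟨y', mem_connectedComponent, rfl⟩,
    fun x hx => (hZA hx).2, ?_⟩
  · exact isClosed_connectedComponent.isCompact.image continuous_subtype_val
  · exact isConnected_connectedComponent.image _ continuous_subtype_val.continuousOn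
  by_contra hcon
  push Not at hcon
  have hlt : ∀ x ∈ connectedComponent y', f x.1 < S := fun x hx =>
    lt_of_le_of_ne x.2.2 (hcon _ ⟨x, hx, rfl⟩)
  rw [connectedComponent_eq_iInter_isClopen] at hlt
  let N := { s : Set A // IsClopen s ∧ y' ∈ s }
  have : Nonempty N := ⟨⟨univ, isClopen_univ, mem_univ _⟩⟩
  have hdir : Directed (· ⊇ ·) (fun s : N => s.1) := by
    rintro ⟨s, hs, hxs⟩ ⟨t, ht, hxt⟩
    exact ⟨⟨s ∩ t, hs.inter ht, ⟨hxs, hxt⟩⟩, inter_subset_left, inter_subset_right⟩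
  obtain ⟨⟨Q, hQ, hyQ⟩, hQs⟩ := exists_subset_nhds_of_compactSpace hdir (fun s => s.2.1.1)
    (U := {x : A | f x.1 < S}) (fun x hx =>
      (isOpen_lt (hf.comp continuous_subtype_val) continuous_const).mem_nhds (hlt x hx))
  have hQ1 : IsClosed (Subtype.val '' Q : Set R2) :=
    (hQ.1.isCompact.image continuous_subtype_val).isClosed
  have hQ2 : IsClosed (Subtype.val '' Qᶜ : Set R2) :=
    (hQ.compl.1.isCompact.image continuous_subtype_val).isClosed
  have hQ3 : IsClosed (Subtype.val '' Qᶜ ∪ {x | S ≤ f x} : Set R2) :=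
    hQ2.union (isClosed_le continuous_const hf)
  have := isPreconnected_closed_iff.1 hC.2.isPreconnected _ _ hQ1 hQ3
    (by
      intro x hx
      rcases le_or_gt S (f x) with h | h
      · right; right; exact h
      · by_cases hxQ : (⟨x, hx, h.le⟩ : A) ∈ Q
        · left; exact ⟨_, hxQ, rfl⟩
        · right; left; exact ⟨_, hxQ, rfl⟩)
    ⟨y, hy, ⟨y', hyQ, rfl⟩⟩ ⟨z, hz, Or.inr hzS⟩
  obtain ⟨x, -, ⟨q, hq, hqx⟩, hx⟩ := this
  rcases hx with ⟨q', hq', hqx'⟩ | hx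
  · exact hq' (by rw [show q' = q from Subtype.ext (hqx'.trans hqx.symm)]; exact hq)
  · have : f q.1 < S := hQs hq
    rw [hqx] at this
    exact absurd this (not_lt.2 hx)

/-- bump with a ball -/
theorem bumpBall (C : Set R2) (hC : IsContinuum C) (S : ℝ) (hS : 0 ≤ S)
    {y z : R2} (hy : y ∈ C) (hz : z ∈ C) (hzS : S ≤ dist z y) :
    ∃ Z ⊆ C, IsContinuum Z ∧ y ∈ Z ∧ Z ⊆ closedBall y S ∧ ∃ x ∈ Z, dist x y = S :=
  bump (fun x => dist x y) (by fun_prop) C hC S hy (by simpa using hS) hz hzS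

/-- sub-continuum crossing a strip -/
theorem stripSub (f : R2 → ℝ) (hf : Continuous f) (C : Set R2) (hC : IsContinuum C) (a b : ℝ)
    (hab : a ≤ b) {y z : R2} (hy : y ∈ C) (hya : f y ≤ a) (hz : z ∈ C) (hzb : b ≤ f z) :
    ∃ Z ⊆ C, IsContinuum Z ∧ (∀ x ∈ Z, a ≤ f x ∧ f x ≤ b) ∧ (∃ x ∈ Z, f x = a) ∧
      ∃ x ∈ Z, f x = b := by
  obtain ⟨Z1, h1, hc1, hz1, hle1, p, hp, hpa⟩ := bump (fun x => - f x) hf.neg C hC (-a) hz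
    (by linarith) hy (by linarith)
  obtain ⟨Z2, h2, hc2, hz2, hle2, q, hq, hqa⟩ := bump f hf Z1 hc1 b hp
    (by linarith) hz1 hzb
  exact ⟨Z2, h2.trans h1, hc2, fun x hx => ⟨by linarith [hle1 x (h2 hx)], hle2 x hx⟩,
    ⟨p, hz2, by linarith⟩, ⟨q, hq, hqa⟩⟩

/-! ### Duality -/

open Classical in
theorem pw_cont {Y : Type*} [TopologicalSpace Y] (P V S : Set R2) (hP : IsOpen P) (hVP : IsOpen (V \ P)) 
    (f : R2 → Y) (hf : Continuous f) (c : Y) (h : ∀ x ∈ S, x ∉ V → f x = c) (hPV : P ⊆ V) :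
    ContinuousOn (fun x => if x ∈ P then f x else c) S := by
  intro x hx
  apply ContinuousAt.continuousWithinAt
  by_cases hxP : x ∈ P
  · apply hf.continuousAt.congr
    filter_upwards [hP.mem_nhds hxP] with y hy
    simp [hy]
  · by_cases hxV : x ∈ V
    · apply (continuousAt_const (y := c)).congr
      filter_upwards [hVP.mem_nhds ⟨hxV, hxP⟩] with y hy
      simp [hy.2]
    · have e := h x hx hxV
      intro U hU
      simp only [hxP, if_false] at hU
      have : f ⁻¹' U ∈ 𝓝 x := hf.continuousAt (by rw [e]; exact hU)
      rw [mem_map]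
      filter_upwards [this] with y hy
      simp only [mem_preimage]
      split_ifs
      · exact hy
      · exact mem_of_mem_nhds hU

theorem int_const (g : unitInterval → ℝ) (hg : Continuous g) (h : ∀ t, ∃ n : ℤ, g t = n) :
    g 0 = g 1 := by
  have hT : IsDiscrete (range ((↑) : ℤ → ℝ)) := Int.isClosedEmbedding_coe_real.isEmbedding.isDiscrete_range
  exact isPreconnected_univ.constant_of_mapsTo hT hg.continuousOn
    (fun t _ => by obtain ⟨n, hn⟩ := h t; exact ⟨n, hn.symm⟩) (mem_univ _) (mem_univ _)

open Classical in
theorem duality2 (D : Set R2) (hD : IsOpen D) (hDc : Convex ℝ D) (Y1 Y2 : Set R2)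
    (h1 : IsClosed Y1) (h2 : IsClosed Y2) (hd : Disjoint Y1 Y2) (a b : R2)
    (j1 : JoinedIn (D \ Y1) a b) (j2 : JoinedIn (D \ Y2) a b) :
    JoinedIn (D \ (Y1 ∪ Y2)) a b := by
  set V := D \ (Y1 ∪ Y2) with hV
  have hVo : IsOpen V := hD.sdiff (h1.union h2)
  have haV : a ∈ V := ⟨j1.source_mem.1, fun h => h.elim j1.source_mem.2 j2.source_mem.2⟩
  set P := pathComponentIn V a with hP
  have hPo : IsOpen P := hVo.pathComponentIn a
  have haP : a ∈ P := mem_pathComponentIn_self haV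
  have hPV : P ⊆ V := pathComponentIn_subset
  have hVP : IsOpen (V \ P) := by
    rw [isOpen_iff_mem_nhds]
    rintro y ⟨hy, hyP⟩
    filter_upwards [(hVo.pathComponentIn y).mem_nhds (mem_pathComponentIn_self hy)] with x hx
    refine ⟨pathComponentIn_subset hx, fun h => hyP ?_⟩
    exact JoinedIn.trans h (JoinedIn.symm hx)
  by_contra hb
  have hbP : b ∉ P := hb
  obtain ⟨u, hu1, hu2, -⟩ := exists_continuous_zero_one_of_isClosed h1 h2 hd
  have hsc : IsSimplyConnected D := by
    have : ContractibleSpace D := hDc.contractibleSpace ⟨a, haV.1⟩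
    exact SimplyConnectedSpace.ofContractible _
  set g : R2 → ℂ := fun x => if x ∈ P then Complex.exp (u x * (2 * Real.pi * Complex.I)) else 1 with hg
  have hgc : ContinuousOn g D := by
    apply pw_cont P V D hPo hVP _ (by fun_prop) 1 _ hPV
    intro x hx hxV
    have : x ∈ Y1 ∪ Y2 := by by_contra h; exact hxV ⟨hx, h⟩
    rcases this with h | h
    · simp [hu1 h]
    · simp [hu2 h]
  obtain ⟨f, hf, hfg⟩ := Complex.exists_continuousOn_eqOn_exp_comp hsc hD hgc (by
    rintro ⟨x, -, hx⟩
    simp only [hg] at hx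
    split_ifs at hx
    · exact Complex.exp_ne_zero _ hx
    · exact one_ne_zero hx)
  have hfg : ∀ x ∈ D, Complex.exp (f x) = g x := fun x hx => hfg hx
  have two_pi : (2 * Real.pi) ≠ 0 := by positivity
  -- the key comparison
  have key : ∀ (Y Y' : Set R2) (m : ℤ), Y ∪ Y' = Y1 ∪ Y2 → (∀ x ∈ Y', u x = m) → JoinedIn (D \ Y) a b →
      (f a).im / (2 * Real.pi) - (u a - m) = (f b).im / (2*Real.pi) := by
    rintro Y Y' m hYY hY' ⟨γ, hγ⟩
    let k : R2 → ℝ := fun x => if x ∈ P then u x - m else 0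
    have hk : ContinuousOn k (D \ Y) := by
      apply pw_cont P V (D \ Y) hPo hVP _ (by fun_prop) 0 _ hPV
      intro x hx hxV
      have : x ∈ Y ∪ Y' := by rw [hYY]; by_contra h; exact hxV ⟨hx.1, h⟩
      rcases this with h | h
      · exact absurd h hx.2
      · simp [hY' x h]
    have := int_const (fun t => (f (γ t)).im / (2 * Real.pi) - k (γ t)) (by
      apply Continuous.sub
      · apply Continuous.div_const
        apply Complex.continuous_im.comp
        exact hf.comp_continuous γ.continuous (fun t => (hγ t).1)
      · exact hk.comp_continuous γ.continuous hγ) (by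
      intro t
      have e := hfg (γ t) (hγ t).1
      simp only [hg, k] at e ⊢
      split_ifs at e ⊢ with hp
      · obtain ⟨n, hn⟩ := Complex.exp_eq_exp_iff_exists_int.1 e
        refine ⟨n + m, ?_⟩
        rw [hn]
        simp
        field_simp
        ring
      · obtain ⟨n, hn⟩ := Complex.exp_eq_one_iff.1 e
        refine ⟨n, ?_⟩
        rw [hn]
        simp)
    simpa [k, haP, hbP] using this
  have k1 := key Y1 Y2 1 rfl (fun x hx => by simpa using hu2 hx) j1
  have k2 := key Y2 Y1 0 (union_comm _ _) (fun x hx => by simpa using hu1 hx) j2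
  push_cast at k1 k2
  linarith

theorem duality {ι : Type*} (D : Set R2) (hD : IsOpen D) (hDc : Convex ℝ D) (Y : ι → Set R2)
    (s : Finset ι) (hY : ∀ i ∈ s, IsClosed (Y i))
    (hd : ∀ i ∈ s, ∀ j ∈ s, i ≠ j → Disjoint (Y i) (Y j)) (a b : R2) (ha : a ∈ D) (hb : b ∈ D)
    (hj : ∀ i ∈ s, JoinedIn (D \ Y i) a b) : JoinedIn (D \ ⋃ i ∈ s, Y i) a b := by
  classical
  induction s using Finset.induction_on with
  | empty =>
    simp
    exact (hDc.isPathConnected ⟨a, ha⟩).joinedIn a ha b hb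
  | insert i s hi ih =>
    rw [Finset.set_biUnion_insert]
    apply duality2 D hD hDc _ _ (hY i (by simp)) _ _ a b (hj i (by simp))
    · apply ih
      · intro j hj'; exact hY j (by simp [hj'])
      · intro j hj' k hk; exact hd j (by simp [hj']) k (by simp [hk])
      · intro j hj'; exact hj j (by simp [hj'])
    · exact s.finite_toSet.isClosed_biUnion (fun j hj' => hY j (Finset.mem_insert_of_mem hj'))
    · rw [Set.disjoint_iUnion₂_right]
      intro j hj'
      exact hd i (by simp) j (by simp [hj']) (fun h => hi (h ▸ hj'))

/-! ### integer translations, lifted-line lemma, net lemma -/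

/-- inclusion of the integer lattice -/
def zr : ℤ × ℤ →+ R2 := (Int.castAddHom ℝ).prodMap (Int.castAddHom ℝ)

@[simp] theorem zr_fst (v : ℤ × ℤ) : (zr v).1 = v.1 := rfl
@[simp] theorem zr_snd (v : ℤ × ℤ) : (zr v).2 = v.2 := rfl
theorem zr_def (v : ℤ × ℤ) : zr v = ((v.1 : ℝ), (v.2 : ℝ)) := rfl

/-- translate of a set -/
def tr (v : ℤ × ℤ) (K : Set R2) : Set R2 := (fun x => x + zr v) '' K

theorem mem_tr {v : ℤ × ℤ} {K : Set R2} {x : R2} : x ∈ tr v K ↔ x - zr v ∈ K := by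
  constructor
  · rintro ⟨y, hy, rfl⟩; simpa using hy
  · intro h; exact ⟨_, h, by simp⟩

theorem add_mem_tr {v : ℤ × ℤ} {K : Set R2} {x : R2} (h : x ∈ K) : x + zr v ∈ tr v K := ⟨x, h, rfl⟩

theorem IsContinuum.tr {K : Set R2} (h : IsContinuum K) (v : ℤ × ℤ) : IsContinuum (tr v K) :=
  ⟨h.1.image (by fun_prop), h.2.image _ (by fun_prop)⟩

theorem IsContinuum.image {K : Set R2} (h : IsContinuum K) {f : R2 → R2} (hf : Continuous f) :
    IsContinuum (f '' K) := ⟨h.1.image hf, h.2.image _ hf.continuousOn⟩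

theorem IsContinuum.union {K L : Set R2} (h : IsContinuum K) (h' : IsContinuum L)
    (hn : (K ∩ L).Nonempty) : IsContinuum (K ∪ L) :=
  ⟨h.1.union h'.1, h.2.union hn h'.2⟩

theorem isContinuum_singleton (x : R2) : IsContinuum ({x} : Set R2) :=
  ⟨isCompact_singleton, isConnected_singleton⟩

theorem isContinuum_segment (x y : R2) : IsContinuum (segment ℝ x y) := by
  refine ⟨?_, ⟨x, left_mem_segment ℝ x y⟩, (convex_segment x y).isPreconnected⟩
  rw [segment_eq_image_lineMap]
  exact isCompact_Icc.image AffineMap.lineMap_continuous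

/-- determinant with an integer vector -/
def dt (v : ℤ × ℤ) (x : R2) : ℝ := v.1 * x.2 - v.2 * x.1

theorem dt_add (v : ℤ × ℤ) (x y : R2) : dt v (x + y) = dt v x + dt v y := by
  simp [dt]; ring

theorem dt_sub (v : ℤ × ℤ) (x y : R2) : dt v (x - y) = dt v x - dt v y := by
  simp [dt]; ring

theorem dt_self (v : ℤ × ℤ) (k : ℤ) : dt v (zr (k • v)) = 0 := by
  simp [dt]; ring

theorem coord_le (x y : R2) : |x.1 - y.1| ≤ dist x y ∧ |x.2 - y.2| ≤ dist x y := by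
  rw [Prod.dist_eq, Real.dist_eq, Real.dist_eq]
  exact ⟨le_max_left _ _, le_max_right _ _⟩

theorem exists_coord (x y : R2) : dist x y = |x.1 - y.1| ∨ dist x y = |x.2 - y.2| := by
  rw [Prod.dist_eq, Real.dist_eq, Real.dist_eq]
  exact max_choice _ _

theorem LL (K : Set R2) (hK : IsContinuum K) (v : ℤ × ℤ) (hv : v ≠ 0) (x : R2) (hx : x ∈ K)
    (hxv : x + zr v ∈ K) (C : Set R2) (hC : IsCompact C) (hCc : IsPreconnected C) (q q' : R2)
    (hqC : q ∈ C) (hqC' : q' ∈ C) (hq : ∀ k ∈ K, dt v q < dt v k) (hq' : ∀ k ∈ K, dt v k < dt v q') :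
    ∃ k : ℤ, ∃ y ∈ K, y + zr (k • v) ∈ C := by
  let L : R2 → ℝ := fun p => p.1 * v.1 + p.2 * v.2
  have hL : Continuous L := by fun_prop
  have hn : 0 < (v.1:ℝ)^2 + (v.2:ℝ)^2 := by
    by_contra h
    apply hv
    have h1 : (v.1:ℝ) = 0 := by nlinarith [sq_nonneg (v.1:ℝ), sq_nonneg (v.2:ℝ)]
    have h2 : (v.2:ℝ) = 0 := by nlinarith [sq_nonneg (v.1:ℝ), sq_nonneg (v.2:ℝ)]
    ext
    · exact_mod_cast h1
    · exact_mod_cast h2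
  obtain ⟨m, hm⟩ := (hC.image hL).isBounded.bddBelow
  obtain ⟨M, hM⟩ := (hC.image hL).isBounded.bddAbove
  obtain ⟨N, hN⟩ := exists_nat_gt ((L x - m) / ((v.1:ℝ)^2 + (v.2:ℝ)^2))
  obtain ⟨N', hN'⟩ := exists_nat_gt ((M - L x) / ((v.1:ℝ)^2 + (v.2:ℝ)^2))
  rw [div_lt_iff₀ hn] at hN hN'
  have hLk : ∀ k : ℤ, L (x + zr (k • v)) = L x + k * ((v.1:ℝ)^2 + (v.2:ℝ)^2) := by
    intro k; simp [L]; ring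
  let Row : Set R2 := ⋃ k ∈ Icc (-(N:ℤ)) N', tr (k • v) K
  have hRc : IsCompact Row := (Set.finite_Icc _ _).isCompact_biUnion (fun k _ => (hK.tr _).1)
  have hRp : IsPreconnected Row := by
    apply IsPreconnected.biUnion_of_chain ordConnected_Icc
    · intro k _; exact (hK.tr _).2.isPreconnected
    · intro k _ _
      refine ⟨x + zr v + zr (k • v), add_mem_tr hxv, ?_⟩
      rw [mem_tr]
      convert hx using 1
      rw [Order.succ_eq_add_one, add_smul, one_smul, map_add]; abel
  have mR : ∀ p ∈ Row, ∃ k : ℤ, p - zr (k • v) ∈ K := by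
    intro p hp
    simp only [Row, mem_iUnion] at hp
    obtain ⟨k, _, hk⟩ := hp
    exact ⟨k, mem_tr.1 hk⟩
  have dR : ∀ p ∈ Row, ∃ k ∈ K, dt v p = dt v k := by
    intro p hp
    obtain ⟨k, hk⟩ := mR p hp
    exact ⟨_, hk, by rw [dt_sub, dt_self]; ring⟩
  obtain ⟨p, hpR, hpC⟩ := cross_continua' (fun p => (L p, dt v p))
    (by unfold dt; fun_prop)
    (by
      intro p p' h
      simp only [Prod.mk.injEq, L, dt] at h
      have e1 : (p.1 - p'.1) * ((v.1:ℝ)^2 + (v.2:ℝ)^2) = 0 := by linear_combination v.1 * h.1 - v.2 * h.2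
      have e2 : (p.2 - p'.2) * ((v.1:ℝ)^2 + (v.2:ℝ)^2) = 0 := by linear_combination v.2 * h.1 + v.1 * h.2
      have f1 := (mul_eq_zero.1 e1).resolve_right hn.ne'
      have f2 := (mul_eq_zero.1 e2).resolve_right hn.ne'
      ext <;> linarith) Row C hRc hC hRp hCc
    ⟨x + zr ((-(N:ℤ)) • v), by
      simp only [Row, mem_iUnion]
      exact ⟨_, ⟨le_rfl, by omega⟩, add_mem_tr hx⟩, fun c hc => by
      have := hm ⟨c, hc, rfl⟩
      simp only [hLk]; push_cast; linarith⟩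
    ⟨x + zr (((N':ℤ)) • v), by
      simp only [Row, mem_iUnion]
      exact ⟨_, ⟨by omega, le_rfl⟩, add_mem_tr hx⟩, fun c hc => by
      have := hM ⟨c, hc, rfl⟩
      simp only [hLk]; push_cast; linarith⟩
    ⟨q, hqC, fun k hk => by obtain ⟨k', hk', e⟩ := dR k hk; simp only [e]; exact hq k' hk'⟩
    ⟨q', hqC', fun k hk => by obtain ⟨k', hk', e⟩ := dR k hk; simp only [e]; exact hq' k' hk'⟩
  obtain ⟨k, hk⟩ := mR p hpR
  exact ⟨k, _, hk, by simpa using hpC⟩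

theorem dt_abs_le (v : ℤ × ℤ) (a : ℝ) (h1 : |(v.1:ℝ)| ≤ a) (h2 : |(v.2:ℝ)| ≤ a) (x y : R2) :
    |dt v x - dt v y| ≤ 2 * a * dist x y := by
  have := coord_le x y
  have e : dt v x - dt v y = v.1 * (x.2 - y.2) - v.2 * (x.1 - y.1) := by simp [dt]; ring
  rw [e]
  calc _ ≤ |(v.1:ℝ) * (x.2 - y.2)| + |v.2 * (x.1 - y.1)| := abs_sub _ _
    _ ≤ a * dist x y + a * dist x y := by
      rw [abs_mul, abs_mul]
      have : 0 ≤ a := (abs_nonneg _).trans h1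
      gcongr <;> tauto
    _ = _ := by ring

theorem NL_aux (K : Set R2) (hK : IsContinuum K) (v w : ℤ × ℤ) (a ρ : ℝ)
    (hv1 : |(v.1:ℝ)| ≤ a) (hv2 : |(v.2:ℝ)| ≤ a) (hw1 : |(w.1:ℝ)| ≤ a) (hw2 : |(w.2:ℝ)| ≤ a)
    (hdet : v.1 * w.2 - v.2 * w.1 ≠ 0) (hρ : ∀ x ∈ K, ∀ y ∈ K, dist x y ≤ ρ)
    (x : R2) (hx : x ∈ K) (hxv : x + zr v ∈ K) (C : Set R2) (hC : IsCompact C)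
    (hCc : IsPreconnected C) (p q : R2) (hp : p ∈ C) (hq : q ∈ C)
    (hd : 4 * a * ρ + 2 * a ^ 2 + 1 < dt v p - dt v q) :
    ∃ k l : ℤ, ∃ y ∈ K, y + zr (k • v + l • w) ∈ C := by
  have ha : 0 ≤ a := (abs_nonneg _).trans hv1
  have hρ0 : 0 ≤ ρ := dist_nonneg.trans (hρ x hx x hx)
  set Δ : ℝ := v.1 * w.2 - v.2 * w.1 with hΔ
  have hΔ0 : Δ ≠ 0 := by rw [hΔ]; exact_mod_cast hdet
  have hΔa : |Δ| ≤ 2 * a ^ 2 := by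
    calc _ ≤ |(v.1:ℝ) * w.2| + |(v.2:ℝ) * w.1| := abs_sub _ _
      _ ≤ a * a + a * a := by rw [abs_mul, abs_mul]; gcongr
      _ = _ := by ring
  -- choose l
  obtain ⟨l, hl1, hl2⟩ : ∃ l : ℤ, dt v q + 2 * a * ρ < dt v x + l * Δ ∧
      dt v x + l * Δ < dt v p - 2 * a * ρ := by
    obtain ⟨m, hm, -⟩ := existsUnique_add_zsmul_mem_Ioc (abs_pos.2 hΔ0) (dt v x) (dt v q + 2 * a * ρ)
    simp only [zsmul_eq_mul, mem_Ioc] at hm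
    rcases abs_choice Δ with e | e
    · rw [e] at hm hΔa
      exact ⟨m, by linarith, by linarith⟩
    · rw [e] at hm hΔa
      exact ⟨-m, by push_cast; linarith, by push_cast; linarith⟩
  have hv0 : v ≠ 0 := by rintro rfl; simp at hdet
  have hdw : dt v (zr (l • w)) = l * Δ := by simp [dt, hΔ]; ring
  obtain ⟨k, y, hy, hyC⟩ := LL (tr (l • w) K) (hK.tr _) v hv0 (x + zr (l • w)) (add_mem_tr hx)
    (by rw [mem_tr]; convert hxv using 1; abel) C hC hCc q p hq hp
    (by
      intro y hy
      have h1 := hρ _ (mem_tr.1 hy) x hx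
      have h2 := (abs_le.1 (dt_abs_le v a hv1 hv2 (y - zr (l • w)) x)).1
      rw [dt_sub, hdw] at h2
      have h3 : 2 * a * dist (y - zr (l • w)) x ≤ 2 * a * ρ := by gcongr
      linarith)
    (by
      intro y hy
      have h1 := hρ _ (mem_tr.1 hy) x hx
      have h2 := (abs_le.1 (dt_abs_le v a hv1 hv2 (y - zr (l • w)) x)).2
      rw [dt_sub, hdw] at h2
      have h3 : 2 * a * dist (y - zr (l • w)) x ≤ 2 * a * ρ := by gcongr
      linarith)
  refine ⟨k, l, _, mem_tr.1 hy, ?_⟩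
  convert hyC using 1
  rw [map_add]; abel

theorem NL (K : Set R2) (hK : IsContinuum K) (v w : ℤ × ℤ) (a ρ : ℝ)
    (hv1 : |(v.1:ℝ)| ≤ a) (hv2 : |(v.2:ℝ)| ≤ a) (hw1 : |(w.1:ℝ)| ≤ a) (hw2 : |(w.2:ℝ)| ≤ a)
    (hdet : v.1 * w.2 - v.2 * w.1 ≠ 0) (hρ : ∀ x ∈ K, ∀ y ∈ K, dist x y ≤ ρ)
    (hv : ∃ x ∈ K, x + zr v ∈ K) (hw : ∃ x ∈ K, x + zr w ∈ K) (C : Set R2) (hC : IsCompact C)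
    (hCc : IsPreconnected C) (p q : R2) (hp : p ∈ C) (hq : q ∈ C)
    (hd : 2 * a * (4 * a * ρ + 2 * a ^ 2 + 1) < dist p q) :
    ∃ k l : ℤ, ∃ y ∈ K, y + zr (k • v + l • w) ∈ C := by
  obtain ⟨x, hx, hxv⟩ := hv
  obtain ⟨x', hx', hxw⟩ := hw
  have ha : 0 ≤ a := (abs_nonneg _).trans hv1
  set E := 4 * a * ρ + 2 * a ^ 2 + 1 with hE
  have hdet' : w.1 * v.2 - w.2 * v.1 ≠ 0 := by
    intro h; apply hdet; linarith
  by_cases hA : E < |dt v p - dt v q|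
  · rcases lt_abs.1 hA with h | h
    · exact NL_aux K hK v w a ρ hv1 hv2 hw1 hw2 hdet hρ x hx hxv C hC hCc p q hp hq h
    · exact NL_aux K hK v w a ρ hv1 hv2 hw1 hw2 hdet hρ x hx hxv C hC hCc q p hq hp (by linarith)
  by_cases hB : E < |dt w p - dt w q|
  · rcases lt_abs.1 hB with h | h
    · obtain ⟨k, l, h⟩ := NL_aux K hK w v a ρ hw1 hw2 hv1 hv2 hdet' hρ x' hx' hxw C hC hCc p q hp hq h
      exact ⟨l, k, by rwa [add_comm]⟩
    · obtain ⟨k, l, h⟩ := NL_aux K hK w v a ρ hw1 hw2 hv1 hv2 hdet' hρ x' hx' hxw C hC hCc q p hq hp (by linarith)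
      exact ⟨l, k, by rwa [add_comm]⟩
  exfalso
  push Not at hA hB
  have hΔ1 : (1:ℝ) ≤ |(v.1:ℝ) * w.2 - v.2 * w.1| := by
    have := Int.one_le_abs hdet
    exact_mod_cast this
  have e1 : (p.1 - q.1) * ((v.1:ℝ) * w.2 - v.2 * w.1) = v.1 * (dt w q - dt w p) - w.1 * (dt v q - dt v p) := by
    simp only [dt]; ring
  have e2 : (p.2 - q.2) * ((v.1:ℝ) * w.2 - v.2 * w.1) = v.2 * (dt w q - dt w p) - w.2 * (dt v q - dt v p) := by
    simp only [dt]; ring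
  rw [abs_sub_comm] at hA hB
  have bd : ∀ s c d : ℝ, |c| ≤ a → |d| ≤ a →
      s * ((v.1:ℝ) * w.2 - v.2 * w.1) = c * (dt w q - dt w p) - d * (dt v q - dt v p) → |s| ≤ 2 * a * E := by
    intro s c d hc hd' e
    calc |s| ≤ |s| * |(v.1:ℝ) * w.2 - v.2 * w.1| := le_mul_of_one_le_right (abs_nonneg _) hΔ1
      _ = |c * (dt w q - dt w p) - d * (dt v q - dt v p)| := by rw [← abs_mul, e]
      _ ≤ |c * (dt w q - dt w p)| + |d * (dt v q - dt v p)| := abs_sub _ _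
      _ ≤ a * E + a * E := by rw [abs_mul, abs_mul]; gcongr
      _ = _ := by ring
  rcases exists_coord p q with h | h
  · rw [h] at hd; linarith [bd _ _ _ hv1 hw1 e1]
  · rw [h] at hd; linarith [bd _ _ _ hv2 hw2 e2]

/-! ### Basic dynamics -/

/-- iterates -/
def It (F : R2 ≃ₜ R2) (j : ℤ) (x : R2) : R2 := (F ^ j : R2 ≃ₜ R2) x

@[simp] theorem It_zero (F : R2 ≃ₜ R2) (x : R2) : It F 0 x = x := by simp [It]
theorem It_one (F : R2 ≃ₜ R2) (x : R2) : It F 1 x = F x := by simp [It]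
theorem It_add (F : R2 ≃ₜ R2) (i j : ℤ) (x : R2) : It F (i + j) x = It F i (It F j x) := by
  simp [It, zpow_add]
@[simp] theorem It_neg_cancel (F : R2 ≃ₜ R2) (i : ℤ) (x : R2) : It F (-i) (It F i x) = x := by
  rw [← It_add]; simp
@[simp] theorem It_neg_cancel' (F : R2 ≃ₜ R2) (i : ℤ) (x : R2) : It F i (It F (-i) x) = x := by
  rw [← It_add]; simp
theorem It_cont (F : R2 ≃ₜ R2) (j : ℤ) : Continuous (It F j) := (F ^ j : R2 ≃ₜ R2).continuous
theorem It_inj (F : R2 ≃ₜ R2) (j : ℤ) : Function.Injective (It F j) := (F ^ j : R2 ≃ₜ R2).injective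
theorem It_inv (F : R2 ≃ₜ R2) (j : ℤ) (x : R2) : It F⁻¹ j x = It F (-j) x := by
  simp [It]

structure Frice (F : R2 ≃ₜ R2) : Prop where
  per : ∀ x v, F (x + zr v) = F x + zr v
  drift : ∃ c > 0, ∀ (n : ℕ) (e : R2), ∃ z : R2,
    c * n * (|e.1| + |e.2|) ≤ (It F n z - z).1 * e.1 + (It F n z - z).2 * e.2
  exp : ∀ K : Set R2, IsContinuum K → K.Nontrivial → ∀ M : ℝ, ∃ j : ℤ, ∃ x ∈ K, ∃ y ∈ K,
    M < dist (It F j x) (It F j y)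

namespace Frice
variable {F : R2 ≃ₜ R2}

theorem itper (hF : Frice F) (j : ℤ) (x : R2) (v : ℤ × ℤ) : It F j (x + zr v) = It F j x + zr v := by
  have h1 : ∀ n : ℕ, ∀ x, It F n (x + zr v) = It F n x + zr v := by
    intro n
    induction n with
    | zero => simp
    | succ n ih =>
      intro x
      push_cast
      rw [It_add, It_add, It_one, It_one, hF.per, ih]
  rcases le_total 0 j with h | h
  · lift j to ℕ using h
    exact h1 j x
  · obtain ⟨n, hn⟩ := Int.eq_ofNat_of_zero_le (neg_nonneg.2 h)
    apply It_inj F n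
    have e : j = -(n:ℤ) := by omega
    subst e
    rw [It_neg_cancel', h1, It_neg_cancel']

theorem inv (hF : Frice F) : Frice F⁻¹ where
  per := by
    intro x v
    have := hF.itper (-1) x v
    simpa [It] using this
  drift := by
    obtain ⟨c, hc, h⟩ := hF.drift
    refine ⟨c, hc, fun n e => ?_⟩
    obtain ⟨z, hz⟩ := h n (-e)
    refine ⟨It F n z, ?_⟩
    rw [It_inv, It_neg_cancel]
    simp at hz ⊢
    linarith
  exp := by
    intro K hK hn M
    obtain ⟨j, x, hx, y, hy, h⟩ := hF.exp K hK hn M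
    exact ⟨-j, x, hx, y, hy, by simpa [It_inv] using h⟩

end Frice

theorem exists_zr_near (x : R2) : ∃ v : ℤ × ℤ, dist (x + zr v) 0 ≤ 1 ∧ 
    0 ≤ (x + zr v).1 ∧ (x + zr v).1 < 1 ∧ 0 ≤ (x + zr v).2 ∧ (x + zr v).2 < 1 := by
  refine ⟨(-⌊x.1⌋, -⌊x.2⌋), ?_⟩
  have a1 := Int.floor_le x.1
  have a2 := Int.lt_floor_add_one x.1
  have b1 := Int.floor_le x.2
  have b2 := Int.lt_floor_add_one x.2
  have : (0:ℝ) ≤ x.1 - ⌊x.1⌋ := by linarith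
  refine ⟨?_, ?_, ?_, ?_, ?_⟩
  · rw [Prod.dist_eq, Real.dist_eq, Real.dist_eq]
    simp only [Prod.fst_add, Prod.snd_add, zr_fst, zr_snd, Prod.fst_zero, Prod.snd_zero, sub_zero]
    push_cast
    apply max_le <;> rw [abs_le] <;> constructor <;> linarith
  all_goals
    simp only [Prod.fst_add, Prod.snd_add, zr_fst, zr_snd]
    push_cast
    linarith

/-- nearby integer point -/
theorem exists_zr_close (x : R2) : ∃ v : ℤ × ℤ, dist x (zr v) ≤ 1 := by
  obtain ⟨v, h, -⟩ := exists_zr_near x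
  refine ⟨-v, ?_⟩
  rw [dist_eq_norm] at h ⊢
  simpa using h

namespace Frice
variable {F : R2 ≃ₜ R2}

theorem unif (hF : Frice F) (T : ℕ) (η : ℝ) (hη : 0 < η) : ∃ σ > 0, ∀ j : ℤ, |j| ≤ T → ∀ x y : R2,
    dist x y < σ → dist (It F j x) (It F j y) < η := by
  have h1 : ∀ j : ℤ, ∃ σ > 0, ∀ x y : R2, dist x y < σ → dist (It F j x) (It F j y) < η := by
    intro j
    have hu := (isCompact_closedBall (0:R2) 2).uniformContinuousOn_of_continuous (It_cont F j).continuousOn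
    obtain ⟨δ, hδ, h⟩ := Metric.uniformContinuousOn_iff.1 hu η hη
    refine ⟨min δ 1, by positivity, fun x y hxy => ?_⟩
    obtain ⟨v, hv, -⟩ := exists_zr_near x
    have h2 : dist (x + zr v) (y + zr v) = dist x y := dist_add_right _ _ _
    have := h (x + zr v) (by simp only [mem_closedBall]; linarith) (y + zr v) (by
      simp only [mem_closedBall]
      have := dist_triangle (y + zr v) (x + zr v) 0
      rw [dist_comm (y + zr v) (x + zr v), h2] at this
      have := lt_of_lt_of_le hxy (min_le_right _ _)
      linarith) (by rw [h2]; exact lt_of_lt_of_le hxy (min_le_left _ _))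
    rwa [hF.itper, hF.itper, dist_add_right] at this
  choose σ hσ h using h1
  have : ∃ s > 0, ∀ j ∈ Finset.Icc (-(T:ℤ)) T, s ≤ σ j := by
    have hne : (Finset.Icc (-(T:ℤ)) T).Nonempty := ⟨0, by simp⟩
    refine ⟨(Finset.Icc (-(T:ℤ)) T).inf' hne σ, ?_, fun j hj => Finset.inf'_le _ hj⟩
    rw [gt_iff_lt, Finset.lt_inf'_iff]
    exact fun j _ => hσ j
  obtain ⟨s, hs, hle⟩ := this
  exact ⟨s, hs, fun j hj x y hxy => h j x y (lt_of_lt_of_le hxy (hle j (by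
    rw [Finset.mem_Icc]; exact abs_le.1 hj)))⟩

theorem disp (hF : Frice F) (j : ℤ) : ∃ M : ℝ, 0 < M ∧ ∀ x, dist (It F j x) x ≤ M := by
  obtain ⟨M, hM⟩ := ((isCompact_closedBall (0:R2) 1).image (f := fun x => dist (It F j x) x)
    (by have := It_cont F j; fun_prop)).isBounded.bddAbove
  refine ⟨max M 1, by positivity, fun x => ?_⟩
  obtain ⟨v, hv, -⟩ := exists_zr_near x
  have := hM ⟨x + zr v, hv, rfl⟩
  simp only [hF.itper, dist_add_right] at this
  exact this.trans (le_max_left _ _)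

end Frice

/-! ### limits of continua -/

theorem limCont (C : ℕ → Set R2) (hC : ∀ n, IsContinuum (C n)) (c : R2) (ρ : ℝ)
    (hb : ∀ n, C n ⊆ closedBall c ρ) : ∃ L : Set R2, IsContinuum L ∧
    (∀ x ∈ L, ∃ u : ℕ → R2, (∀ n, u n ∈ C n) ∧ Tendsto u (hyperfilter ℕ) (𝓝 x)) ∧
    (∀ u : ℕ → R2, (∀ n, u n ∈ C n) → ∃ x ∈ L, Tendsto u (hyperfilter ℕ) (𝓝 x)) := by
  set U : Ultrafilter ℕ := hyperfilter ℕ with hU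
  let L : Set R2 := {x | ∀ ε > 0, ∀ᶠ n in (U : Filter ℕ), ∃ y ∈ C n, dist y x < ε}
  have hlim : ∀ u : ℕ → R2, (∀ n, u n ∈ C n) → ∃ x ∈ L, Tendsto u U (𝓝 x) := by
    intro u hu
    obtain ⟨x, -, hx⟩ := (isCompact_closedBall c ρ).ultrafilter_le_nhds (U.map u) (by
      rw [le_principal_iff]
      exact (show ∀ᶠ n in (U : Filter ℕ), u n ∈ closedBall c ρ from
        Filter.Eventually.of_forall (fun n => hb n (hu n))))
    refine ⟨x, fun ε hε => ?_, hx⟩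
    have : Tendsto u U (𝓝 x) := hx
    filter_upwards [Metric.tendsto_nhds.1 this ε hε] with n hn
    exact ⟨u n, hu n, hn⟩
  have hpts : ∀ x ∈ L, ∃ u : ℕ → R2, (∀ n, u n ∈ C n) ∧ Tendsto u U (𝓝 x) := by
    intro x hx
    have : ∀ n, ∃ y ∈ C n, ∀ z ∈ C n, dist y x ≤ dist z x := fun n =>
      (hC n).1.exists_isMinOn (hC n).2.nonempty (by fun_prop : ContinuousOn (fun y => dist y x) (C n))
    choose u hu hmin using this
    refine ⟨u, hu, Metric.tendsto_nhds.2 fun ε hε => ?_⟩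
    filter_upwards [hx ε hε] with n ⟨y, hy, hyx⟩
    exact lt_of_le_of_lt (hmin n y hy) hyx
  refine ⟨L, ⟨?_, ?_, ?_⟩, hpts, hlim⟩
  · have hcl : IsClosed L := by
      apply isClosed_of_closure_subset
      intro x hx ε hε
      obtain ⟨y, hy, hxy⟩ := Metric.mem_closure_iff.1 hx (ε/2) (by positivity)
      filter_upwards [hy (ε/2) (by positivity)] with n ⟨z, hz, hzy⟩
      refine ⟨z, hz, ?_⟩
      have := dist_triangle z y x
      rw [dist_comm y x] at this
      linarith
    apply (isCompact_closedBall c ρ).of_isClosed_subset hcl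
    intro x hx
    obtain ⟨u, hu, hux⟩ := hpts x hx
    exact isClosed_closedBall.mem_of_tendsto hux (Filter.Eventually.of_forall fun n => hb n (hu n))
  · choose u hu using fun n => (hC n).2.nonempty
    obtain ⟨x, hx, -⟩ := hlim u hu
    exact ⟨x, hx⟩
  · have hcl : IsClosed L := by
      apply isClosed_of_closure_subset
      intro x hx ε hε
      obtain ⟨y, hy, hxy⟩ := Metric.mem_closure_iff.1 hx (ε/2) (by positivity)
      filter_upwards [hy (ε/2) (by positivity)] with n ⟨z, hz, hzy⟩
      refine ⟨z, hz, ?_⟩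
      have := dist_triangle z y x
      rw [dist_comm y x] at this
      linarith
    have hLc : IsCompact L := by
      apply (isCompact_closedBall c ρ).of_isClosed_subset hcl
      intro x hx
      obtain ⟨u, hu, hux⟩ := hpts x hx
      exact isClosed_closedBall.mem_of_tendsto hux (Filter.Eventually.of_forall fun n => hb n (hu n))
    rw [isPreconnected_closed_iff]
    intro A B hA hB hAB ⟨a, haL, haA⟩ ⟨b, hbL, hbB⟩
    by_contra hne
    have hd : Disjoint (L ∩ A) (L ∩ B) := by
      rw [Set.disjoint_left]
      rintro x ⟨hx, hxA⟩ ⟨-, hxB⟩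
      exact hne ⟨x, hx, hxA, hxB⟩
    obtain ⟨δ, hδ, hdis⟩ := hd.exists_thickenings (hLc.inter_right hA) (hcl.inter hB)
    have hev : ∀ᶠ n in (U : Filter ℕ), ∃ w ∈ C n, w ∉ thickening δ (L ∩ A) ∧ w ∉ thickening δ (L ∩ B) := by
      filter_upwards [haL δ hδ, hbL δ hδ] with n ⟨y, hy, hya⟩ ⟨z, hz, hzb⟩
      by_contra hcon
      push Not at hcon
      obtain ⟨x, -, h1, h2⟩ := (hC n).2.isPreconnected _ _ (isOpen_thickening (δ := δ) (E := L ∩ A))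
        (isOpen_thickening (δ := δ) (E := L ∩ B))
        (fun w hw => by
          by_cases h : w ∈ thickening δ (L ∩ A)
          · exact Or.inl h
          · exact Or.inr (hcon w hw h))
        ⟨y, hy, mem_thickening_iff.2 ⟨a, ⟨haL, haA⟩, hya⟩⟩ ⟨z, hz, mem_thickening_iff.2 ⟨b, ⟨hbL, hbB⟩, hzb⟩⟩
      exact Set.disjoint_left.1 hdis h1 h2
    have : ∀ n, ∃ w ∈ C n, (∃ w ∈ C n, w ∉ thickening δ (L ∩ A) ∧ w ∉ thickening δ (L ∩ B)) →
        w ∉ thickening δ (L ∩ A) ∧ w ∉ thickening δ (L ∩ B) := by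
      intro n
      by_cases h : ∃ w ∈ C n, w ∉ thickening δ (L ∩ A) ∧ w ∉ thickening δ (L ∩ B)
      · obtain ⟨w, hw, h'⟩ := h
        exact ⟨w, hw, fun _ => h'⟩
      · obtain ⟨w, hw⟩ := (hC n).2.nonempty
        exact ⟨w, hw, fun h' => absurd h' h⟩
    choose w hw hw' using this
    obtain ⟨x, hxL, hwx⟩ := hlim w hw
    rcases hAB hxL with h | h
    · have : ∀ᶠ n in (U : Filter ℕ), w n ∈ thickening δ (L ∩ A) :=
        hwx (isOpen_thickening.mem_nhds (self_subset_thickening hδ _ ⟨hxL, h⟩))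
      obtain ⟨n, h1, h2⟩ := (this.and hev).exists
      exact (hw' n h2).1 h1
    · have : ∀ᶠ n in (U : Filter ℕ), w n ∈ thickening δ (L ∩ B) :=
        hwx (isOpen_thickening.mem_nhds (self_subset_thickening hδ _ ⟨hxL, h⟩))
      obtain ⟨n, h1, h2⟩ := (this.and hev).exists
      exact (hw' n h2).2 h1

theorem ev_ge (N : ℕ) : ∀ᶠ n in (hyperfilter ℕ : Filter ℕ), N ≤ n := by
  have : (hyperfilter ℕ : Filter ℕ) ≤ atTop := by
    rw [← Nat.cofinite_eq_atTop]; exact hyperfilter_le_cofinite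
  exact this (eventually_ge_atTop N)

theorem bumpFin {ι : Type*} (s : Finset ι) (hs : s.Nonempty) (g : ι → R2 → ℝ) (hg : ∀ i, Continuous (g i))
    (C : Set R2) (hC : IsContinuum C) (S : ℝ)
    {y z : R2} (hy : y ∈ C) (hyS : ∀ i ∈ s, g i y ≤ S) (hz : z ∈ C) (hzS : ∃ i ∈ s, S ≤ g i z) :
    ∃ Z ⊆ C, IsContinuum Z ∧ y ∈ Z ∧ (∀ x ∈ Z, ∀ i ∈ s, g i x ≤ S) ∧ ∃ x ∈ Z, ∃ i ∈ s, g i x = S := by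
  obtain ⟨Z, h1, h2, h3, h4, x, hx, hxS⟩ := bump (fun x => s.sup' hs (fun i => g i x))
    (Continuous.finset_sup'_apply hs (fun i _ => hg i)) C hC S hy (Finset.sup'_le hs _ hyS) hz (by
      obtain ⟨i, hi, h⟩ := hzS
      exact (Finset.le_sup'_iff hs).2 ⟨i, hi, h⟩)
  refine ⟨Z, h1, h2, h3, fun x hx i hi => (Finset.le_sup' (fun i => g i x) hi).trans (h4 x hx), x, hx, ?_⟩
  obtain ⟨i, hi, h⟩ := Finset.exists_mem_eq_sup' hs (fun i => g i x)
  exact ⟨i, hi, by rw [← h, hxS]⟩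

/-- backward bounded -/
def Unst (F : R2 ≃ₜ R2) (M : ℝ) (A : Set R2) : Prop :=
  ∀ j : ℕ, ∀ a ∈ A, ∀ b ∈ A, dist (It F (-j) a) (It F (-j) b) ≤ M

/-- forward bounded -/
def Stab (F : R2 ≃ₜ R2) (M : ℝ) (A : Set R2) : Prop :=
  ∀ j : ℕ, ∀ a ∈ A, ∀ b ∈ A, dist (It F j a) (It F j b) ≤ M

theorem unst_inv {F : R2 ≃ₜ R2} {M : ℝ} {A : Set R2} : Unst F⁻¹ M A ↔ Stab F M A := by
  simp [Unst, Stab, It_inv]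

theorem stab_inv {F : R2 ≃ₜ R2} {M : ℝ} {A : Set R2} : Stab F⁻¹ M A ↔ Unst F M A := by
  simp [Unst, Stab, It_inv]

theorem dist_le_of_tendsto {u v : ℕ → R2} {x y : R2} {M : ℝ}
    (hu : Tendsto u (hyperfilter ℕ) (𝓝 x)) (hv : Tendsto v (hyperfilter ℕ) (𝓝 y))
    (h : ∀ᶠ n in (hyperfilter ℕ : Filter ℕ), dist (u n) (v n) ≤ M) : dist x y ≤ M :=
  le_of_tendsto (hu.dist hv) h

theorem le_dist_of_tendsto {u v : ℕ → R2} {x y : R2} {M : ℝ}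
    (hu : Tendsto u (hyperfilter ℕ) (𝓝 x)) (hv : Tendsto v (hyperfilter ℕ) (𝓝 y))
    (h : ∀ᶠ n in (hyperfilter ℕ : Filter ℕ), M ≤ dist (u n) (v n)) : M ≤ dist x y :=
  ge_of_tendsto (hu.dist hv) h

theorem dist_seg {y p x : R2} (hx : x ∈ segment ℝ y p) : dist x y ≤ dist p y := by
  rw [segment_eq_image_lineMap] at hx
  obtain ⟨t, ht, rfl⟩ := hx
  rw [dist_comm, dist_left_lineMap, dist_comm p y, Real.norm_eq_abs, abs_of_nonneg ht.1]
  exact mul_le_of_le_one_left dist_nonneg ht.2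

namespace Frice
variable {F : R2 ≃ₜ R2}

theorem E0 (hF : Frice F) (M η : ℝ) (hη : 0 < η) : ∃ T : ℕ, ∀ K : Set R2, IsContinuum K →
    (∀ j : ℤ, |j| ≤ T → ∀ x ∈ K, ∀ y ∈ K, dist (It F j x) (It F j y) ≤ M) →
    ∀ x ∈ K, ∀ y ∈ K, dist x y < η := by
  by_contra hcon
  push Not at hcon
  choose K hK hb x hx y hy hxy using hcon
  choose v hv using fun n => (exists_zr_near (x n))
  obtain ⟨L, hL, hp, hl⟩ := limCont (fun n => tr (v n) (K n)) (fun n => (hK n).tr _) 0 (1 + M) (by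
    intro n p hp
    have h1 := hb n 0 (by simp) _ (mem_tr.1 hp) (x n) (hx n)
    simp only [It_zero] at h1
    have h2 : dist (p - zr (v n)) (x n) = dist p (x n + zr (v n)) := by
      rw [← dist_add_right _ _ (zr (v n))]; simp
    rw [mem_closedBall]
    have := dist_triangle p (x n + zr (v n)) 0
    linarith [(hv n).1])
  obtain ⟨a, haL, ha⟩ := hl (fun n => x n + zr (v n)) (fun n => add_mem_tr (hx n))
  obtain ⟨b, hbL, hb'⟩ := hl (fun n => y n + zr (v n)) (fun n => add_mem_tr (hy n))
  have hab : η ≤ dist a b := le_dist_of_tendsto ha hb' (Filter.Eventually.of_forall fun n => by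
    simpa using hxy n)
  obtain ⟨j, p, hpL, q, hqL, hpq⟩ := hF.exp L hL ⟨a, haL, b, hbL, by
    intro h; rw [h, dist_self] at hab; linarith⟩ M
  obtain ⟨u, hu, hup⟩ := hp p hpL
  obtain ⟨w, hw, hwq⟩ := hp q hqL
  have : dist (It F j p) (It F j q) ≤ M :=
    dist_le_of_tendsto (((It_cont F j).tendsto p).comp hup) (((It_cont F j).tendsto q).comp hwq) (by
      filter_upwards [ev_ge j.natAbs] with n hn
      have := hb n j (by rw [Int.abs_eq_natAbs]; exact_mod_cast hn) _ (mem_tr.1 (hu n)) _ (mem_tr.1 (hw n))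
      rw [sub_eq_add_neg, sub_eq_add_neg, ← map_neg, hF.itper, hF.itper, dist_add_right] at this
      exact this)
  linarith

theorem E1 (hF : Frice F) (M η : ℝ) (hη : 0 < η) : ∃ T : ℕ, ∀ K : Set R2, IsContinuum K →
    Stab F M K → ∀ j : ℕ, T ≤ j → ∀ x ∈ K, ∀ y ∈ K, dist (It F j x) (It F j y) < η := by
  obtain ⟨T, hT⟩ := hF.E0 M η hη
  refine ⟨T, fun K hK hS j hj x hx y hy => ?_⟩
  apply hT (It F j '' K) (hK.image (It_cont F j)) _ _ (mem_image_of_mem _ hx) _ (mem_image_of_mem _ hy)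
  rintro i hi _ ⟨a, ha, rfl⟩ _ ⟨b, hb, rfl⟩
  rw [← It_add, ← It_add]
  obtain ⟨k, hk⟩ : ∃ k : ℕ, i + j = k := ⟨(i + j).toNat, by rw [abs_le] at hi; omega⟩
  rw [hk]
  exact hS k a ha b hb

theorem UNIF (hF : Frice F) (ε' δ' : ℝ) (hε : 0 < ε') (hδ : 0 < δ') : ∃ σ0 > 0, ∃ N0 : ℕ, ∀ p : R2,
    (∀ q ∈ ball p δ', ∀ k : ℕ, dist (It F k q) (It F k p) ≤ ε') →
    ∀ n : ℕ, N0 ≤ n → ∀ q ∈ ball (It F (-n) p) σ0, ∀ j : ℕ,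
      dist (It F j q) (It F j (It F (-n) p)) ≤ ε' := by
  obtain ⟨T, hT⟩ := hF.E1 (2 * ε') (min ε' (δ'/2)) (by positivity)
  obtain ⟨σ0, hσ0, hσ⟩ := hF.unif T ε' hε
  refine ⟨σ0, hσ0, T, fun p hp n hn q hq j => ?_⟩
  by_contra hcon
  set y := It F (-n) p with hy
  have hyp : It F n y = p := by rw [hy]; simp
  -- family of functions indexed by Option ℕ
  let g : Option ℕ → R2 → ℝ := fun o x => match o with
    | none => dist (It F n x) (It F n y) / (δ'/2)
    | some k => dist (It F k x) (It F k y) / ε'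
  have hg : ∀ o, Continuous (g o) := by
    intro o
    rcases o with _ | k
    · have := It_cont F n; simp only [g]; fun_prop
    · have := It_cont F k; simp only [g]; fun_prop
  have after : ∀ x, dist (It F n x) (It F n y) < δ' → ∀ k : ℕ, n ≤ k → dist (It F k x) (It F k y) ≤ ε' := by
    intro x hx k hk
    obtain ⟨i, rfl⟩ := Nat.exists_eq_add_of_le hk
    push_cast
    rw [add_comm, It_add, It_add, hyp]
    apply hp
    rw [mem_ball, ← hyp]; exact hx
  let s : Finset (Option ℕ) := insert none ((Finset.range (n+1)).map Function.Embedding.some)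
  have hsS : ∀ k ≤ n, some k ∈ s := by intro k hk; simp [s]; omega
  obtain ⟨Z, hZC, hZ, hyZ, hZle, x, hxZ, o, ho, hox⟩ := bumpFin s ⟨none, by simp [s]⟩ g hg
    (segment ℝ y q) (isContinuum_segment y q) 1 (left_mem_segment ℝ y q)
    (by intro o _; rcases o with _ | k <;> simp [g]) (right_mem_segment ℝ y q)
    (by
      by_contra h
      push Not at h
      rcases le_or_gt j n with hj | hj
      · have := h (some j) (hsS j hj)
        simp only [g] at this
        rw [div_lt_one hε] at this
        linarith
      · have := h none (by simp [s])
        simp only [g] at this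
        rw [div_lt_one (by positivity)] at this
        exact hcon (after q (by linarith) j hj.le))
  have hZb : ∀ x ∈ Z, ∀ k : ℕ, dist (It F k x) (It F k y) ≤ ε' := by
    intro x hx k
    rcases le_or_gt k n with hk | hk
    · have := hZle x hx (some k) (hsS k hk)
      simp only [g] at this
      rwa [div_le_one hε] at this
    · have := hZle x hx none (by simp [s])
      simp only [g] at this
      rw [div_le_one (by positivity)] at this
      exact after x (by linarith) k hk.le
  have hS : Stab F (2 * ε') Z := by
    intro k a ha b hb
    have h1 := hZb a ha k
    have h2 := hZb b hb k
    have := dist_triangle_right (It F k a) (It F k b) (It F k y)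
    linarith
  have hE := hT Z hZ hS
  rcases o with _ | k
  · simp only [g] at hox
    rw [div_eq_one_iff_eq (by positivity)] at hox
    have := hE n hn x hxZ y hyZ
    have := min_le_right ε' (δ'/2)
    linarith
  · simp only [g] at hox
    rw [div_eq_one_iff_eq (by positivity)] at hox
    rcases le_or_gt T k with hk | hk
    · have := hE k hk x hxZ y hyZ
      have := min_le_left ε' (δ'/2)
      linarith
    · have h1 := dist_seg (hZC hxZ)
      have := hσ k (by simp; omega) x y (lt_of_le_of_lt h1 hq)
      linarith

theorem NS (hF : Frice F) (x : R2) (δ ε : ℝ) (hδ : 0 < δ) (hε : 0 < ε)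
    (h : ∀ p ∈ ball x δ, ∀ k : ℕ, dist (It F k p) (It F k x) ≤ ε) : False := by
  obtain ⟨σ0, hσ0, N0, hU⟩ := hF.UNIF (2 * ε) (δ/2) (by positivity) (by positivity)
  obtain ⟨m, hm⟩ := exists_nat_gt (1/σ0)
  have hm0 : (0:ℝ) < m := lt_trans (by positivity) hm
  have hmp : 0 < m := by exact_mod_cast hm0
  have hm1 : 1 / (m:ℝ) < σ0 := by
    rw [div_lt_iff₀ hσ0] at hm; rw [div_lt_iff₀ hm0]; linarith
  set N := m * m + 1 with hN
  -- spacing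
  obtain ⟨h0, hh0, hh1⟩ : ∃ h0 > 0, h0 * N < min (δ/2) (1/2) := by
    refine ⟨min (δ/2) (1/2) / (2 * N), by positivity, ?_⟩
    have hNp : (0:ℝ) < N := by positivity
    have hmp : (0:ℝ) < min (δ/2) (1/2) := by positivity
    field_simp
    linarith
  obtain ⟨T, hT⟩ := hF.E1 (4 * ε) h0 hh0
  let p : ℕ → R2 := fun i => x + (i * h0, 0)
  have hpx : ∀ i < N, dist (p i) x < δ / 2 := by
    intro i hi
    have hi' : (i:ℝ) ≤ N := by exact_mod_cast hi.le
    have : (i:ℝ) * h0 < δ/2 := by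
      calc (i:ℝ) * h0 ≤ h0 * N := by nlinarith
        _ < _ := lt_of_lt_of_le hh1 (min_le_left _ _)
    rw [dist_eq_norm]
    simp only [p, add_sub_cancel_left, Prod.norm_def]
    rw [max_lt_iff]
    refine ⟨by rw [Real.norm_eq_abs, abs_of_nonneg (by positivity)]; exact this, by simp; exact hδ⟩
  have hp : ∀ i < N, ∀ q ∈ ball (p i) (δ/2), ∀ k : ℕ, dist (It F k q) (It F k (p i)) ≤ 2 * ε := by
    intro i hi q hq k
    have h1 := h (p i) (by rw [mem_ball]; linarith [hpx i hi]) k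
    have h2 := h q (by
      rw [mem_ball] at hq ⊢
      have := dist_triangle q (p i) x
      linarith [hpx i hi]) k
    have := dist_triangle_right (It F k q) (It F k (p i)) (It F k x)
    linarith
  set n := max N0 T with hn
  -- separation
  have hsep : ∀ i < N, ∀ j < N, i ≠ j → ∀ v, ¬ dist (It F (-n) (p j) + zr v) (It F (-n) (p i)) < σ0 := by
    intro i hi j hj hij v hd
    have hU' := hU (p i) (hp i hi) n (le_max_left _ _)
    set q := It F (-n) (p j) + zr v
    set y := It F (-n) (p i)
    have hS : Stab F (4 * ε) (segment ℝ y q) := by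
      intro k a ha b hb
      have h1 := hU' a (lt_of_le_of_lt (dist_seg ha) hd) k
      have h2 := hU' b (lt_of_le_of_lt (dist_seg hb) hd) k
      have := dist_triangle_right (It F k a) (It F k b) (It F k y)
      linarith
    have := hT _ (isContinuum_segment y q) hS n (le_max_right _ _) q (right_mem_segment ℝ y q) y
      (left_mem_segment ℝ y q)
    simp only [q, y] at this
    rw [hF.itper, It_neg_cancel', It_neg_cancel'] at this
    have h1 := (coord_le (p j + zr v) (p i)).1
    simp only [p, Prod.fst_add, zr_fst] at h1
    have h2 : |((j:ℝ) - i) * h0 + v.1| < h0 := by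
      have e : x.1 + j * h0 + v.1 - (x.1 + i * h0) = ((j:ℝ) - i) * h0 + v.1 := by ring
      rw [e] at h1; exact lt_of_le_of_lt h1 this
    have h3 : |((j:ℝ) - i)| * h0 < 1/2 := by
      have : |((j:ℝ) - i)| ≤ N := by
        have hi' : (i:ℝ) ≤ N := by exact_mod_cast hi.le
        have hj' : (j:ℝ) ≤ N := by exact_mod_cast hj.le
        have := Nat.cast_nonneg (α := ℝ) i
        have := Nat.cast_nonneg (α := ℝ) j
        rw [abs_le]; constructor <;> linarith
      calc _ ≤ h0 * N := by nlinarith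
        _ < _ := lt_of_lt_of_le hh1 (min_le_right _ _)
    have h4 : h0 < 1/2 := by
      have : (1:ℝ) ≤ N := by rw [hN]; push_cast; nlinarith
      calc h0 ≤ h0 * N := by nlinarith
        _ < _ := lt_of_lt_of_le hh1 (min_le_right _ _)
    by_cases hv : v.1 = 0
    · rw [hv] at h2
      simp only [Int.cast_zero, add_zero, abs_mul, abs_of_pos hh0] at h2
      have : (1:ℝ) ≤ |(j:ℝ) - i| := by
        have : (1:ℤ) ≤ |(j:ℤ) - i| := Int.one_le_abs (by omega)
        exact_mod_cast this
      nlinarith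
    · have h5 : (1:ℝ) ≤ |(v.1:ℝ)| := by exact_mod_cast Int.one_le_abs hv
      have h6 : |(v.1:ℝ)| ≤ |((j:ℝ) - i) * h0 + v.1| + |((j:ℝ) - i) * h0| := by
        have := abs_sub (((j:ℝ) - i) * h0 + v.1) (((j:ℝ) - i) * h0)
        simpa using this
      rw [abs_mul ((j:ℝ) - i), abs_of_pos hh0] at h6
      linarith
  -- pigeonhole
  choose v hv using fun i => exists_zr_near (It F (-n) (p i))
  let z : ℕ → R2 := fun i => It F (-n) (p i) + zr (v i)
  obtain ⟨i, hi, j, hj, hij, he⟩ := Finset.exists_ne_map_eq_of_card_lt_of_maps_to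
    (s := Finset.range N) (t := (Finset.range m) ×ˢ (Finset.range m))
    (f := fun i => (⌊m * (z i).1⌋₊, ⌊m * (z i).2⌋₊)) (by simp [hN]) (by
      intro i _
      obtain ⟨-, h1, h2, h3, h4⟩ := hv i
      simp only [Finset.coe_product, Finset.coe_range, mem_prod, mem_Iio]
      constructor
      · rw [Nat.floor_lt (by positivity)]; change (m:ℝ) * (z i).1 < m; nlinarith
      · rw [Nat.floor_lt (by positivity)]; change (m:ℝ) * (z i).2 < m; nlinarith)
  simp only [Prod.mk.injEq] at he
  have cl : ∀ a b : ℝ, 0 ≤ a → 0 ≤ b → ⌊m * a⌋₊ = ⌊m * b⌋₊ → |a - b| < σ0 := by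
    intro a b ha hb h
    have h1 := Nat.floor_le (mul_nonneg hm0.le ha)
    have h2 := Nat.lt_floor_add_one (m * a)
    have h3 := Nat.floor_le (mul_nonneg hm0.le hb)
    have h4 := Nat.lt_floor_add_one (m * b)
    rw [h] at h1 h2
    have : m * |a - b| < 1 := by
      have e : m * |a - b| = |m * (a - b)| := by rw [abs_mul, abs_of_pos hm0]
      rw [e, abs_lt]; constructor <;> nlinarith
    have h5 : |a - b| < 1 / m := by rw [lt_div_iff₀ hm0]; linarith
    linarith
  have hd : dist (z j) (z i) < σ0 := by
    rw [Prod.dist_eq, max_lt_iff, Real.dist_eq, Real.dist_eq]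
    exact ⟨cl _ _ (hv j).2.1 (hv i).2.1 he.1.symm, cl _ _ (hv j).2.2.2.1 (hv i).2.2.2.1 he.2.symm⟩
  refine hsep i (Finset.mem_range.1 hi) j (Finset.mem_range.1 hj) hij (v j - v i) ?_
  have : dist (It F (-n) (p j) + zr (v j - v i)) (It F (-n) (p i)) = dist (z j) (z i) := by
    rw [← dist_add_right _ _ (zr (v i))]
    simp only [z, map_sub]
    congr 1
    abel
  rw [this]; exact hd

theorem NSfin (hF : Frice F) (σ ε : ℝ) (hσ : 0 < σ) (hε : 0 < ε) : ∃ n0 : ℕ, ∀ x : R2,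
    ∃ p ∈ ball x σ, ∃ k ≤ n0, ε < dist (It F k p) (It F k x) := by
  by_contra hcon
  push Not at hcon
  choose x hx using hcon
  choose v hv using fun n => exists_zr_near (x n)
  obtain ⟨y, -, φ, hφ, hy⟩ := (isCompact_closedBall (0:R2) 1).tendsto_subseq (x := fun n => x n + zr (v n))
    (fun n => (hv n).1)
  refine hF.NS y (σ/2) ε (by positivity) hε (fun p hp k => ?_)
  refine le_of_tendsto ((tendsto_const_nhds (x := It F k p)).dist (((It_cont F k).tendsto y).comp hy)) ?_
  filter_upwards [hφ.tendsto_atTop.eventually_ge_atTop k, Metric.tendsto_nhds.1 hy (σ/2) (by positivity)] with n h1 h2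
  simp only [Function.comp] at h2 ⊢
  have := hx (φ n) (p - zr (v (φ n))) (by
    rw [mem_ball] at hp ⊢
    have e : dist (p - zr (v (φ n))) (x (φ n)) = dist p (x (φ n) + zr (v (φ n))) := by
      rw [← dist_add_right _ _ (zr (v (φ n)))]; simp
    rw [e]
    have := dist_triangle_right p (x (φ n) + zr (v (φ n))) y
    linarith) k h1
  rw [sub_eq_add_neg, ← map_neg, hF.itper] at this
  rw [hF.itper, ← dist_add_right _ _ (zr (-v (φ n)))]
  convert this using 2
  simp

/-- unstable continua through every point -/
theorem E2 (hF : Frice F) (ε : ℝ) (hε : 0 < ε) : ∃ δ > 0, ∀ x : R2, ∃ A : Set R2, IsContinuum A ∧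
    x ∈ A ∧ (∃ a ∈ A, δ ≤ dist a x) ∧ Unst F (2 * ε) A := by
  obtain ⟨T, hT⟩ := hF.E0 (2 * ε) ε hε
  obtain ⟨δ, hδ, hδ'⟩ := hF.unif T ε hε
  obtain ⟨n0, hn0⟩ := hF.NSfin δ ε hδ hε
  refine ⟨δ, hδ, fun x => ?_⟩
  have main : ∀ n : ℕ, ∃ A : Set R2, IsContinuum A ∧ x ∈ A ∧ (∃ a ∈ A, δ ≤ dist a x) ∧
      ∀ j : ℕ, j ≤ n → ∀ a ∈ A, ∀ b ∈ A, dist (It F (-j) a) (It F (-j) b) ≤ 2 * ε := by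
    intro n'
    obtain ⟨n, hn, hnn0⟩ : ∃ n : ℕ, n' ≤ n ∧ n0 ≤ n := ⟨max n' n0, le_max_left _ _, le_max_right _ _⟩
    set y := It F (-n) x with hy
    have hyx : It F n y = x := by rw [hy]; simp
    obtain ⟨p, hp, k, hk, hkp⟩ := hn0 y
    obtain ⟨Z, hZC, hZ, hyZ, hZle, z, hz, k', hk', hzk⟩ := bumpFin (Finset.range (n+1)) ⟨0, by simp⟩
      (fun k x => dist (It F k x) (It F k y)) (fun k => by have := It_cont F k; fun_prop)
      (segment ℝ y p) (isContinuum_segment y p) ε (left_mem_segment ℝ y p) (by intro i _; simpa using hε.le)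
      (right_mem_segment ℝ y p) ⟨k, by simp; omega, hkp.le⟩
    have hZ2 : ∀ i ≤ n, ∀ a ∈ Z, ∀ b ∈ Z, dist (It F i a) (It F i b) ≤ 2 * ε := by
      intro i hi a ha b hb
      have h1 := hZle a ha i (by simp; omega)
      have h2 := hZle b hb i (by simp; omega)
      have := dist_triangle_right (It F i a) (It F i b) (It F i y)
      linarith
    rw [Finset.mem_range] at hk'
    have hk1 : T < k' := by
      by_contra h
      have := hδ' k' (by simp; omega) z y (lt_of_le_of_lt (dist_seg (hZC hz)) hp)
      linarith
    have hk2 : n < k' + T := by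
      by_contra h
      have := hT (It F k' '' Z) (hZ.image (It_cont F k')) (by
        rintro i hi _ ⟨a, ha, rfl⟩ _ ⟨b, hb, rfl⟩
        rw [← It_add, ← It_add]
        rw [abs_le] at hi
        obtain ⟨m, hm⟩ : ∃ m : ℕ, i + k' = m := ⟨(i + k').toNat, by omega⟩
        rw [hm]
        exact hZ2 m (by omega) a ha b hb) _ (mem_image_of_mem _ hz) _ (mem_image_of_mem _ hyZ)
      linarith
    refine ⟨It F n '' Z, hZ.image (It_cont F n), ⟨y, hyZ, hyx⟩, ⟨_, mem_image_of_mem _ hz, ?_⟩, ?_⟩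
    · by_contra h
      have := hδ' (-((n - k' : ℕ):ℤ)) (by rw [abs_neg]; simp; omega) _ _ (not_le.1 h)
      rw [← hyx, ← It_add, ← It_add] at this
      have e : (-((n - k' : ℕ):ℤ)) + n = k' := by omega
      rw [e] at this
      linarith
    · rintro j hj _ ⟨a, ha, rfl⟩ _ ⟨b, hb, rfl⟩
      rw [← It_add, ← It_add]
      have e : (-(j:ℤ)) + n = ((n - j : ℕ):ℤ) := by omega
      rw [e]
      exact hZ2 _ (by omega) a ha b hb
  choose A hA hxA hex hb using main
  choose a ha hax using hex
  obtain ⟨L, hL, hp, hl⟩ := limCont A hA x (2 * ε) (by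
    intro n p hp
    have := hb n 0 (by omega) p hp x (hxA n)
    simpa using this)
  refine ⟨L, hL, ?_, ?_, ?_⟩
  · obtain ⟨x', hx', ht⟩ := hl (fun _ => x) hxA
    rwa [← tendsto_nhds_unique ht tendsto_const_nhds]
  · obtain ⟨a', ha', ht⟩ := hl a ha
    exact ⟨a', ha', le_dist_of_tendsto ht tendsto_const_nhds (Filter.Eventually.of_forall hax)⟩
  · intro j b hbL c hcL
    obtain ⟨u, hu, hub⟩ := hp b hbL
    obtain ⟨w, hw, hwc⟩ := hp c hcL
    refine dist_le_of_tendsto (((It_cont F _).tendsto b).comp hub) (((It_cont F _).tendsto c).comp hwc) ?_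
    filter_upwards [ev_ge j] with n hn
    exact hb n j hn _ (hu n) _ (hw n)

end Frice

/-! ### a planar crossing lemma for three continua -/

theorem hseg {a b h : ℝ} (hab : b ≤ a) {x : R2} (hx : x ∈ segment ℝ ((a, h) : R2) (b, h)) :
    x.2 = h ∧ b ≤ x.1 ∧ x.1 ≤ a := by
  obtain ⟨s, t, hs, ht, hst, rfl⟩ := hx
  obtain rfl : s = 1 - t := by linarith
  simp only [Prod.smul_mk, smul_eq_mul, Prod.mk_add_mk]
  refine ⟨by ring, by nlinarith, by nlinarith⟩

theorem vseg {a b h : ℝ} (hab : b ≤ a) {x : R2} (hx : x ∈ segment ℝ ((h, a) : R2) (h, b)) :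
    x.1 = h ∧ b ≤ x.2 ∧ x.2 ≤ a := by
  obtain ⟨s, t, hs, ht, hst, rfl⟩ := hx
  obtain rfl : s = 1 - t := by linarith
  simp only [Prod.smul_mk, smul_eq_mul, Prod.mk_add_mk]
  refine ⟨by ring, by nlinarith, by nlinarith⟩

theorem isContinuum_closedBall (y : R2) {r : ℝ} (hr : 0 ≤ r) : IsContinuum (closedBall y r) :=
  ⟨isCompact_closedBall y r, ⟨y, mem_closedBall_self hr⟩, (convex_closedBall y r).isPreconnected⟩

theorem IsContinuum.bdd {K : Set R2} (h : IsContinuum K) : ∃ B : ℝ, 0 < B ∧ ∀ x ∈ K, dist x 0 ≤ B := by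
  obtain ⟨B, hB⟩ := h.1.isBounded.subset_closedBall 0
  exact ⟨max B 1, by positivity, fun x hx => (hB hx).trans (le_max_left _ _)⟩

theorem threeCross (c d : ℝ) (P1 P2 P3 J1 J3 : Set R2) (hP1 : IsContinuum P1) (hP2 : IsContinuum P2)
    (hP3 : IsContinuum P3) (hJ1 : IsContinuum J1) (hJ3 : IsContinuum J3)
    (s1 : ∀ x ∈ P1, c ≤ x.1 ∧ x.1 ≤ d) (s2 : ∀ x ∈ P2, c ≤ x.1 ∧ x.1 ≤ d)
    (s3 : ∀ x ∈ P3, c ≤ x.1 ∧ x.1 ≤ d) (t1 : ∀ x ∈ J1, c ≤ x.1 ∧ x.1 ≤ d)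
    (t3 : ∀ x ∈ J3, c ≤ x.1 ∧ x.1 ≤ d) (m1 : (P1 ∩ J1).Nonempty) (m3 : (P3 ∩ J3).Nonempty)
    (y : R2) (r : ℝ) (hr : 0 ≤ r) (y1 : c ≤ y.1 - r) (y2 : y.1 + r ≤ d)
    (u1 : (J1 ∩ closedBall y r).Nonempty) (u3 : (J3 ∩ closedBall y r).Nonempty)
    (hy : ∀ x ∈ P2, x ∉ closedBall y r) (l1 l2 l3 r2 : ℝ) (h1 : (c, l1) ∈ P1) (h2 : (c, l2) ∈ P2)
    (h3 : (c, l3) ∈ P3) (hr2 : (d, r2) ∈ P2) (l12 : l1 < l2) (l23 : l2 < l3) :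
    ∃ x ∈ P2, x ∈ P1 ∨ x ∈ J1 ∨ x ∈ P3 ∨ x ∈ J3 := by
  have hcd : c ≤ d := by linarith
  have hE0 : IsContinuum ((P1 ∪ J1) ∪ closedBall y r) := (hP1.union hJ1 m1).union
    (isContinuum_closedBall y hr) (u1.mono (inter_subset_inter_left _ subset_union_right))
  have hE1 : IsContinuum (((P1 ∪ J1) ∪ closedBall y r) ∪ (P3 ∪ J3)) := hE0.union (hP3.union hJ3 m3) (by
    obtain ⟨x, h1, h2⟩ := u3
    exact ⟨x, Or.inr h2, Or.inr h1⟩)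
  obtain ⟨B1, hB1, hb1⟩ := hE1.bdd
  obtain ⟨B2, hB2, hb2⟩ := hP2.bdd
  set B := max B1 B2 + 1 with hB
  have hbE : ∀ x ∈ (((P1 ∪ J1) ∪ closedBall y r) ∪ (P3 ∪ J3)), |x.2| < B := by
    intro x hx
    have := (coord_le x 0).2
    simp only [Prod.snd_zero, sub_zero] at this
    have := hb1 x hx
    have := le_max_left B1 B2
    linarith
  have hbP : ∀ x ∈ P2, |x.2| < B := by
    intro x hx
    have := (coord_le x 0).2
    simp only [Prod.snd_zero, sub_zero] at this
    have := hb2 x hx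
    have := le_max_right B1 B2
    linarith
  have bl1 := abs_lt.1 (hbE (c, l1) (Or.inl (Or.inl (Or.inl h1))))
  have bl2 := abs_lt.1 (hbP (c, l2) h2)
  have bl3 := abs_lt.1 (hbE (c, l3) (Or.inr (Or.inl h3)))
  have br2 := abs_lt.1 (hbP (d, r2) hr2)
  simp only at bl1 bl2 bl3 br2
  set S1 := segment ℝ ((c, l1) : R2) (c - 1, l1) with hS1
  set S2 := segment ℝ ((c - 1, l1) : R2) (c - 1, -B) with hS2
  set S3 := segment ℝ ((c, l3) : R2) (c - 1, l3) with hS3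
  set S4 := segment ℝ ((c - 1, B) : R2) (c - 1, l3) with hS4
  have hH : IsContinuum (((((P1 ∪ J1) ∪ closedBall y r) ∪ (P3 ∪ J3)) ∪ (S1 ∪ S2)) ∪ (S3 ∪ S4)) := by
    refine (hE1.union ((isContinuum_segment _ _).union (isContinuum_segment _ _)
      ⟨(c-1, l1), right_mem_segment _ _ _, left_mem_segment _ _ _⟩)
      ⟨(c, l1), Or.inl (Or.inl (Or.inl h1)), Or.inl (left_mem_segment _ _ _)⟩).union
      ((isContinuum_segment _ _).union (isContinuum_segment _ _)
      ⟨(c-1, l3), right_mem_segment _ _ _, right_mem_segment _ _ _⟩)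
      ⟨(c, l3), Or.inl (Or.inr (Or.inl h3)), Or.inl (left_mem_segment _ _ _)⟩
  set T1 := segment ℝ ((c, l2) : R2) (c - 2, l2) with hT1
  set T2 := segment ℝ ((d + 1, r2) : R2) (d, r2) with hT2
  have hR : IsContinuum ((P2 ∪ T1) ∪ T2) := (hP2.union (isContinuum_segment _ _)
    ⟨_, h2, left_mem_segment _ _ _⟩).union (isContinuum_segment _ _)
    ⟨(d, r2), Or.inl hr2, right_mem_segment _ _ _⟩
  have f1 : ∀ x ∈ S1, x.2 = l1 ∧ c - 1 ≤ x.1 ∧ x.1 ≤ c := fun x hx => hseg (by linarith) hx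
  have f2 : ∀ x ∈ S2, x.1 = c - 1 ∧ -B ≤ x.2 ∧ x.2 ≤ l1 := fun x hx => vseg (by linarith) hx
  have f3 : ∀ x ∈ S3, x.2 = l3 ∧ c - 1 ≤ x.1 ∧ x.1 ≤ c := fun x hx => hseg (by linarith) hx
  have f4 : ∀ x ∈ S4, x.1 = c - 1 ∧ l3 ≤ x.2 ∧ x.2 ≤ B := fun x hx => vseg (by linarith) hx
  have g1 : ∀ x ∈ T1, x.2 = l2 ∧ c - 2 ≤ x.1 ∧ x.1 ≤ c := fun x hx => hseg (by linarith) hx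
  have g2 : ∀ x ∈ T2, x.2 = r2 ∧ d ≤ x.1 ∧ x.1 ≤ d + 1 := fun x hx => hseg (by linarith) hx
  have e1 : ∀ x ∈ (((P1 ∪ J1) ∪ closedBall y r) ∪ (P3 ∪ J3)), c ≤ x.1 ∧ x.1 ≤ d := by
    rintro x (((h | h) | h) | (h | h))
    · exact s1 x h
    · exact t1 x h
    · have := abs_le.1 ((coord_le x y).1.trans h)
      constructor <;> linarith
    · exact s3 x h
    · exact t3 x h
  have hHx : ∀ x ∈ (((((P1 ∪ J1) ∪ closedBall y r) ∪ (P3 ∪ J3)) ∪ (S1 ∪ S2)) ∪ (S3 ∪ S4)),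
      c - 1 ≤ x.1 ∧ x.1 ≤ d := by
    rintro x ((h | (h | h)) | (h | h))
    · have := e1 x h; constructor <;> linarith
    · have := f1 x h; constructor <;> linarith
    · have := f2 x h; constructor <;> linarith
    · have := f3 x h; constructor <;> linarith
    · have := f4 x h; constructor <;> linarith
  have hRx : ∀ x ∈ ((P2 ∪ T1) ∪ T2), |x.2| < B := by
    rintro x ((h | h) | h)
    · exact hbP x h
    · rw [(g1 x h).1, abs_lt]; exact bl2
    · rw [(g2 x h).1, abs_lt]; exact br2
  obtain ⟨x, hxR, hxH⟩ := cross_continua _ _ hR.1 hH.1 hR.2.isPreconnected hH.2.isPreconnected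
    ⟨(c - 2, l2), Or.inl (Or.inr (right_mem_segment _ _ _)), fun x hx => by
      have := hHx x hx; simp only; linarith⟩
    ⟨(d + 1, r2), Or.inr (left_mem_segment _ _ _), fun x hx => by
      have := hHx x hx; simp only; linarith⟩
    ⟨(c - 1, -B), Or.inl (Or.inr (Or.inr (right_mem_segment _ _ _))), fun x hx => by
      have := abs_lt.1 (hRx x hx); simp only; linarith⟩
    ⟨(c - 1, B), Or.inr (Or.inr (left_mem_segment _ _ _)), fun x hx => by
      have := abs_lt.1 (hRx x hx); simp only; linarith⟩
  have key : x ∈ P2 → ∃ x ∈ P2, x ∈ P1 ∨ x ∈ J1 ∨ x ∈ P3 ∨ x ∈ J3 := by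
    intro hx
    have hxs := s2 x hx
    rcases hxH with ((((h | h) | h) | (h | h)) | (h | h)) | (h | h)
    · exact ⟨x, hx, Or.inl h⟩
    · exact ⟨x, hx, Or.inr (Or.inl h)⟩
    · exact absurd h (hy x hx)
    · exact ⟨x, hx, Or.inr (Or.inr (Or.inl h))⟩
    · exact ⟨x, hx, Or.inr (Or.inr (Or.inr h))⟩
    · have := f1 x h
      have e : x = (c, l1) := Prod.ext (by simp only; linarith) this.1
      exact ⟨x, hx, Or.inl (e ▸ h1)⟩
    · have := f2 x h; linarith
    · have := f3 x h
      have e : x = (c, l3) := Prod.ext (by simp only; linarith) this.1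
      exact ⟨x, hx, Or.inr (Or.inr (Or.inl (e ▸ h3)))⟩
    · have := f4 x h; linarith
  rcases hxR with (h | h) | h
  · exact key h
  · have hg := g1 x h
    rcases hxH with (h' | (h' | h')) | (h' | h')
    · have := e1 x h'
      have e : x = (c, l2) := Prod.ext (by simp only; linarith) hg.1
      exact key (e ▸ h2)
    · have := f1 x h'; linarith
    · have := f2 x h'; linarith
    · have := f3 x h'; linarith
    · have := f4 x h'; linarith
  · have hg := g2 x h
    have := hHx x hxH
    have e : x = (d, r2) := Prod.ext (by simp only; linarith) hg.1
    exact key (e ▸ hr2)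

/-! ### unstable and stable continua, the link -/

/-- unstable continuum -/
def UC (F : R2 ≃ₜ R2) (A : Set R2) : Prop := IsContinuum A ∧ ∃ M, Unst F M A
/-- stable continuum -/
def SC (F : R2 ≃ₜ R2) (A : Set R2) : Prop := IsContinuum A ∧ ∃ M, Stab F M A

theorem uc_inv {F : R2 ≃ₜ R2} {A : Set R2} : UC F⁻¹ A ↔ SC F A := by simp [UC, SC, unst_inv]
theorem sc_inv {F : R2 ≃ₜ R2} {A : Set R2} : SC F⁻¹ A ↔ UC F A := by simp [UC, SC, stab_inv]

theorem Unst.mono {F : R2 ≃ₜ R2} {M : ℝ} {A B : Set R2} (h : Unst F M B) (hAB : A ⊆ B) : Unst F M A :=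
  fun j a ha b hb => h j a (hAB ha) b (hAB hb)

theorem Unst.le {F : R2 ≃ₜ R2} {M M' : ℝ} {A : Set R2} (h : Unst F M A) (hM : M ≤ M') : Unst F M' A :=
  fun j a ha b hb => (h j a ha b hb).trans hM

theorem Stab.le {F : R2 ≃ₜ R2} {M M' : ℝ} {A : Set R2} (h : Stab F M A) (hM : M ≤ M') : Stab F M' A :=
  fun j a ha b hb => (h j a ha b hb).trans hM

theorem Unst.union {F : R2 ≃ₜ R2} {M M' : ℝ} {A B : Set R2} (h : Unst F M A) (h' : Unst F M' B)
    (hn : (A ∩ B).Nonempty) : Unst F (M + M') (A ∪ B) := by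
  obtain ⟨x, hxA, hxB⟩ := hn
  have hM : 0 ≤ M := dist_nonneg.trans (h 0 x hxA x hxA)
  have hM' : 0 ≤ M' := dist_nonneg.trans (h' 0 x hxB x hxB)
  rintro j a (ha | ha) b (hb | hb)
  · have := h j a ha b hb; linarith
  · have := h j a ha x hxA
    have := h' j x hxB b hb
    have := dist_triangle (It F (-j) a) (It F (-j) x) (It F (-j) b); linarith
  · have := h' j a ha x hxB
    have := h j x hxA b hb
    have := dist_triangle (It F (-j) a) (It F (-j) x) (It F (-j) b); linarith
  · have := h' j a ha b hb; linarith

theorem UC.union {F : R2 ≃ₜ R2} {A B : Set R2} (h : UC F A) (h' : UC F B) (hn : (A ∩ B).Nonempty) :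
    UC F (A ∪ B) := by
  obtain ⟨hA, M, hM⟩ := h
  obtain ⟨hB, M', hM'⟩ := h'
  exact ⟨hA.union hB hn, _, hM.union hM' hn⟩

namespace Frice
variable {F : R2 ≃ₜ R2}

theorem unst_tr (hF : Frice F) {M : ℝ} {A : Set R2} (h : Unst F M A) (v : ℤ × ℤ) : Unst F M (tr v A) := by
  rintro j _ ⟨a, ha, rfl⟩ _ ⟨b, hb, rfl⟩
  simp only [hF.itper, dist_add_right]
  exact h j a ha b hb

theorem uc_tr (hF : Frice F) {A : Set R2} (h : UC F A) (v : ℤ × ℤ) : UC F (tr v A) :=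
  ⟨h.1.tr v, h.2.imp fun _ hM => hF.unst_tr hM v⟩

theorem uc_image (hF : Frice F) {A : Set R2} (h : UC F A) (n : ℤ) : UC F (It F n '' A) := by
  obtain ⟨hA, M, hM⟩ := h
  obtain ⟨D, hD, hd⟩ := hF.disp n
  refine ⟨hA.image (It_cont F n), M + 2 * D, ?_⟩
  rintro j _ ⟨a, ha, rfl⟩ _ ⟨b, hb, rfl⟩
  rw [← It_add, ← It_add, add_comm, It_add, It_add]
  have h1 := hd (It F (-j) a)
  have h2 := hd (It F (-j) b)
  have h3 := hM j a ha b hb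
  have := dist_triangle4 (It F n (It F (-j) a)) (It F (-j) a) (It F (-j) b) (It F n (It F (-j) b))
  rw [dist_comm (It F (-j) b)] at this
  linarith

theorem uc_singleton (F : R2 ≃ₜ R2) (x : R2) : UC F {x} :=
  ⟨isContinuum_singleton x, 0, by rintro j a rfl b rfl; simp⟩
theorem sc_singleton (F : R2 ≃ₜ R2) (x : R2) : SC F {x} :=
  ⟨isContinuum_singleton x, 0, by rintro j a rfl b rfl; simp⟩

theorem etaSep (hF : Frice F) (M δ : ℝ) (hδ : 0 < δ) : ∃ η > 0, ∀ J P : Set R2, IsContinuum J →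
    Stab F M J → (∃ a ∈ J, ∃ b ∈ J, δ ≤ dist a b) → Unst F M P → ∃ y ∈ J, ∀ x ∈ P, η ≤ dist y x := by
  by_contra hcon
  push Not at hcon
  choose J P hJ hS hd hU hc using fun n : ℕ => hcon (1 / ((n:ℝ) + 1)) (by positivity)
  choose x hx y hy hxy using hd
  choose v hv using fun n => (exists_zr_near (x n))
  obtain ⟨L, hL, hp, hl⟩ := limCont (fun n => tr (v n) (J n)) (fun n => (hJ n).tr _) 0 (1 + M) (by
    intro n p hp
    have h1 := hS n 0 _ (mem_tr.1 hp) (x n) (hx n)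
    simp only [Nat.cast_zero, It_zero] at h1
    have h2 : dist (p - zr (v n)) (x n) = dist p (x n + zr (v n)) := by
      rw [← dist_add_right _ _ (zr (v n))]; simp
    rw [mem_closedBall]
    have := dist_triangle p (x n + zr (v n)) 0
    linarith [(hv n).1])
  obtain ⟨a, haL, ha⟩ := hl (fun n => x n + zr (v n)) (fun n => add_mem_tr (hx n))
  obtain ⟨b, hbL, hb'⟩ := hl (fun n => y n + zr (v n)) (fun n => add_mem_tr (hy n))
  have hab : δ ≤ dist a b := le_dist_of_tendsto ha hb' (Filter.Eventually.of_forall fun n => by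
    simpa using hxy n)
  obtain ⟨j, p, hpL, q, hqL, hpq⟩ := hF.exp L hL ⟨a, haL, b, hbL, by
    intro h; rw [h, dist_self] at hab; linarith⟩ M
  obtain ⟨u, hu, hup⟩ := hp p hpL
  obtain ⟨w, hw, hwq⟩ := hp q hqL
  have h0 : Tendsto (fun n : ℕ => 1 / ((n:ℝ) + 1)) (hyperfilter ℕ) (𝓝 0) :=
    tendsto_one_div_add_atTop_nhds_zero_nat.mono_left (by
      rw [← Nat.cofinite_eq_atTop]; exact hyperfilter_le_cofinite)
  have near : ∀ (u : ℕ → R2) (p : R2), (∀ n, u n ∈ tr (v n) (J n)) → Tendsto u (hyperfilter ℕ) (𝓝 p) →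
      ∃ u' : ℕ → R2, (∀ n, u' n ∈ tr (v n) (P n)) ∧ Tendsto u' (hyperfilter ℕ) (𝓝 p) := by
    intro u p hu hup
    choose s hs hs' using fun n => hc n _ (mem_tr.1 (hu n))
    refine ⟨fun n => s n + zr (v n), fun n => add_mem_tr (hs n), ?_⟩
    rw [tendsto_iff_dist_tendsto_zero] at hup ⊢
    refine squeeze_zero (fun _ => dist_nonneg) (fun n => ?_) (by simpa using h0.add hup)
    have h1 := hs' n
    rw [one_div] at h1
    have h2 : dist (u n - zr (v n)) (s n) = dist (u n) (s n + zr (v n)) := by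
      rw [← dist_add_right _ _ (zr (v n))]; simp
    have := dist_triangle_left (s n + zr (v n)) p (u n)
    linarith
  have : dist (It F j p) (It F j q) ≤ M := by
    rcases le_total 0 j with hj | hj
    · lift j to ℕ using hj
      refine dist_le_of_tendsto (((It_cont F j).tendsto p).comp hup) (((It_cont F j).tendsto q).comp hwq) (.of_forall fun n => ?_)
      have := hS n j _ (mem_tr.1 (hu n)) _ (mem_tr.1 (hw n))
      rw [sub_eq_add_neg, sub_eq_add_neg, ← map_neg, hF.itper, hF.itper, dist_add_right] at this
      exact this
    · obtain ⟨k, rfl⟩ : ∃ k : ℕ, j = -k := ⟨j.natAbs, by omega⟩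
      obtain ⟨u', hu', hup'⟩ := near u p hu hup
      obtain ⟨w', hw', hwq'⟩ := near w q hw hwq
      refine dist_le_of_tendsto (((It_cont F _).tendsto p).comp hup') (((It_cont F _).tendsto q).comp hwq') (.of_forall fun n => ?_)
      have := hU n k _ (mem_tr.1 (hu' n)) _ (mem_tr.1 (hw' n))
      rw [sub_eq_add_neg, sub_eq_add_neg, ← map_neg, hF.itper, hF.itper, dist_add_right] at this
      exact this
  linarith

theorem largeUnst (hF : Frice F) (M : ℝ) : ∃ A, UC F A ∧ ∃ a ∈ A, ∃ b ∈ A, M < dist a b := by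
  obtain ⟨δ, hδ, h⟩ := hF.E2 1 one_pos
  obtain ⟨A, hA, hx, ⟨a, ha, had⟩, hU⟩ := h 0
  obtain ⟨j, p, hp, q, hq, hpq⟩ := hF.exp A hA ⟨a, ha, 0, hx, by
    rintro rfl; rw [dist_self] at had; linarith⟩ (max M 2)
  exact ⟨It F j '' A, hF.uc_image ⟨hA, _, hU⟩ j, _, mem_image_of_mem _ hp, _, mem_image_of_mem _ hq,
    lt_of_le_of_lt (le_max_left _ _) hpq⟩

end Frice

theorem manyPts (A : Set R2) (hA : IsContinuum A) (N : ℕ) (a b : R2) (ha : a ∈ A) (hb : b ∈ A)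
    (hab : 3 * N < dist a b) : ∃ (x : ℕ → R2) (v : ℕ → ℤ × ℤ), (∀ i < N, x i ∈ A ∧ dist (x i) (zr (v i)) ≤ 1) ∧
      ∀ i < N, ∀ j < N, i ≠ j → v i ≠ v j := by
  have main : ∀ g : R2 → ℝ, Continuous g → (∀ x y, |g x - g y| ≤ dist x y) → ∀ a ∈ A, ∀ b ∈ A,
      3 * N < g b - g a → ∃ (x : ℕ → R2) (v : ℕ → ℤ × ℤ), (∀ i < N, x i ∈ A ∧ dist (x i) (zr (v i)) ≤ 1) ∧
      ∀ i < N, ∀ j < N, i ≠ j → v i ≠ v j := by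
    intro g hg hgl a ha b hb h
    have hx : ∀ i : ℕ, ∃ x, i < N → x ∈ A ∧ g x = g a + 3 * i := by
      intro i
      by_cases hi : i < N
      · have hi' : (i:ℝ) ≤ N := by exact_mod_cast hi.le
        have h0 := Nat.cast_nonneg (α := ℝ) i
        obtain ⟨x, hx, hgx⟩ := hA.2.isPreconnected.intermediate_value ha hb hg.continuousOn
          (show g a + 3 * i ∈ Icc (g a) (g b) by constructor <;> linarith)
        exact ⟨x, fun _ => ⟨hx, hgx⟩⟩
      · exact ⟨0, fun h => absurd h hi⟩
    choose x hx using hx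
    choose v hv using fun i => exists_zr_close (x i)
    refine ⟨x, v, fun i hi => ⟨(hx i hi).1, hv i⟩, fun i hi j hj hij he => ?_⟩
    have h1 := abs_le.1 ((hgl _ _).trans (hv i))
    have h2 := abs_le.1 ((hgl _ _).trans (hv j))
    rw [(hx i hi).2] at h1
    rw [(hx j hj).2, ← he] at h2
    rcases lt_or_gt_of_ne hij with h | h
    · have : (i:ℝ) + 1 ≤ j := by exact_mod_cast h
      linarith
    · have : (j:ℝ) + 1 ≤ i := by exact_mod_cast h
      linarith
  rcases exists_coord a b with h | h
  · rw [h] at hab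
    rcases lt_abs.1 hab with h' | h'
    · exact main Prod.fst continuous_fst (fun x y => (coord_le x y).1) b hb a ha h'
    · exact main Prod.fst continuous_fst (fun x y => (coord_le x y).1) a ha b hb (by linarith)
  · rw [h] at hab
    rcases lt_abs.1 hab with h' | h'
    · exact main Prod.snd continuous_snd (fun x y => (coord_le x y).2) b hb a ha h'
    · exact main Prod.snd continuous_snd (fun x y => (coord_le x y).2) a ha b hb (by linarith)

/-- orientation -/
def sw (o : Bool) (x : R2) : R2 := if o then x else Prod.swap x

theorem sw_cont (o : Bool) : Continuous (sw o) := by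
  unfold sw; cases o
  · exact continuous_swap
  · exact continuous_id
theorem sw_inj (o : Bool) : Function.Injective (sw o) := by
  unfold sw; cases o
  · exact Prod.swap_injective
  · exact Function.injective_id
theorem sw_dist (o : Bool) (x y : R2) : dist (sw o x) (sw o y) = dist x y := by
  unfold sw; cases o
  · simp [Prod.dist_eq, max_comm]
  · simp

theorem seg_strip {s t w : ℝ} (hw : 0 < w) (h : 3 * w ≤ t - s) (hs : |s| ≤ 3) (K0 : ℤ) (hK : 3 / w + 1 ≤ K0) :
    ∃ k ∈ Finset.Icc (-K0) K0, s ≤ k * w ∧ k * w + w ≤ t := by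
  have h1 := Int.le_ceil (s / w)
  have h2 := Int.ceil_lt_add_one (s / w)
  rw [div_le_iff₀ hw] at h1
  have h2' : (⌈s / w⌉ : ℝ) * w < s + w := by
    have := mul_lt_mul_of_pos_right h2 hw
    rw [add_mul, div_mul_cancel₀ _ hw.ne'] at this; linarith
  rw [abs_le] at hs
  have hK' : 3 + w ≤ K0 * w := by
    have := mul_le_mul_of_nonneg_right hK hw.le
    rw [add_mul, div_mul_cancel₀ _ hw.ne'] at this; linarith
  refine ⟨⌈s / w⌉, ?_, h1, by linarith⟩
  rw [Finset.mem_Icc]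
  constructor
  · have : -(K0:ℝ) ≤ (⌈s / w⌉ : ℝ) := by
      by_contra hc
      push Not at hc
      nlinarith
    exact_mod_cast this
  · have : (⌈s / w⌉ : ℝ) ≤ (K0:ℝ) := by
      by_contra hc
      push Not at hc
      nlinarith
    exact_mod_cast this

namespace Frice
variable {F : R2 ≃ₜ R2}

theorem link (hF : Frice F) : ∃ A J v, UC F A ∧ SC F J ∧ v ≠ 0 ∧ (∃ a ∈ J, a ∈ A) ∧
    ∃ b ∈ J, b + zr v ∈ A := by
  obtain ⟨δu, hδu, hPu⟩ := hF.E2 1 one_pos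
  set w := δu / 3 with hw
  have hw0 : 0 < w := by positivity
  obtain ⟨δs, hδs, hJs⟩ := hF.inv.E2 (min 1 (w / 16)) (by positivity)
  obtain ⟨η0, hη0, hsep⟩ := hF.etaSep 2 δs hδs
  set η := min η0 (w / 8) with hη
  have hηp : 0 < η := by positivity
  obtain ⟨K0, hK0⟩ := exists_int_gt (3 / w + 1)
  -- data at a point
  have cell : ∀ x : R2, ∃ (o : Bool) (k : ℤ) (Pf P J : Set R2) (l r : ℝ), dist x 0 ≤ 1 →
      k ∈ Finset.Icc (-K0) K0 ∧ IsContinuum Pf ∧ Unst F 2 Pf ∧ x ∈ Pf ∧ P ⊆ Pf ∧ IsContinuum P ∧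
      IsContinuum J ∧ Stab F 2 J ∧ (∃ a ∈ J, ∃ b ∈ J, δs ≤ dist a b) ∧ (P ∩ J).Nonempty ∧
      J ⊆ closedBall 0 10 ∧ (∀ p ∈ P, k * w ≤ (sw o p).1 ∧ (sw o p).1 ≤ k * w + w) ∧
      (∀ p ∈ J, k * w + w / 4 ≤ (sw o p).1 ∧ (sw o p).1 ≤ k * w + 3 * w / 4) ∧
      (∃ p ∈ P, sw o p = (k * w, l)) ∧ (∃ p ∈ P, sw o p = (k * w + w, r)) := by
    intro x
    by_cases hx0 : dist x 0 ≤ 1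
    swap
    · exact ⟨true, 0, ∅, ∅, ∅, 0, 0, fun h => absurd h hx0⟩
    obtain ⟨Pf, hPf, hxP, ⟨a, haP, had⟩, hU⟩ := hPu x
    rw [mul_one] at hU
    have hPb : ∀ p ∈ Pf, dist p 0 ≤ 3 := by
      intro p hp
      have := hU 0 p hp x hxP
      simp only [Nat.cast_zero, neg_zero, It_zero] at this
      have := dist_triangle p x 0
      linarith
    have ho : ∃ o, ∃ a ∈ Pf, ∃ b ∈ Pf, 3 * w ≤ (sw o a).1 - (sw o b).1 := by
      have hw3 : 3 * w = δu := by rw [hw]; ring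
      rw [hw3]
      rcases exists_coord a x with h | h
      · rw [h] at had
        rcases le_abs.1 had with h' | h'
        · exact ⟨true, a, haP, x, hxP, by simpa [sw] using h'⟩
        · exact ⟨true, x, hxP, a, haP, by simp [sw]; linarith⟩
      · rw [h] at had
        rcases le_abs.1 had with h' | h'
        · exact ⟨false, a, haP, x, hxP, by simpa [sw] using h'⟩
        · exact ⟨false, x, hxP, a, haP, by simp [sw]; linarith⟩
    obtain ⟨o, t, ht, s, hs, hst⟩ := ho
    have hs3 : |(sw o s).1| ≤ 3 := by
      have h1 := (coord_le (sw o s) (sw o 0)).1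
      rw [sw_dist] at h1
      have e : (sw o (0:R2)).1 = 0 := by cases o <;> simp [sw]
      rw [e, sub_zero] at h1
      exact h1.trans (hPb s hs)
    obtain ⟨k, hk, hk1, hk2⟩ := seg_strip hw0 hst hs3 K0 hK0.le
    have hcf : Continuous (fun p => (sw o p).1) := continuous_fst.comp (sw_cont o)
    obtain ⟨P, hPs, hP, hPst, ⟨p1, hp1, hp1'⟩, ⟨p2, hp2, hp2'⟩⟩ := stripSub (fun p => (sw o p).1)
      hcf Pf hPf (k * w) (k * w + w) (by linarith) hs hk1 ht hk2
    obtain ⟨z, hz, hzm⟩ := hP.2.isPreconnected.intermediate_value hp1 hp2 hcf.continuousOn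
      (show k * w + w / 2 ∈ Icc ((sw o p1).1) ((sw o p2).1) by rw [hp1', hp2']; constructor <;> linarith)
    obtain ⟨J, hJ, hzJ, ⟨b, hb, hbd⟩, hJS⟩ := hJs z
    rw [unst_inv] at hJS
    have hJz : ∀ p ∈ J, dist p z ≤ 2 * min 1 (w / 16) := by
      intro p hp
      have := hJS 0 p hp z hzJ
      simpa only [Nat.cast_zero, It_zero] using this
    have m1 := min_le_left 1 (w / 16)
    have m2 := min_le_right 1 (w / 16)
    refine ⟨o, k, Pf, P, J, (sw o p1).2, (sw o p2).2, fun _ => ⟨hk, hPf, hU, hxP, hPs, hP, hJ,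
      hJS.le (by linarith), ⟨b, hb, z, hzJ, hbd⟩, ⟨z, hz, hzJ⟩, ?_, hPst, ?_, ⟨p1, hp1, ?_⟩, ⟨p2, hp2, ?_⟩⟩⟩
    · intro p hp
      rw [mem_closedBall]
      have := hJz p hp
      have := hPb z (hPs hz)
      have := dist_triangle p z 0
      linarith
    · intro p hp
      have h1 := (coord_le (sw o p) (sw o z)).1
      rw [sw_dist] at h1
      have h2 := abs_le.1 (h1.trans (hJz p hp))
      simp only at hzm
      rw [hzm] at h2
      constructor <;> linarith
    · exact Prod.ext hp1' rfl
    · exact Prod.ext hp2' rfl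
  choose o k Pf P J l r hcell using cell
  -- finite cover
  obtain ⟨t, -, ht, hcov⟩ := (isCompact_closedBall (0:R2) 10).finite_cover_balls (e := η / 4) (by positivity)
  classical
  let T : Finset (Bool × ℤ × Finset R2) := Finset.univ ×ˢ (Finset.Icc (-K0) K0 ×ˢ ht.toFinset.powerset)
  obtain ⟨A, hA, a, ha, b, hb, hab⟩ := hF.largeUnst (3 * ((T.card * 2 + 1 : ℕ) : ℝ))
  obtain ⟨x, v, hxv, hvne⟩ := manyPts A hA.1 _ a b ha hb hab
  let X : ℕ → R2 := fun i => x i - zr (v i)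
  have hX : ∀ i < T.card * 2 + 1, dist (X i) 0 ≤ 1 := by
    intro i hi
    have := (hxv i hi).2
    rw [dist_eq_norm] at this ⊢
    simpa [X] using this
  obtain ⟨y, hy, hcard⟩ := Finset.exists_lt_card_fiber_of_mul_lt_card_of_maps_to
    (s := Finset.range (T.card * 2 + 1)) (t := T) (n := 2)
    (f := fun i => (o (X i), k (X i), ht.toFinset.filter (fun q => (J (X i) ∩ ball q (η / 4)).Nonempty)))
    (by
      intro i hi
      have := (hcell (X i) (hX i (Finset.mem_range.1 hi))).1
      simp only [T, Finset.mem_product, Finset.mem_univ, true_and, Finset.mem_powerset]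
      exact ⟨this, Finset.filter_subset _ _⟩) (by simp)
  obtain ⟨i1, h1, i2, h2, i3, h3, h12, h13, h23⟩ := Finset.two_lt_card.1 hcard
  simp only [Finset.mem_filter, Finset.mem_range] at h1 h2 h3
  -- a pair gives a link
  have pair : ∀ i < T.card * 2 + 1, ∀ j < T.card * 2 + 1, i ≠ j → ∀ p ∈ P (X j), (p ∈ P (X i) ∨ p ∈ J (X i)) →
      ∃ A J v, UC F A ∧ SC F J ∧ v ≠ 0 ∧ (∃ a ∈ J, a ∈ A) ∧ ∃ b ∈ J, b + zr v ∈ A := by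
    intro i hi j hj hij p hpj hp
    obtain ⟨-, ci, ui, xi, si, -, hJi, hJS, -, ⟨z, hzP, hzJ⟩, -⟩ := hcell (X i) (hX i hi)
    obtain ⟨-, cj, uj, xj, sj, -⟩ := hcell (X j) (hX j hj)
    have ui' : UC F (tr (v i) (Pf (X i))) := hF.uc_tr ⟨ci, _, ui⟩ _
    have uj' : UC F (tr (v j) (Pf (X j))) := hF.uc_tr ⟨cj, _, uj⟩ _
    have hA1 : UC F ((A ∪ tr (v i) (Pf (X i))) ∪ tr (v j) (Pf (X j))) := (hA.union ui'
      ⟨x i, (hxv i hi).1, mem_tr.2 xi⟩).union uj' ⟨x j, Or.inl (hxv j hj).1, mem_tr.2 xj⟩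
    have hA2 := hF.uc_tr hA1 (-v i)
    refine ⟨_, if p ∈ J (X i) then J (X i) else {p}, v j - v i, hA2, ?_, sub_ne_zero.2 (hvne j hj i hi hij.symm), ?_, ?_⟩
    · split_ifs
      · exact ⟨hJi, _, hJS⟩
      · exact sc_singleton F p
    · split_ifs with hpJ
      · refine ⟨z, hzJ, mem_tr.2 (Or.inl (Or.inr (mem_tr.2 ?_)))⟩
        simpa using si hzP
      · refine ⟨p, rfl, mem_tr.2 (Or.inl (Or.inr (mem_tr.2 ?_)))⟩
        simpa using si (hp.resolve_right hpJ)
    · refine ⟨p, by split_ifs with h; exacts [h, rfl], mem_tr.2 (Or.inr (mem_tr.2 ?_))⟩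
      have e : p + zr (v j - v i) - zr (-v i) - zr (v j) = p := by simp only [map_sub, map_neg]; abel
      rw [e]; exact sj hpj
  -- three ordered
  have tri : ∀ i j m : ℕ, (i < T.card * 2 + 1 ∧ (o (X i), k (X i), ht.toFinset.filter (fun q => (J (X i) ∩ ball q (η / 4)).Nonempty)) = y) →
      (j < T.card * 2 + 1 ∧ (o (X j), k (X j), ht.toFinset.filter (fun q => (J (X j) ∩ ball q (η / 4)).Nonempty)) = y) →
      (m < T.card * 2 + 1 ∧ (o (X m), k (X m), ht.toFinset.filter (fun q => (J (X m) ∩ ball q (η / 4)).Nonempty)) = y) →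
      l (X i) < l (X j) → l (X j) < l (X m) → 
      ∃ A J v, UC F A ∧ SC F J ∧ v ≠ 0 ∧ (∃ a ∈ J, a ∈ A) ∧ ∃ b ∈ J, b + zr v ∈ A := by
    rintro i j m ⟨hi, rfl⟩ ⟨hj, hje⟩ ⟨hm, hme⟩ hij hjm
    simp only [Prod.mk.injEq] at hje hme
    obtain ⟨oj, kj, Jj⟩ := hje
    obtain ⟨om, km, Jm⟩ := hme
    obtain ⟨-, -, -, -, -, cPi, cJi, -, -, mi, -, si, ti, ⟨pi, hpi, epi⟩, -⟩ := hcell (X i) (hX i hi)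
    obtain ⟨-, -, -, -, -, cPm, cJm, -, -, mm, -, sm, tm, ⟨pm, hpm, epm⟩, -⟩ := hcell (X m) (hX m hm)
    obtain ⟨-, -, uj, -, pj, cPj, cJj, sJj, dj, -, bj, sj, tj, ⟨q1, hq1, eq1⟩, ⟨q2, hq2, eq2⟩⟩ := hcell (X j) (hX j hj)
    rw [oj, kj] at sj tj eq1 eq2
    rw [om, km] at sm tm epm
    obtain ⟨y, hyJ, hyP⟩ := hsep _ _ cJj sJj dj uj
    obtain ⟨q, hq, hyq⟩ := mem_iUnion₂.1 (hcov (bj hyJ))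
    have hqj : q ∈ ht.toFinset.filter (fun q => (J (X j) ∩ ball q (η / 4)).Nonempty) :=
      Finset.mem_filter.2 ⟨by simpa using hq, y, hyJ, hyq⟩
    have hqi := hqj
    rw [Jj] at hqi
    have hqm := hqi
    rw [← Jm] at hqm
    obtain ⟨yi, hyi, hyiq⟩ := (Finset.mem_filter.1 hqi).2
    obtain ⟨ym, hym, hymq⟩ := (Finset.mem_filter.1 hqm).2
    have near : ∀ y' ∈ ball q (η / 4), sw (o (X i)) y' ∈ closedBall (sw (o (X i)) y) (η / 2) := by
      intro y' hy'
      rw [mem_closedBall, sw_dist]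
      rw [mem_ball] at hy' hyq
      have := dist_triangle_right y' y q
      linarith
    set φ := sw (o (X i)) with hφ
    have hφc : Continuous φ := sw_cont _
    have n1 : η ≤ η0 := min_le_left _ _
    have n2 : η ≤ w / 8 := min_le_right _ _
    have hyb := tj y hyJ
    obtain ⟨p, hp, hcase⟩ := threeCross (k (X i) * w) (k (X i) * w + w) (φ '' P (X i)) (φ '' P (X j))
      (φ '' P (X m)) (φ '' J (X i)) (φ '' J (X m)) (cPi.image hφc) (cPj.image hφc) (cPm.image hφc)
      (cJi.image hφc) (cJm.image hφc) (by rintro _ ⟨p, hp, rfl⟩; exact si p hp)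
      (by rintro _ ⟨p, hp, rfl⟩; exact sj p hp) (by rintro _ ⟨p, hp, rfl⟩; exact sm p hp)
      (by rintro _ ⟨p, hp, rfl⟩; have := ti p hp; constructor <;> linarith)
      (by rintro _ ⟨p, hp, rfl⟩; have := tm p hp; constructor <;> linarith)
      (by obtain ⟨z, h1, h2⟩ := mi; exact ⟨_, mem_image_of_mem _ h1, mem_image_of_mem _ h2⟩)
      (by obtain ⟨z, h1, h2⟩ := mm; exact ⟨_, mem_image_of_mem _ h1, mem_image_of_mem _ h2⟩)
      (φ y) (η / 2) (by positivity) (by linarith) (by linarith)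
      ⟨_, mem_image_of_mem _ hyi, near _ hyiq⟩ ⟨_, mem_image_of_mem _ hym, near _ hymq⟩
      (by
        rintro _ ⟨p, hp, rfl⟩ hc
        rw [mem_closedBall, sw_dist, dist_comm] at hc
        have := hyP p (pj hp)
        linarith)
      (l (X i)) (l (X j)) (l (X m)) (r (X j)) ⟨_, hpi, epi⟩ ⟨_, hq1, eq1⟩ ⟨_, hpm, epm⟩ ⟨_, hq2, eq2⟩ hij hjm
    obtain ⟨p, hp, rfl⟩ := hp
    have hφi := sw_inj (o (X i))
    rw [hφi.mem_set_image, hφi.mem_set_image, hφi.mem_set_image, hφi.mem_set_image] at hcase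
    rcases hcase with h | h | h | h
    · exact pair i hi j hj (by rintro rfl; exact lt_irrefl _ hij) p hp (Or.inl h)
    · exact pair i hi j hj (by rintro rfl; exact lt_irrefl _ hij) p hp (Or.inr h)
    · exact pair m hm j hj (by rintro rfl; exact lt_irrefl _ hjm) p hp (Or.inl h)
    · exact pair m hm j hj (by rintro rfl; exact lt_irrefl _ hjm) p hp (Or.inr h)
  have eqc : ∀ i j : ℕ, (i < T.card * 2 + 1 ∧ (o (X i), k (X i), ht.toFinset.filter (fun q => (J (X i) ∩ ball q (η / 4)).Nonempty)) = y) →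
      (j < T.card * 2 + 1 ∧ (o (X j), k (X j), ht.toFinset.filter (fun q => (J (X j) ∩ ball q (η / 4)).Nonempty)) = y) →
      i ≠ j → l (X i) = l (X j) → 
      ∃ A J v, UC F A ∧ SC F J ∧ v ≠ 0 ∧ (∃ a ∈ J, a ∈ A) ∧ ∃ b ∈ J, b + zr v ∈ A := by
    rintro i j ⟨hi, rfl⟩ ⟨hj, hje⟩ hij hl
    simp only [Prod.mk.injEq] at hje
    obtain ⟨oj, kj, Jj⟩ := hje
    obtain ⟨-, -, -, -, -, -, -, -, -, -, -, -, -, ⟨pi, hpi, epi⟩, -⟩ := hcell (X i) (hX i hi)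
    obtain ⟨-, -, -, -, -, -, -, -, -, -, -, -, -, ⟨pj, hpj, epj⟩, -⟩ := hcell (X j) (hX j hj)
    rw [oj, kj, ← hl, ← epi] at epj
    have := sw_inj _ epj
    subst this
    exact pair i hi j hj hij _ hpj (Or.inl hpi)
  rcases lt_trichotomy (l (X i1)) (l (X i2)) with a | a | a
  · rcases lt_trichotomy (l (X i2)) (l (X i3)) with b | b | b
    · exact tri i1 i2 i3 h1 h2 h3 a b
    · exact eqc i2 i3 h2 h3 h23 b
    · rcases lt_trichotomy (l (X i1)) (l (X i3)) with c | c | c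
      · exact tri i1 i3 i2 h1 h3 h2 c b
      · exact eqc i1 i3 h1 h3 h13 c
      · exact tri i3 i1 i2 h3 h1 h2 c a
  · exact eqc i1 i2 h1 h2 h12 a
  · rcases lt_trichotomy (l (X i1)) (l (X i3)) with b | b | b
    · exact tri i2 i1 i3 h2 h1 h3 a b
    · exact eqc i1 i3 h1 h3 h13 b
    · rcases lt_trichotomy (l (X i2)) (l (X i3)) with c | c | c
      · exact tri i2 i3 i1 h2 h3 h1 c b
      · exact eqc i2 i3 h2 h3 h23 c
      · exact tri i3 i2 i1 h3 h2 h1 c a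

end Frice

/-! ### spanning -/

/-- inner product -/
def ip (e x : R2) : ℝ := x.1 * e.1 + x.2 * e.2
/-- l1 norm -/
def n1 (e : R2) : ℝ := |e.1| + |e.2|

theorem n1_nonneg (e : R2) : 0 ≤ n1 e := by unfold n1; positivity
theorem ip_add (e x y : R2) : ip e (x + y) = ip e x + ip e y := by simp [ip]; ring
theorem ip_sub (e x y : R2) : ip e (x - y) = ip e x - ip e y := by simp [ip]; ring
theorem ip_abs (e x : R2) : |ip e x| ≤ ‖x‖ * n1 e := by
  unfold ip n1
  have h1 : |x.1| ≤ ‖x‖ := norm_fst_le x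
  have h2 : |x.2| ≤ ‖x‖ := norm_snd_le x
  calc |x.1 * e.1 + x.2 * e.2| ≤ |x.1 * e.1| + |x.2 * e.2| := abs_add_le _ _
    _ = |x.1| * |e.1| + |x.2| * |e.2| := by rw [abs_mul, abs_mul]
    _ ≤ ‖x‖ * |e.1| + ‖x‖ * |e.2| := by gcongr
    _ = _ := by ring

theorem ip_diff (e x y : R2) : |ip e x - ip e y| ≤ dist x y * n1 e := by
  rw [← ip_sub, dist_eq_norm]; exact ip_abs _ _

def DriftC (F : R2 ≃ₜ R2) (c : ℝ) : Prop := 0 < c ∧ ∀ (n : ℕ) (e : R2), ∃ z : R2,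
    c * n * n1 e ≤ ip e (It F n z - z)

theorem Frice.driftC {F : R2 ≃ₜ R2} (hF : Frice F) : ∃ c, DriftC F c := by
  obtain ⟨c, hc, h⟩ := hF.drift
  exact ⟨c, hc, h⟩

theorem dt_neg (v : ℤ × ℤ) (x : R2) : dt (-v) x = - dt v x := by
  simp [dt]; ring

theorem seg_param {y e x : R2} {s : ℝ} (hs : 0 ≤ s) (hx : x ∈ segment ℝ y (y + s • e)) :
    ∃ t : ℝ, 0 ≤ t ∧ x = y + t • e := by
  obtain ⟨a, b, ha, hb, hab, rfl⟩ := hx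
  refine ⟨b * s, by positivity, ?_⟩
  have : a = 1 - b := by linarith
  subst this
  ext <;> simp <;> ring

theorem span1_aux {F : R2 ≃ₜ R2} (hF : Frice F) {c : ℝ} (hc : DriftC F c) (K : Set R2) (hK : IsContinuum K)
    (v : ℤ × ℤ) (hv : v ≠ 0) (a ρ : ℝ) (h1 : |(v.1:ℝ)| ≤ a) (h2 : |(v.2:ℝ)| ≤ a)
    (hρ : ∀ x ∈ K, dist x 0 ≤ ρ) (x : R2) (hx : x ∈ K) (hxv : x + zr v ∈ K) (n : ℕ) :
    ∃ y ∈ K, c * n - (2 * a * ρ + 2 * a ^ 2 + 1) ≤ dt v (It F n y) := by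
  set e : R2 := (-(v.2:ℝ), (v.1:ℝ)) with he
  have hip : ∀ x, ip e x = dt v x := by intro x; simp [ip, dt, he]; ring
  have ha : 0 ≤ a := (abs_nonneg _).trans h1
  set q : ℝ := (v.1:ℝ) ^ 2 + (v.2:ℝ) ^ 2 with hq
  have hq1 : 1 ≤ q := by
    have : v.1 ≠ 0 ∨ v.2 ≠ 0 := by
      by_contra h; push Not at h; exact hv (Prod.ext h.1 h.2)
    have h3 : (1:ℤ) ≤ v.1 ^ 2 + v.2 ^ 2 := by
      rcases this with h | h
      · nlinarith [sq_nonneg v.2, Int.one_le_abs h, sq_abs v.1]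
      · nlinarith [sq_nonneg v.1, Int.one_le_abs h, sq_abs v.2]
    rw [hq]; exact_mod_cast h3
  have hq2 : q ≤ 2 * a ^ 2 := by
    nlinarith [sq_abs (v.1:ℝ), sq_abs (v.2:ℝ), abs_nonneg (v.1:ℝ), abs_nonneg (v.2:ℝ)]
  have hn1 : 1 ≤ n1 e := by
    have : 1 ≤ n1 e ^ 2 := by
      simp only [n1, he, abs_neg]
      nlinarith [sq_abs (v.1:ℝ), sq_abs (v.2:ℝ), abs_nonneg (v.1:ℝ), abs_nonneg (v.2:ℝ)]
    nlinarith [n1_nonneg e]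
  obtain ⟨z, hz⟩ := hc.2 n e
  rw [ip_sub, hip, hip] at hz
  have hz' : c * n ≤ dt v (It F n z) - dt v z := by
    refine le_trans ?_ hz
    have : 0 ≤ c * n := mul_nonneg hc.1.le (Nat.cast_nonneg n)
    nlinarith
  obtain ⟨k, ⟨hk1, hk2⟩, -⟩ := existsUnique_add_zsmul_mem_Ico (lt_of_lt_of_le one_pos hq1) (dt v z) (-(2*a*ρ) - 1 - q)
  set u : ℤ × ℤ := (-v.2, v.1) with hu
  have hdu : dt v (zr (k • u)) = k • q := by simp [dt, hu, hq]; ring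
  set z1 := z + zr (k • u) with hz1
  have hz1a : dt v z1 = dt v z + k • q := by rw [hz1, dt_add, hdu]
  have hz1b : It F n z1 = It F n z + zr (k • u) := hF.itper _ _ _
  set y0 := It F n z1 with hy0
  have hy0d : c * n ≤ dt v y0 - dt v z1 := by rw [hz1b, hz1a, dt_add, hdu]; linarith
  obtain ⟨Mn, hMn, hM⟩ := hF.disp (-(n:ℤ))
  have hdte : ∀ s : ℝ, dt v (y0 + s • e) = dt v y0 + s * q := by
    intro s; simp [dt, he, hq]; ring
  set s : ℝ := |dt v y0| + 2 * a * Mn + |2 * a * ρ| + 1 with hs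
  have hs0 : 0 ≤ s := by positivity
  set C := It F (-(n:ℤ)) '' segment ℝ y0 (y0 + s • e)
  have hC : IsContinuum C := (isContinuum_segment _ _).image (It_cont _ _)
  have hKl : ∀ k ∈ K, |dt v k| ≤ 2 * a * ρ := by
    intro k hk
    have h := dt_abs_le v a h1 h2 k 0
    have h0 : dt v 0 = 0 := by simp [dt]
    rw [h0, sub_zero] at h
    exact h.trans (by gcongr; exact hρ k hk)
  obtain ⟨l, y, hy, hyC⟩ := LL K hK v hv x hx hxv C hC.1 hC.2.2 z1 (It F (-(n:ℤ)) (y0 + s • e))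
    ⟨y0, left_mem_segment _ _ _, by rw [hy0, It_neg_cancel]⟩ ⟨_, right_mem_segment _ _ _, rfl⟩
    (by
      intro k hk
      have := (abs_le.1 (hKl k hk)).1
      rw [hz1a]; linarith)
    (by
      intro k hk
      have h3 := (abs_le.1 (hKl k hk)).2
      have h4 := dt_abs_le v a h1 h2 (It F (-(n:ℤ)) (y0 + s • e)) (y0 + s • e)
      have h5 : 2 * a * dist (It F (-(n:ℤ)) (y0 + s • e)) (y0 + s • e) ≤ 2 * a * Mn := by
        gcongr; exact hM _
      have h6 := (abs_le.1 h4).1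
      rw [hdte] at h6
      have h7 : s ≤ s * q := by nlinarith
      have h8 := neg_abs_le (dt v y0)
      have h9 := le_abs_self (2 * a * ρ)
      linarith)
  obtain ⟨w, hw, hwe⟩ := hyC
  refine ⟨y, hy, ?_⟩
  obtain ⟨t, ht, rfl⟩ := seg_param hs0 hw
  have h6 : It F n y + zr (l • v) = y0 + t • e := by
    rw [← hF.itper, ← hwe, It_neg_cancel']
  have h7 : dt v (It F n y) = dt v y0 + t * q := by
    rw [← hdte, ← h6, dt_add, dt_self, add_zero]
  rw [h7]
  have : 0 ≤ t * q := by positivity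
  rw [hz1a] at hy0d
  linarith

theorem span1 {F : R2 ≃ₜ R2} (hF : Frice F) {c : ℝ} (hc : DriftC F c) (K : Set R2) (hK : IsContinuum K)
    (v : ℤ × ℤ) (hv : v ≠ 0) (a ρ : ℝ) (h1 : |(v.1:ℝ)| ≤ a) (h2 : |(v.2:ℝ)| ≤ a)
    (hρ : ∀ x ∈ K, dist x 0 ≤ ρ) (x : R2) (hx : x ∈ K) (hxv : x + zr v ∈ K) (n : ℕ) :
    (∃ y ∈ K, c * n - (2 * a * ρ + 2 * a ^ 2 + 1) ≤ dt v (It F n y)) ∧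
    (∃ y ∈ K, dt v (It F n y) ≤ -(c * n - (2 * a * ρ + 2 * a ^ 2 + 1))) := by
  refine ⟨span1_aux hF hc K hK v hv a ρ h1 h2 hρ x hx hxv n, ?_⟩
  obtain ⟨y, hy, h⟩ := span1_aux hF hc K hK (-v) (neg_ne_zero.2 hv) a ρ (by simpa using h1) (by simpa using h2) hρ 
    (x + zr v) hxv (by simpa using hx) n
  rw [dt_neg] at h
  exact ⟨y, hy, by linarith⟩

theorem span2 {F : R2 ≃ₜ R2} (hF : Frice F) {c : ℝ} (hc : DriftC F c) (K : Set R2) (hK : IsContinuum K)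
    (v w : ℤ × ℤ) (a ρ : ℝ) (hv1 : |(v.1:ℝ)| ≤ a) (hv2 : |(v.2:ℝ)| ≤ a)
    (hw1 : |(w.1:ℝ)| ≤ a) (hw2 : |(w.2:ℝ)| ≤ a) (hdet : v.1 * w.2 - v.2 * w.1 ≠ 0)
    (hρ : ∀ x ∈ K, dist x 0 ≤ ρ) (hv : ∃ x ∈ K, x + zr v ∈ K) (hw : ∃ x ∈ K, x + zr w ∈ K) (n : ℕ) (e : R2) :
    ∃ y ∈ K, (c * n - ((2 * a * (4 * a * (2 * ρ) + 2 * a ^ 2 + 1) + 1) + ρ)) * n1 e ≤ ip e (It F n y) := by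
  have ha : 0 ≤ a := (abs_nonneg _).trans hv1
  obtain ⟨x0, hx0⟩ := hK.2.1
  have hρ0 : 0 ≤ ρ := dist_nonneg.trans (hρ x0 hx0)
  rcases eq_or_ne e 0 with rfl | he
  · exact ⟨x0, hx0, by simp [n1, ip]⟩
  set S := 2 * a * (4 * a * (2 * ρ) + 2 * a ^ 2 + 1) + 1 with hS
  have hS0 : 0 ≤ S := by positivity
  obtain ⟨z, hz⟩ := hc.2 n e
  obtain ⟨M1, hM1, hM1'⟩ := hF.disp (-(n:ℤ))
  set y0 := It F n z with hy0
  have hzy : It F (-(n:ℤ)) y0 = z := by rw [hy0, It_neg_cancel]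
  have hen : 0 < ‖e‖ := norm_pos_iff.2 he
  set s := (S + M1 + M1) / ‖e‖ with hs
  have hs0 : 0 ≤ s := by positivity
  set C := It F (-(n:ℤ)) '' segment ℝ y0 (y0 + s • e) with hCdef
  have hC : IsContinuum C := (isContinuum_segment _ _).image (It_cont _ _)
  have hzC : z ∈ C := ⟨y0, left_mem_segment _ _ _, hzy⟩
  have hzC' : It F (-(n:ℤ)) (y0 + s • e) ∈ C := ⟨_, right_mem_segment _ _ _, rfl⟩
  have hfar : S ≤ dist (It F (-(n:ℤ)) (y0 + s • e)) z := by
    have h3 := hM1' (y0 + s • e)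
    have h4 := hM1' y0
    rw [hzy] at h4
    have h5 : dist (y0 + s • e) y0 = S + M1 + M1 := by
      rw [dist_eq_norm, add_sub_cancel_left, norm_smul, Real.norm_eq_abs, abs_of_nonneg hs0, hs]
      field_simp
    have h6 := dist_triangle4 (y0 + s • e) (It F (-(n:ℤ)) (y0 + s • e)) z y0
    rw [dist_comm (y0 + s • e) (It F (-(n:ℤ)) (y0 + s • e))] at h6
    linarith
  obtain ⟨Z, hZC, hZ, hzZ, hZb, p, hpZ, hpd⟩ := bumpBall C hC S hS0 hzC hzC' hfar
  obtain ⟨k, l, y, hy, hyZ⟩ := NL K hK v w a (2*ρ) hv1 hv2 hw1 hw2 hdet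
    (fun x hx y hy => (dist_triangle_right x y 0).trans (by linarith [hρ x hx, hρ y hy])) hv hw Z hZ.1 hZ.2.2 p z hpZ hzZ
    (by rw [hpd, hS]; linarith)
  refine ⟨y, hy, ?_⟩
  have hb := hZb hyZ
  rw [mem_closedBall] at hb
  obtain ⟨x1, hx1, hx1e⟩ := hZC hyZ
  obtain ⟨t, ht, rfl⟩ := seg_param hs0 hx1
  set lam := k • v + l • w
  have h6 : It F n y + zr lam = y0 + t • e := by
    rw [← hF.itper, ← hx1e, It_neg_cancel']
  have h7 : ip e (It F n y) = ip e y0 + t * (e.1^2 + e.2^2) - ip e (zr lam) := by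
    have : ip e (It F n y + zr lam) = ip e y0 + t * (e.1^2 + e.2^2) := by
      rw [h6]; simp [ip]; ring
    rw [ip_add] at this; linarith
  have h8 := (abs_le.1 (ip_diff e (y + zr lam) z)).2
  rw [ip_add] at h8
  have h9 : |ip e y| ≤ ρ * n1 e := (ip_abs e y).trans (by
    have := hρ y hy
    rw [dist_zero_right] at this
    exact mul_le_mul_of_nonneg_right this (n1_nonneg e))
  have h10 := (abs_le.1 h9).1
  have h11 : dist (y + zr lam) z * n1 e ≤ S * n1 e := mul_le_mul_of_nonneg_right hb (n1_nonneg e)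
  have h12 : 0 ≤ t * (e.1^2 + e.2^2) := by positivity
  rw [ip_sub] at hz
  rw [h7]
  have : (c * n - (S + ρ)) * n1 e = c * n * n1 e - S * n1 e - ρ * n1 e := by ring
  rw [this]; linarith

theorem Stab.dist0 {F : R2 ≃ₜ R2} {M : ℝ} {A : Set R2} (h : Stab F M A) (n : ℕ) {a b : R2} (ha : a ∈ A) (hb : b ∈ A) :
    dist (It F n a) (It F n b) ≤ M := h n a ha b hb

theorem Frice.net {F : R2 ≃ₜ R2} (hF : Frice F) : ∃ (J A1 A2 : Set R2) (D ρ1 : ℝ), 0 < D ∧ 0 < ρ1 ∧ SC F J ∧ UC F A1 ∧ UC F A2 ∧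
    (∀ x ∈ J ∪ (A1 ∪ A2), dist x 0 ≤ ρ1) ∧
    ∀ C, IsContinuum C → ∀ p ∈ C, ∀ q ∈ C, D < dist p q → ∃ l : ℤ × ℤ, ∃ x ∈ C, x - zr l ∈ J ∪ (A1 ∪ A2) := by
  obtain ⟨A, J, v, hA, hJ, hv, ⟨a0, ha0J, ha0A⟩, b, hbJ, hbA⟩ := hF.link
  obtain ⟨c, hc⟩ := hF.driftC
  obtain ⟨MJ, hMJ⟩ := hJ.2
  have hK0 : IsContinuum (J ∪ A) := hJ.1.union hA.1 ⟨a0, ha0J, ha0A⟩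
  obtain ⟨B, hB, hBd⟩ := hK0.bdd
  set a : ℝ := max |(v.1:ℝ)| |(v.2:ℝ)| with ha
  have h1 : |(v.1:ℝ)| ≤ a := le_max_left _ _
  have h2 : |(v.2:ℝ)| ≤ a := le_max_right _ _
  have ha' : 0 ≤ a := (abs_nonneg _).trans h1
  set u : ℤ × ℤ := (-v.2, v.1) with hu
  set q : ℝ := dt v (zr u) with hq
  set C0 := 2 * a * B + 2 * a ^ 2 + 1
  obtain ⟨n, hn⟩ := exists_nat_gt ((C0 + 2 * a * MJ + |q| + 2 * a * B) / c)
  rw [div_lt_iff₀ hc.1] at hn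
  obtain ⟨⟨y1, hy1, hy1d⟩, y2, hy2, hy2d⟩ := span1 hF hc _ hK0 v hv a B h1 h2 hBd b (Or.inl hbJ) (Or.inr hbA) n
  have hrep : ∀ y ∈ J ∪ A, ∃ y' ∈ A, |dt v (It F n y) - dt v (It F n y')| ≤ 2 * a * MJ := by
    rintro y (hy | hy)
    · exact ⟨a0, ha0A, (dt_abs_le v a h1 h2 _ _).trans (by gcongr; exact hMJ.dist0 n hy ha0J)⟩
    · refine ⟨y, hy, ?_⟩
      have : 0 ≤ MJ := dist_nonneg.trans (hMJ.dist0 n ha0J ha0J)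
      rw [sub_self, abs_zero]; positivity
  obtain ⟨z1, hz1, hz1d⟩ := hrep y1 hy1
  obtain ⟨z2, hz2, hz2d⟩ := hrep y2 hy2
  have hA' : UC F (It F n '' A) := hF.uc_image hA n
  have hKl : ∀ k ∈ J ∪ A, |dt v k| ≤ 2 * a * B := by
    intro k hk
    have h := dt_abs_le v a h1 h2 k 0
    have h0 : dt v 0 = 0 := by simp [dt]
    rw [h0, sub_zero] at h
    exact h.trans (by gcongr; exact hBd k hk)
  have key : ∀ w : ℤ × ℤ, |dt v (zr w)| ≤ |q| → ∃ k : ℤ, ∃ y ∈ J ∪ A, y + zr (k • v + w) ∈ It F n '' A := by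
    intro w hw
    obtain ⟨k, y, hy, hyC⟩ := LL (tr w (J ∪ A)) (hK0.tr w) v hv (b + zr w) (add_mem_tr (Or.inl hbJ))
      (by rw [add_right_comm]; exact add_mem_tr (Or.inr hbA)) (It F n '' A) hA'.1.1 hA'.1.2.2
      (It F n z2) (It F n z1) ⟨_, hz2, rfl⟩ ⟨_, hz1, rfl⟩
      (by
        rintro _ ⟨k, hk, rfl⟩
        simp only [dt_add]
        have e1 := abs_le.1 (hKl k hk)
        have e2 := abs_le.1 hw
        have e3 := abs_le.1 hz2d
        linarith)
      (by
        rintro _ ⟨k, hk, rfl⟩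
        simp only [dt_add]
        have e1 := abs_le.1 (hKl k hk)
        have e2 := abs_le.1 hw
        have e3 := abs_le.1 hz1d
        linarith)
    obtain ⟨y, hy', rfl⟩ := hy
    exact ⟨k, y, hy', by rw [map_add, add_comm (zr (k • v)), ← add_assoc]; exact hyC⟩
  obtain ⟨k1, p1, hp1, hp1'⟩ := key 0 (by simp [dt])
  obtain ⟨k2, p2, hp2, hp2'⟩ := key u le_rfl
  rw [add_zero] at hp1'
  set A2 := tr (-(k1 • v)) (It F n '' A) with hA2
  have hA2u : UC F A2 := hF.uc_tr hA' _
  have hp1A : p1 ∈ A2 := by rw [hA2, mem_tr]; simpa using hp1'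
  set w := (k2 - k1) • v + u with hw
  have hp2A : p2 + zr w ∈ A2 := by
    rw [hA2, mem_tr]
    convert hp2' using 1
    rw [add_sub_assoc, ← map_sub, hw]
    congr 2
    rw [sub_smul]; abel
  have hK1 : IsContinuum (J ∪ (A ∪ A2)) := by
    rw [← union_assoc]
    exact hK0.union hA2u.1 ⟨p1, hp1, hp1A⟩
  obtain ⟨ρ1, hρ1, hρdd⟩ := hK1.bdd
  set a' : ℝ := max a (max |(w.1:ℝ)| |(w.2:ℝ)|)
  refine ⟨J, A, A2, 2 * a' * (4 * a' * (2 * ρ1) + 2 * a' ^ 2 + 1) + 1, ρ1, by positivity, hρ1, hJ, hA, hA2u, hρdd, ?_⟩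
  intro C hC p hp q' hq' hd
  obtain ⟨k, l, y, hy, hyC⟩ := NL (J ∪ (A ∪ A2)) hK1 v w a' (2 * ρ1) (h1.trans (le_max_left _ _)) (h2.trans (le_max_left _ _))
    ((le_max_left _ _).trans (le_max_right _ _)) ((le_max_right _ _).trans (le_max_right _ _))
    (by
      simp only [hw, hu, Prod.snd_add, Prod.fst_add, Prod.smul_fst, Prod.smul_snd, smul_eq_mul]
      intro h
      have h3 : v.1 ^ 2 + v.2 ^ 2 = 0 := by linear_combination h
      apply hv
      ext
      · simp; nlinarith [sq_nonneg v.1, sq_nonneg v.2]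
      · simp; nlinarith [sq_nonneg v.1, sq_nonneg v.2])
    (fun x hx y hy => (dist_triangle_right x y 0).trans (by linarith [hρdd x hx, hρdd y hy]))
    ⟨b, Or.inl hbJ, Or.inr (Or.inl hbA)⟩
    ⟨p2, by rw [← union_assoc]; exact Or.inl hp2, Or.inr (Or.inr hp2A)⟩ C hC.1 hC.2.2 p q' hp hq' (by linarith)
  exact ⟨k • v + l • w, _, hyC, by simpa using hy⟩

/-! ### the kit -/

/-- weak crossing from J to J + v -/
def WC (J : Set R2) (ρ : ℝ) (v : ℤ × ℤ) (X : Set R2) : Prop :=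
  IsContinuum X ∧ (∀ x ∈ X, dist x 0 < ρ) ∧ (∃ x ∈ X, x ∈ J) ∧ ∃ x ∈ X, x - zr v ∈ J

def Ty (rt : ℝ) (v : ℤ × ℤ) : Prop := v ≠ 0 ∧ dist (zr v) 0 ≤ rt

structure Kit (F : R2 ≃ₜ R2) (J : Set R2) (rt ρ M M' : ℝ) (i1 : ℕ) : Prop where
  rt0 : 0 ≤ rt
  rho2 : 2 ≤ ρ
  M0 : 0 < M
  M0' : 0 ≤ M'
  sc : SC F J
  jb : ∀ x ∈ J, dist x 0 < ρ
  jv : ∀ v, Ty rt v → ∀ x ∈ J, dist (x + zr v) 0 < ρ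
  hit : ∀ X, IsContinuum X → (∀ x ∈ X, dist x 0 ≤ ρ) → ∀ i : ℕ, i1 ≤ i → ∀ y ∈ It F i '' X, ∀ y2 ∈ It F i '' X,
    M ≤ dist y y2 → ∃ p v Z, Ty rt v ∧ Z ⊆ It F i '' X ∧ WC J ρ v (tr (-p) Z) ∧ dist (zr p) y ≤ M'

theorem three_pts (y1 y2 y3 o1 o2 : R2) (T : ℝ) (h12 : 2 * T < dist y1 y2) (h13 : 2 * T < dist y1 y3)
    (h23 : 2 * T < dist y2 y3) : ∃ y, (y = y1 ∨ y = y2 ∨ y = y3) ∧ T < dist y o1 ∧ T < dist y o2 := by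
  by_contra h
  push Not at h
  have a1 := h y1 (by simp)
  have a2 := h y2 (by simp)
  have a3 := h y3 (by simp)
  have t1 := dist_triangle_right y1 y2 o1
  have t2 := dist_triangle_right y1 y2 o2
  have t3 := dist_triangle_right y1 y3 o1
  have t4 := dist_triangle_right y1 y3 o2
  have t5 := dist_triangle_right y2 y3 o1
  have t6 := dist_triangle_right y2 y3 o2
  by_cases b1 : T < dist y1 o1 <;> by_cases b2 : T < dist y2 o1 <;> by_cases b3 : T < dist y3 o1 <;>
  first
  | (have := a1 b1; first | (have := a2 b2; linarith) | (have := a3 b3; linarith) | linarith)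
  | (have := a2 b2; first | (have := a3 b3; linarith) | linarith)
  | linarith

theorem Frice.kit {F : R2 ≃ₜ R2} (hF : Frice F) : ∃ J rt ρ M M' i1, Kit F J rt ρ M M' i1 := by
  obtain ⟨J, A1, A2, D, ρ1, hD, hρ1, hJ, hA1, hA2, hb, hnet⟩ := hF.net
  set R0 := D + 1 + ρ1 with hR0
  set Rg := 2 * R0 + 1 with hRg
  set rt := Rg + 2 * R0 with hrt
  set ρ := rt + ρ1 + Rg + R0 + 2 with hρ
  set E := ρ1 + ρ + 1 with hE
  set H := 2 * (Rg + E) + 1 with hH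
  obtain ⟨MA1, hM1⟩ := hA1.2
  obtain ⟨MA2, hM2⟩ := hA2.2
  obtain ⟨T1, hT1⟩ := hF.inv.E1 MA1 1 one_pos
  obtain ⟨T2, hT2⟩ := hF.inv.E1 MA2 1 one_pos
  refine ⟨J, rt, ρ, 2 * H, 2 * H + R0, max T1 T2, ?_⟩
  have hexc : ∀ X : Set R2, (∀ x ∈ X, dist x 0 ≤ ρ) → ∀ i : ℕ, ∀ A : Set R2, (∀ x ∈ A, dist x 0 ≤ ρ1) → ∀ a ∈ A,
      (∀ x ∈ A, ∀ y ∈ A, dist (It F⁻¹ i x) (It F⁻¹ i y) < 1) → 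
      ∀ x ∈ It F i '' X, ∀ l, x - zr l ∈ A → dist x (-It F (-(i:ℤ)) a) ≤ E := by
    rintro X hX i A hA a ha hAd _ ⟨ξ, hξ, rfl⟩ l hl
    have h1 := hAd _ hl _ ha
    rw [It_inv, It_inv, sub_eq_add_neg, ← map_neg, hF.itper, It_neg_cancel] at h1
    have h2 := hA _ hl
    have h3 := hX ξ hξ
    rw [dist_eq_norm] at *
    rw [map_neg] at h1
    have e : It F i ξ - -It F (-(i:ℤ)) a = (It F i ξ - zr l - 0) - (ξ + -zr l - It F (-(i:ℤ)) a) + (ξ - 0) := by abel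
    rw [e]
    have h4 := norm_add_le ((It F i ξ - zr l - 0) - (ξ + -zr l - It F (-(i:ℤ)) a)) (ξ - 0)
    have h5 := norm_sub_le (It F i ξ - zr l - 0) (ξ + -zr l - It F (-(i:ℤ)) a)
    linarith
  have hrho : 2 ≤ ρ := by
    have : 0 ≤ rt := by positivity
    have : 0 ≤ Rg := by positivity
    have : 0 ≤ R0 := by positivity
    linarith
  refine ⟨by positivity, hrho, by positivity, by positivity, hJ, ?_, ?_, ?_⟩
  · intro x hx
    have := hb x (Or.inl hx)
    have : 0 ≤ rt := by positivity
    have : 0 ≤ Rg := by positivity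
    have : 0 ≤ R0 := by positivity
    linarith
  · intro v hv x hx
    have h1 := hb x (Or.inl hx)
    have h2 := hv.2
    rw [dist_zero_right] at *
    have := norm_add_le x (zr v)
    have : 0 ≤ Rg := by positivity
    have : 0 ≤ R0 := by positivity
    linarith
  · intro X hX hXρ i hi y hy y2 hy2 hyy
    have hR0p : 0 < R0 := by positivity
    have hRgp : 0 < Rg := by positivity
    have hEp : 0 < E := by positivity
    set Y := It F i '' X with hY
    have hYc : IsContinuum Y := hX.image (It_cont _ _)
    obtain ⟨Z1, hZ1Y, hZ1, hyZ1, -, x3, hx3, hx3d⟩ := bumpBall Y hYc (2 * H) (by positivity) hy hy2 (by rwa [dist_comm])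
    obtain ⟨Z2, hZ2Y, hZ2, hyZ2, -, x2, hx2, hx2d⟩ := bumpBall Y hYc H (by positivity) hy (hZ1Y hx3) (by rw [hx3d]; linarith)
    obtain ⟨a1, ha1⟩ := hA1.1.2.1
    obtain ⟨a2, ha2⟩ := hA2.1.2.1
    set o1 := -It F (-(i:ℤ)) a1 with ho1
    set o2 := -It F (-(i:ℤ)) a2 with ho2
    have hex1 : ∀ x ∈ Y, ∀ l, x - zr l ∈ A1 → dist x o1 ≤ E :=
      hexc X hXρ i A1 (fun x hx => hb x (Or.inr (Or.inl hx))) a1 ha1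
        (fun x hx y hy => hT1 A1 hA1.1 (stab_inv.2 hM1) i ((le_max_left _ _).trans hi) x hx y hy)
    have hex2 : ∀ x ∈ Y, ∀ l, x - zr l ∈ A2 → dist x o2 ≤ E :=
      hexc X hXρ i A2 (fun x hx => hb x (Or.inr (Or.inr hx))) a2 ha2
        (fun x hx y hy => hT2 A2 hA2.1 (stab_inv.2 hM2) i ((le_max_right _ _).trans hi) x hx y hy)
    have d23 : H ≤ dist x2 x3 := by
      have := dist_triangle x3 x2 y
      rw [dist_comm x3 x2] at this; linarith
    obtain ⟨ys, hys, hs1, hs2⟩ := three_pts y x2 x3 o1 o2 (Rg + E) (by rw [dist_comm]; linarith) 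
      (by rw [dist_comm]; linarith) (by linarith)
    have hysY : ys ∈ Y := by
      rcases hys with rfl | rfl | rfl
      · exact hy
      · exact hZ2Y hx2
      · exact hZ1Y hx3
    have hysd : dist ys y ≤ 2 * H := by
      rcases hys with rfl | rfl | rfl
      · rw [dist_self]; positivity
      · linarith
      · linarith
    obtain ⟨yo, hyo, hyod⟩ : ∃ yo ∈ Y, Rg ≤ dist yo ys := by
      rcases hys with rfl | rfl | rfl
      · exact ⟨x2, hZ2Y hx2, by linarith⟩
      · exact ⟨y, hy, by rw [dist_comm]; linarith⟩
      · exact ⟨y, hy, by rw [dist_comm]; linarith⟩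
    obtain ⟨Z, hZY, hZ, hysZ, hZb, x, hxZ, hxd⟩ := bumpBall Y hYc Rg hRgp.le hysY hyo hyod
    have hJhit : ∀ w ∈ Z, ∀ w' ∈ Z, D + 1 ≤ dist w' w → ∃ l : ℤ × ℤ, ∃ x ∈ Z, x - zr l ∈ J ∧ dist x w ≤ D + 1 := by
      intro w hw w' hw' hd
      obtain ⟨W, hWZ, hW, hwW, hWb, w2, hw2, hw2d⟩ := bumpBall Z hZ (D + 1) (by positivity) hw hw' hd
      obtain ⟨l, x, hx, hl⟩ := hnet W hW w2 hw2 w hwW (by rw [hw2d]; linarith)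
      have hxy := hZb (hWZ hx)
      rw [mem_closedBall] at hxy
      refine ⟨l, x, hWZ hx, ?_, hWb hx⟩
      rcases hl with h | h | h
      · exact h
      · have h3 := hex1 x (hZY (hWZ hx)) l h
        have := dist_triangle ys x o1
        rw [dist_comm ys x] at this; linarith
      · have h3 := hex2 x (hZY (hWZ hx)) l h
        have := dist_triangle ys x o2
        rw [dist_comm ys x] at this; linarith
    obtain ⟨l1, x1, hx1, hl1, hd1⟩ := hJhit ys hysZ x hxZ (by rw [hxd]; linarith)
    obtain ⟨l2, x4, hx4, hl2, hd2⟩ := hJhit x hxZ ys hysZ (by rw [dist_comm, hxd]; linarith)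
    have hl1d : dist (zr l1) ys ≤ R0 := by
      have h3 := hb _ (Or.inl hl1)
      rw [dist_zero_right, ← dist_eq_norm] at h3
      have := dist_triangle_left (zr l1) ys x1
      linarith
    have hl2d : dist (zr l2) x ≤ R0 := by
      have h3 := hb _ (Or.inl hl2)
      rw [dist_zero_right, ← dist_eq_norm] at h3
      have := dist_triangle_left (zr l2) x x4
      linarith
    have hll1 : dist (zr l2) (zr l1) ≤ rt := by
      have := dist_triangle4 (zr l2) x ys (zr l1)
      rw [dist_comm ys (zr l1)] at this; linarith
    have hll2 : 0 < dist (zr l2) (zr l1) := by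
      have := dist_triangle4 x (zr l2) (zr l1) ys
      rw [dist_comm x (zr l2)] at this; linarith
    refine ⟨l1, l2 - l1, Z, ⟨?_, ?_⟩, hZY, ⟨hZ.tr _, ?_, ⟨_, add_mem_tr hx1, ?_⟩, ⟨_, add_mem_tr hx4, ?_⟩⟩, ?_⟩
    · intro h
      rw [sub_eq_zero.1 h, dist_self] at hll2
      exact lt_irrefl _ hll2
    · rw [dist_zero_right, map_sub, ← dist_eq_norm]; exact hll1
    · rintro _ ⟨w, hw, rfl⟩
      simp only [map_neg]
      rw [dist_zero_right, ← sub_eq_add_neg, ← dist_eq_norm]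
      have h3 := hZb hw
      rw [mem_closedBall] at h3
      have := dist_triangle_right w (zr l1) ys
      have : 0 ≤ rt := by positivity
      linarith
    · rw [map_neg, ← sub_eq_add_neg]; exact hl1
    · rw [map_neg, map_sub]; convert hl2 using 1; abel
    · have := dist_triangle (zr l1) ys y
      linarith

/-! ### consequences of the kit -/

def Hit (F : R2 ≃ₜ R2) (J : Set R2) (rt ρ : ℝ) (X : Set R2) (n : ℤ) (p v : ℤ × ℤ) (Y : Set R2) : Prop :=
  Ty rt v ∧ WC J ρ v Y ∧ ∀ y ∈ Y, y + zr p ∈ It F n '' X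

theorem Ty.coord {rt : ℝ} {v : ℤ × ℤ} (h : Ty rt v) : |(v.1:ℝ)| ≤ rt ∧ |(v.2:ℝ)| ≤ rt := by
  have := coord_le (zr v) 0
  simp only [zr_fst, zr_snd, Prod.fst_zero, Prod.snd_zero, sub_zero] at this
  exact ⟨this.1.trans h.2, this.2.trans h.2⟩

theorem coord_zr {v : ℤ × ℤ} {P : ℝ} (h : dist (zr v) 0 ≤ P) : |(v.1:ℝ)| ≤ P ∧ |(v.2:ℝ)| ≤ P := by
  have := coord_le (zr v) 0
  simp only [zr_fst, zr_snd, Prod.fst_zero, Prod.snd_zero, sub_zero] at this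
  exact ⟨this.1.trans h, this.2.trans h⟩

namespace Kit
variable {F : R2 ≃ₜ R2} {J : Set R2} {rt ρ M M' : ℝ} {i1 : ℕ}

theorem hit' (hk : Kit F J rt ρ M M' i1) {X : Set R2} (hX : IsContinuum X) (hXρ : ∀ x ∈ X, dist x 0 ≤ ρ) (i : ℕ)
    (hi : i1 ≤ i) {y y2 : R2} (hy : y ∈ X) (hy2 : y2 ∈ X) (hd : M ≤ dist (It F i y) (It F i y2)) :
    ∃ p v Y, Hit F J rt ρ X i p v Y ∧ dist (zr p) (It F i y) ≤ M' := by
  obtain ⟨p, v, Z, hv, hZ, hW, hp⟩ := hk.hit X hX hXρ i hi _ ⟨y, hy, rfl⟩ _ ⟨y2, hy2, rfl⟩ hd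
  refine ⟨p, v, _, ⟨hv, hW, ?_⟩, hp⟩
  rintro _ ⟨z, hz, rfl⟩
  simpa using hZ hz

theorem comp (hF : Frice F) {X Y Y' : Set R2} {n m : ℤ} {p q v v' : ℤ × ℤ} (h : Hit F J rt ρ X n p v Y)
    (h' : Hit F J rt ρ Y m q v' Y') : Hit F J rt ρ X (n + m) (p + q) v' Y' := by
  refine ⟨h'.1, h'.2.1, fun y hy => ?_⟩
  obtain ⟨x, hx, e⟩ := h'.2.2 y hy
  obtain ⟨x', hx', e'⟩ := h.2.2 x hx
  refine ⟨x', hx', ?_⟩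
  rw [add_comm n m, It_add, e', hF.itper, e, map_add]; abel

/-- adjoin J and J+v -/
def full (J : Set R2) (v : ℤ × ℤ) (X : Set R2) : Set R2 := X ∪ (J ∪ tr v J)

theorem full_cont (hk : Kit F J rt ρ M M' i1) {v : ℤ × ℤ} {X : Set R2} (hX : WC J ρ v X) :
    IsContinuum (full J v X) := by
  unfold full
  rw [← union_assoc]
  obtain ⟨x, hx, hxJ⟩ := hX.2.2.1
  obtain ⟨y, hy, hyJ⟩ := hX.2.2.2
  exact (hX.1.union hk.sc.1 ⟨x, hx, hxJ⟩).union (hk.sc.1.tr v) ⟨y, Or.inl hy, mem_tr.2 hyJ⟩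

theorem full_bdd (hk : Kit F J rt ρ M M' i1) {v : ℤ × ℤ} (hv : Ty rt v) {X : Set R2} (hX : WC J ρ v X) :
    ∀ x ∈ full J v X, dist x 0 < ρ := by
  rintro x (hx | hx | hx)
  · exact hX.2.1 x hx
  · exact hk.jb x hx
  · rw [mem_tr] at hx
    simpa using hk.jv v hv _ hx

theorem full_rep (hF : Frice F) {MJ : ℝ} (hMJ : Stab F MJ J) {v : ℤ × ℤ} {X : Set R2} (hX : WC J ρ v X) (n : ℕ) :
    ∀ x ∈ full J v X, ∃ y ∈ X, dist (It F n x) (It F n y) ≤ MJ := by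
  obtain ⟨a, ha, haJ⟩ := hX.2.2.1
  obtain ⟨b, hb, hbJ⟩ := hX.2.2.2
  rintro x (hx | hx | hx)
  · exact ⟨x, hx, by rw [dist_self]; exact dist_nonneg.trans (hMJ.dist0 n haJ haJ)⟩
  · exact ⟨a, ha, hMJ.dist0 n hx haJ⟩
  · refine ⟨b, hb, ?_⟩
    rw [mem_tr] at hx
    have := hMJ.dist0 n hx hbJ
    rwa [sub_eq_add_neg, sub_eq_add_neg, ← map_neg, hF.itper, hF.itper, dist_add_right] at this

theorem ext (hk : Kit F J rt ρ M M' i1) (hF : Frice F) {c : ℝ} (hc : DriftC F c) : ∃ (C : ℝ) (N : ℕ), ∀ v, Ty rt v → ∀ X, WC J ρ v X → 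
    ∀ n : ℕ, N ≤ n → ∀ e, ∃ y ∈ X, (c * n - C) * n1 e ≤ ip e (It F n y) := by
  obtain ⟨MJ, hMJ⟩ := hk.sc.2
  obtain ⟨j0, hj0⟩ := hk.sc.1.2.1
  have hMJ0 : 0 ≤ MJ := dist_nonneg.trans (hMJ.dist0 0 hj0 hj0)
  have hrt := hk.rt0
  set C0 := 2 * rt * ρ + 2 * rt ^ 2 + 1 with hC0
  set C1 := C0 + 2 * rt * MJ with hC1
  obtain ⟨n0, hn0⟩ := exists_nat_gt ((C1 + 2 * rt * M + 2 * rt * M' + 1) / c)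
  set n := max n0 i1 with hn
  have hcn : C1 + 2 * rt * M + 2 * rt * M' + 1 < c * n := by
    rw [div_lt_iff₀ hc.1] at hn0
    have : (n0:ℝ) ≤ n := by exact_mod_cast le_max_left _ _
    nlinarith [hc.1]
  obtain ⟨B1, hB1, hB1d⟩ := hF.disp (n:ℤ)
  obtain ⟨B2, hB2, hB2d⟩ := hF.disp (-(n:ℤ))
  have hρ2 := hk.rho2
  have hM'0 := hk.M0'
  set Q := M' + B1 + ρ with hQ
  set a := rt + 2 * Q with ha
  set ρ' := ρ + B2 + Q with hρ'
  refine ⟨(2 * a * (4 * a * (2 * ρ') + 2 * a ^ 2 + 1) + 1) + ρ' + MJ, n, ?_⟩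
  intro v hv X hX N hN e
  have hfc := hk.full_cont hX
  have hfb := hk.full_bdd hv hX
  obtain ⟨x0, hx0, hx0J⟩ := hX.2.2.1
  obtain ⟨⟨y1, hy1, hy1d⟩, y2, hy2, hy2d⟩ := span1 hF hc _ hfc v hv.1 rt ρ hv.coord.1 hv.coord.2 
    (fun x hx => (hfb x hx).le) x0 (Or.inl hx0) (Or.inr (Or.inr (add_mem_tr hx0J))) n
  obtain ⟨z1, hz1, hz1d⟩ := full_rep hF hMJ hX n y1 hy1
  obtain ⟨z2, hz2, hz2d⟩ := full_rep hF hMJ hX n y2 hy2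
  have e1 := dt_abs_le v rt hv.coord.1 hv.coord.2 (It F n y1) (It F n z1)
  have e2 := dt_abs_le v rt hv.coord.1 hv.coord.2 (It F n y2) (It F n z2)
  have e1' : 2 * rt * dist (It F n y1) (It F n z1) ≤ 2 * rt * MJ := by gcongr
  have e2' : 2 * rt * dist (It F n y2) (It F n z2) ≤ 2 * rt * MJ := by gcongr
  have f1 := (abs_le.1 (e1.trans e1')).2
  have f2 := (abs_le.1 (e2.trans e2')).1
  have g1 : c * n - C1 ≤ dt v (It F n z1) := by linarith
  have g2 : dt v (It F n z2) ≤ -(c * n - C1) := by linarith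
  have hfar : M ≤ dist (It F n z1) (It F n z2) := by
    by_contra h
    push Not at h
    have e3 := dt_abs_le v rt hv.coord.1 hv.coord.2 (It F n z1) (It F n z2)
    have e4 : 2 * rt * dist (It F n z1) (It F n z2) ≤ 2 * rt * M := by gcongr
    have e5 := (abs_le.1 (e3.trans e4)).2
    have e6 : 0 ≤ 2 * rt * M' := by positivity
    have e7 : 0 ≤ 2 * rt * M := by have := hk.M0; positivity
    linarith
  obtain ⟨p1, v1, Y1, hH1, hp1⟩ := hk.hit' hX.1 (fun x hx => (hX.2.1 x hx).le) n (le_max_right _ _) hz1 hz2 hfar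
  obtain ⟨p2, v2, Y2, hH2, hp2⟩ := hk.hit' hX.1 (fun x hx => (hX.2.1 x hx).le) n (le_max_right _ _) hz2 hz1 (by rwa [dist_comm])
  obtain ⟨w1, hw1, hw1J⟩ := hH1.2.1.2.2.1
  obtain ⟨x1, hx1, hx1e⟩ := hH1.2.2 w1 hw1
  obtain ⟨w2, hw2, hw2J⟩ := hH2.2.1.2.2.1
  obtain ⟨x2, hx2, hx2e⟩ := hH2.2.2 w2 hw2
  have hpd : dt v (zr (p1 - p2)) ≠ 0 := by
    have e3 := dt_abs_le v rt hv.coord.1 hv.coord.2 (zr p1) (It F n z1)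
    have e4 := dt_abs_le v rt hv.coord.1 hv.coord.2 (zr p2) (It F n z2)
    have e3' : 2 * rt * dist (zr p1) (It F n z1) ≤ 2 * rt * M' := by gcongr
    have e4' : 2 * rt * dist (zr p2) (It F n z2) ≤ 2 * rt * M' := by gcongr
    have e5 := (abs_le.1 (e3.trans e3')).1
    have e6 := (abs_le.1 (e4.trans e4')).2
    have e7 : 0 ≤ 2 * rt * M := by have := hk.M0; positivity
    rw [map_sub, dt_sub]
    apply ne_of_gt
    linarith
  set E := It F (-(n:ℤ)) '' J with hE
  have hEc : IsContinuum E := hk.sc.1.image (It_cont _ _)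
  have hxE : ∀ x w p, It F n x = w + zr p → w ∈ J → x ∈ tr p E := by
    intro x w p h hw
    rw [mem_tr]
    refine ⟨w, hw, ?_⟩
    apply It_inj F n
    rw [It_neg_cancel', sub_eq_add_neg, ← map_neg, hF.itper, h, map_neg]; abel
  set K := full J v X ∪ tr p1 E ∪ tr p2 E with hK
  have hKc : IsContinuum K := (hfc.union (hEc.tr p1) ⟨x1, Or.inl hx1, hxE _ _ _ hx1e hw1J⟩).union (hEc.tr p2)
    ⟨x2, Or.inl (Or.inl hx2), hxE _ _ _ hx2e hw2J⟩
  have hQb : ∀ z ∈ X, ∀ p, dist (zr p) (It F n z) ≤ M' → dist (zr p) 0 ≤ Q := by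
    intro z hz p hp
    have h1 := hB1d z
    have h2 := hX.2.1 z hz
    have := dist_triangle4 (zr p) (It F n z) z 0
    linarith
  have hp1Q := hQb z1 hz1 p1 hp1
  have hp2Q := hQb z2 hz2 p2 hp2
  have hEb : ∀ p, dist (zr p) 0 ≤ Q → ∀ x ∈ tr p E, dist x 0 ≤ ρ' := by
    rintro p hp _ ⟨_, ⟨j, hj, rfl⟩, rfl⟩
    have h1 := hB2d j
    have h2 := hk.jb j hj
    have h3 := dist_triangle (It F (-(n:ℤ)) j) j 0
    rw [dist_zero_right] at hp h3 ⊢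
    have := norm_add_le (It F (-(n:ℤ)) j) (zr p)
    simp only
    linarith
  have hKb : ∀ x ∈ K, dist x 0 ≤ ρ' := by
    rintro x ((hx | hx) | hx)
    · have := hfb x hx
      have : 0 ≤ Q := by positivity
      linarith
    · exact hEb p1 hp1Q x hx
    · exact hEb p2 hp2Q x hx
  have hQ0 : 0 ≤ Q := by positivity
  have hwQ : dist (zr (p1 - p2)) 0 ≤ a := by
    rw [dist_zero_right] at *
    rw [map_sub]
    have := norm_sub_le (zr p1) (zr p2)
    linarith
  obtain ⟨y, hy, hyd⟩ := span2 hF hc K hKc v (p1 - p2) a ρ' (hv.coord.1.trans (by linarith)) (hv.coord.2.trans (by linarith))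
    (coord_zr hwQ).1 (coord_zr hwQ).2 (by
      intro h
      apply hpd
      simp only [dt, zr_fst, zr_snd]
      exact_mod_cast h) hKb ⟨x0, Or.inl (Or.inl (Or.inl hx0)), Or.inl (Or.inl (Or.inr (Or.inr (add_mem_tr hx0J))))⟩
    ⟨It F (-(n:ℤ)) j0 + zr p2, Or.inr (add_mem_tr ⟨j0, hj0, rfl⟩), by
      left; right
      rw [mem_tr]
      refine ⟨j0, hj0, ?_⟩
      rw [map_sub]; abel⟩ N e
  have hErep : ∀ x ∈ X, ∀ w p, It F n x = w + zr p → w ∈ J → ∀ y ∈ tr p E, dist (It F N y) (It F N x) ≤ MJ := by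
    rintro x hx w p h hw _ ⟨_, ⟨j, hj, rfl⟩, rfl⟩
    obtain ⟨k, rfl⟩ := Nat.exists_eq_add_of_le hN
    have h1 := hMJ.dist0 k hj hw
    have h2 : It F ((n + k : ℕ):ℤ) x = It F k w + zr p := by
      push_cast
      rw [add_comm, It_add, h, hF.itper]
    have h3 : It F ((n + k : ℕ):ℤ) (It F (-(n:ℤ)) j + zr p) = It F k j + zr p := by
      push_cast
      rw [hF.itper, add_comm (n:ℤ) k, It_add, It_neg_cancel']
    simp only
    rw [h2, h3, dist_add_right]
    exact h1
  have hrep : ∃ y' ∈ X, dist (It F N y) (It F N y') ≤ MJ := by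
    rcases hy with (hy | hy) | hy
    · exact full_rep hF hMJ hX N y hy
    · exact ⟨x1, hx1, hErep x1 hx1 _ _ hx1e hw1J y hy⟩
    · exact ⟨x2, hx2, hErep x2 hx2 _ _ hx2e hw2J y hy⟩
  obtain ⟨y', hy', hyy⟩ := hrep
  refine ⟨y', hy', ?_⟩
  have h1 := (abs_le.1 (ip_diff e (It F N y) (It F N y'))).2
  have h2 : dist (It F N y) (It F N y') * n1 e ≤ MJ * n1 e := mul_le_mul_of_nonneg_right hyy (n1_nonneg e)
  nlinarith

end Kit

namespace Kit
variable {F : R2 ≃ₜ R2} {J : Set R2} {rt ρ M M' : ℝ} {i1 : ℕ}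

theorem n1_pos {e : R2} (he : e ≠ 0) : 0 < n1 e := by
  rcases (n1_nonneg e).lt_or_eq with h | h
  · exact h
  · exfalso
    apply he
    unfold n1 at h
    have h1 := abs_nonneg e.1
    have h2 := abs_nonneg e.2
    ext
    · simp; exact abs_eq_zero.1 (by linarith)
    · simp; exact abs_eq_zero.1 (by linarith)

theorem ip_neg (e x : R2) : ip (-e) x = - ip e x := by simp [ip]; ring
theorem n1_neg (e : R2) : n1 (-e) = n1 e := by simp [n1]

theorem step (hk : Kit F J rt ρ M M' i1) (hF : Frice F) : ∃ (P : ℝ) (i : ℕ), 0 ≤ P ∧ 0 < i ∧ ∀ v, Ty rt v → ∀ X, WC J ρ v X →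
    ∀ e : R2, ∃ p v' Y, Hit F J rt ρ X i p v' Y ∧ dist (zr p) 0 ≤ P ∧ n1 e ≤ ip e (zr p) := by
  obtain ⟨c, hc⟩ := hF.driftC
  obtain ⟨C, N, hext⟩ := hk.ext hF hc
  obtain ⟨n0, hn0⟩ := exists_nat_gt ((C + M + M' + 1) / c)
  set i := max n0 (max N (max i1 1)) with hi
  have hiN : N ≤ i := (le_max_left _ _).trans (le_max_right _ _)
  have hii : i1 ≤ i := (le_max_left _ _).trans ((le_max_right _ _).trans (le_max_right _ _))
  have hi1 : 1 ≤ i := (le_max_right _ _).trans ((le_max_right _ _).trans (le_max_right _ _))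
  have hcn : C + M + M' + 1 < c * i := by
    rw [div_lt_iff₀ hc.1] at hn0
    have : (n0:ℝ) ≤ i := by exact_mod_cast le_max_left _ _
    nlinarith [hc.1]
  obtain ⟨B1, hB1, hB1d⟩ := hF.disp (i:ℤ)
  have hM0 := hk.M0
  have hM0' := hk.M0'
  have hρ2 := hk.rho2
  refine ⟨M' + B1 + ρ, i, by positivity, hi1, ?_⟩
  intro v hv X hX
  have main : ∀ e : R2, e ≠ 0 → ∃ p v' Y, Hit F J rt ρ X i p v' Y ∧ dist (zr p) 0 ≤ M' + B1 + ρ ∧ n1 e ≤ ip e (zr p) := by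
    intro e he
    have hn := n1_pos he
    obtain ⟨y, hy, hyd⟩ := hext v hv X hX i hiN e
    obtain ⟨z, hz, hzd⟩ := hext v hv X hX i hiN (-e)
    rw [n1_neg, ip_neg] at hzd
    have hfar : M ≤ dist (It F i y) (It F i z) := by
      by_contra h
      push Not at h
      have h1 := (abs_le.1 (ip_diff e (It F i y) (It F i z))).2
      have h2 : dist (It F i y) (It F i z) * n1 e ≤ M * n1 e := mul_le_mul_of_nonneg_right h.le hn.le
      nlinarith
    obtain ⟨p, v', Y, hH, hp⟩ := hk.hit' hX.1 (fun x hx => (hX.2.1 x hx).le) i hii hy hz hfar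
    refine ⟨p, v', Y, hH, ?_, ?_⟩
    · have h1 := hB1d y
      have h2 := hX.2.1 y hy
      have := dist_triangle4 (zr p) (It F i y) y 0
      linarith
    · have h1 := (abs_le.1 (ip_diff e (zr p) (It F i y))).1
      have h2 : dist (zr p) (It F i y) * n1 e ≤ M' * n1 e := mul_le_mul_of_nonneg_right hp hn.le
      nlinarith
  intro e
  rcases eq_or_ne e 0 with rfl | he
  · obtain ⟨p, v', Y, hH, hp, -⟩ := main (1, 0) (by intro h; simpa using congrArg Prod.fst h)
    exact ⟨p, v', Y, hH, hp, by simp [n1, ip]⟩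
  · exact main e he

theorem hit_zero {v : ℤ × ℤ} (hv : Ty rt v) {X : Set R2} (hX : WC J ρ v X) : Hit F J rt ρ X 0 0 v X :=
  ⟨hv, hX, fun y hy => ⟨y, hy, by simp⟩⟩

theorem reach (hk : Kit F J rt ρ M M' i1) (hF : Frice F) : ∃ R i : ℕ, 0 < i ∧ ∀ m : ℕ, ∀ v, Ty rt v → ∀ X, WC J ρ v X →
    ∀ t : ℤ × ℤ, t.1 ^ 2 + t.2 ^ 2 ≤ m → ∃ p v' Y, Hit F J rt ρ X ((i * m : ℕ):ℤ) p v' Y ∧ 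
      |p.1 - t.1| ≤ R ∧ |p.2 - t.2| ≤ R := by
  obtain ⟨P, i, hP, hi, hst⟩ := hk.step hF
  set B := (P ^ 2 + 1) ^ 2 + 2 * P ^ 2 with hB
  obtain ⟨R, hR⟩ := exists_nat_ge B
  refine ⟨R, i, hi, ?_⟩
  intro m v hv X hX t ht
  have hind : ∀ m : ℕ, ∃ p v' Y, Hit F J rt ρ X ((i * m : ℕ):ℤ) p v' Y ∧ 
      ((t.1 - p.1 : ℤ) : ℝ) ^ 2 + ((t.2 - p.2 : ℤ) : ℝ) ^ 2 ≤ max ((t.1:ℝ) ^ 2 + (t.2:ℝ) ^ 2 - m) B := by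
    intro m
    induction m with
    | zero => exact ⟨0, v, X, by simpa using hit_zero hv hX, by simp⟩
    | succ m ih =>
      obtain ⟨p, v', Y, hH, hd⟩ := ih
      set d1 : ℝ := ((t.1 - p.1 : ℤ) : ℝ) with hd1
      set d2 : ℝ := ((t.2 - p.2 : ℤ) : ℝ) with hd2
      obtain ⟨q, v'', Y', hH', hq, hqe⟩ := hst v' hH.1 Y hH.2.1 (d1, d2)
      refine ⟨p + q, v'', Y', ?_, ?_⟩
      · have := comp hF hH hH'
        convert this using 1
        push_cast; ring
      · have e1 : ((t.1 - (p + q).1 : ℤ) : ℝ) = d1 - q.1 := by rw [hd1]; push_cast [Prod.fst_add]; ring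
        have e2 : ((t.2 - (p + q).2 : ℤ) : ℝ) = d2 - q.2 := by rw [hd2]; push_cast [Prod.snd_add]; ring
        rw [e1, e2]
        have hc := coord_zr hq
        have s1 : (q.1:ℝ) ^ 2 ≤ P ^ 2 := sq_le_sq' (abs_le.1 hc.1).1 (abs_le.1 hc.1).2
        have s2 : (q.2:ℝ) ^ 2 ≤ P ^ 2 := sq_le_sq' (abs_le.1 hc.2).1 (abs_le.1 hc.2).2
        simp only [ip, n1, zr_fst, zr_snd] at hqe
        have hN : (d1 - q.1) ^ 2 + (d2 - q.2) ^ 2 ≤ d1 ^ 2 + d2 ^ 2 - 2 * (|d1| + |d2|) + 2 * P ^ 2 := by nlinarith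
        rcases le_total (P ^ 2 + 1) (|d1| + |d2|) with h | h
        · rcases le_max_iff.1 hd with h' | h'
          · refine le_max_of_le_left ?_
            push_cast
            linarith
          · refine le_max_of_le_right ?_
            linarith
        · refine le_max_of_le_right ?_
          have a1 := abs_nonneg d1
          have a2 := abs_nonneg d2
          have : d1 ^ 2 + d2 ^ 2 ≤ (|d1| + |d2|) ^ 2 := by
            rw [← sq_abs d1, ← sq_abs d2]; nlinarith
          have : (|d1| + |d2|) ^ 2 ≤ (P ^ 2 + 1) ^ 2 := by gcongr
          linarith
  obtain ⟨p, v', Y, hH, hd⟩ := hind m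
  refine ⟨p, v', Y, hH, ?_⟩
  have hB0 : 0 ≤ B := by positivity
  have ht' : (t.1:ℝ) ^ 2 + (t.2:ℝ) ^ 2 ≤ m := by exact_mod_cast ht
  have hd' : ((t.1 - p.1 : ℤ) : ℝ) ^ 2 + ((t.2 - p.2 : ℤ) : ℝ) ^ 2 ≤ R :=
    (hd.trans (max_le (by linarith) le_rfl)).trans hR
  have hd2 : (t.1 - p.1) ^ 2 + (t.2 - p.2) ^ 2 ≤ (R:ℤ) := by exact_mod_cast hd'
  have aux : ∀ x : ℤ, x ^ 2 ≤ R → |x| ≤ R := by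
    intro x hx
    rcases eq_or_ne x 0 with rfl | h
    · simpa using hx
    · have := Int.one_le_abs h
      rw [← sq_abs] at hx
      nlinarith
  constructor
  · rw [abs_sub_comm]; exact aux _ (by nlinarith [sq_nonneg (t.2 - p.2)])
  · rw [abs_sub_comm]; exact aux _ (by nlinarith [sq_nonneg (t.1 - p.1)])

theorem start (hk : Kit F J rt ρ M M' i1) (hF : Frice F) (z : R2) (r : ℝ) (hr : 0 < r) :
    ∃ (n : ℕ) (p v : ℤ × ℤ) (Y : Set R2), Hit F J rt ρ (closedBall z r) n p v Y := by
  have hr' : 0 < min r 1 := by positivity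
  obtain ⟨δ, hδ, h⟩ := hF.E2 (min r 1 / 2) (by positivity)
  obtain ⟨A, hA, hzA, ⟨a, haA, had⟩, hU⟩ := h z
  rw [mul_div_cancel₀ _ (two_ne_zero' ℝ)] at hU
  have hAb : ∀ x ∈ A, dist x z ≤ min r 1 := fun x hx => by simpa using hU 0 x hx z hzA
  obtain ⟨l, hl, -⟩ := exists_zr_near z
  have hUC : UC F (It F i1 '' tr l A) := hF.uc_image (hF.uc_tr ⟨hA, _, hU⟩ l) i1
  have hnt : (It F i1 '' tr l A).Nontrivial := by
    refine ⟨_, ⟨_, add_mem_tr hzA, rfl⟩, _, ⟨_, add_mem_tr haA, rfl⟩, ?_⟩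
    intro h
    have := add_right_cancel (It_inj F i1 h)
    rw [this, dist_self] at had
    linarith
  obtain ⟨M1, hM1⟩ := hUC.2
  obtain ⟨j, x, hx, y, hy, hd⟩ := hF.exp _ hUC.1 hnt (max M M1)
  have hj : 0 ≤ j := by
    by_contra h
    obtain ⟨k, hk⟩ := Int.eq_ofNat_of_zero_le (show 0 ≤ -j by omega)
    have e : j = -(k:ℤ) := by omega
    have := hM1 k x hx y hy
    rw [← e] at this
    linarith [le_max_right M M1]
  lift j to ℕ using hj
  obtain ⟨x, hx, rfl⟩ := hx
  obtain ⟨y, hy, rfl⟩ := hy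
  have hρ2 := hk.rho2
  rw [← It_add, ← It_add] at hd
  obtain ⟨p, v, Y, hH, -⟩ := hk.hit' (X := tr l A) (hA.tr l) (by
    rintro _ ⟨b, hb, rfl⟩
    have h1 := hAb b hb
    have h2 := dist_triangle (b + zr l) (z + zr l) 0
    rw [dist_add_right] at h2
    have := min_le_right r 1
    simp only
    linarith) (j + i1) (by omega) hx hy (by push_cast; linarith [le_max_left M M1])
  refine ⟨j + i1, p - l, v, Y, hH.1, hH.2.1, fun y hy => ?_⟩
  obtain ⟨_, ⟨b, hb, rfl⟩, e⟩ := hH.2.2 y hy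
  refine ⟨b, (hAb b hb).trans (min_le_left _ _), ?_⟩
  simp only [hF.itper] at e
  rw [map_sub, ← add_sub_assoc, ← e]; simp

theorem bigBall (hk : Kit F J rt ρ M M' i1) (hF : Frice F) (z : R2) (r : ℝ) (hr : 0 < r) (D : ℝ) :
    ∃ s0 : ℕ, ∀ s : ℕ, s0 ≤ s → ∃ a ∈ closedBall z r, ∃ b ∈ closedBall z r, D < dist (It F s a) (It F s b) := by
  obtain ⟨n, p, v, Y, hH⟩ := hk.start hF z r hr
  obtain ⟨c, hc⟩ := hF.driftC
  obtain ⟨C, N, hext⟩ := hk.ext hF hc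
  obtain ⟨n0, hn0⟩ := exists_nat_gt ((C + |D| + 1) / c)
  refine ⟨n + max N n0, fun s hs => ?_⟩
  obtain ⟨k, rfl⟩ := Nat.exists_eq_add_of_le (show n ≤ s by omega)
  have hcn : C + |D| + 1 < c * k := by
    rw [div_lt_iff₀ hc.1] at hn0
    have : (n0:ℝ) ≤ k := by exact_mod_cast (show n0 ≤ k by have := le_max_right N n0; omega)
    nlinarith [hc.1]
  have hNk : N ≤ k := by have := le_max_left N n0; omega
  obtain ⟨a, ha, had⟩ := hext v hH.1 Y hH.2.1 k hNk (1, 0)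
  obtain ⟨b, hb, hbd⟩ := hext v hH.1 Y hH.2.1 k hNk (-(1, 0))
  rw [n1_neg, ip_neg] at hbd
  have hn1 : n1 ((1, 0) : R2) = 1 := by simp [n1]
  rw [hn1, mul_one] at had hbd
  have hd := (abs_le.1 (ip_diff (1, 0) (It F k a) (It F k b))).2
  rw [hn1, mul_one] at hd
  obtain ⟨a', ha', ea⟩ := hH.2.2 a ha
  obtain ⟨b', hb', eb⟩ := hH.2.2 b hb
  refine ⟨a', ha', b', hb', ?_⟩
  push_cast
  rw [add_comm, It_add, It_add, ea, eb, hF.itper, hF.itper, dist_add_right]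
  have := le_abs_self D
  linarith [abs_nonneg D]

end Kit

namespace Kit
variable {F : R2 ≃ₜ R2} {J : Set R2} {rt ρ M M' : ℝ} {i1 : ℕ}

theorem hitE {X Y : Set R2} {n : ℤ} {p v : ℤ × ℤ} (h : Hit F J rt ρ X n p v Y) :
    ∃ x ∈ X, ∃ w ∈ J, It F n x = w + zr p := by
  obtain ⟨w, hw, hwJ⟩ := h.2.1.2.2.1
  obtain ⟨x, hx, e⟩ := h.2.2 w hw
  exact ⟨x, hx, w, hwJ, e⟩

theorem memE (hF : Frice F) {x w : R2} {p : ℤ × ℤ} {n : ℤ} (h : It F n x = w + zr p) (hw : w ∈ J) :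
    x ∈ tr p (It F (-n) '' J) := by
  rw [mem_tr]
  refine ⟨w, hw, ?_⟩
  apply It_inj F n
  rw [It_neg_cancel', sub_eq_add_neg, ← map_neg, hF.itper, h, map_neg]; abel

theorem repE (hF : Frice F) {x w : R2} {p : ℤ × ℤ} {n N : ℤ} {η : ℝ}
    (hη : ∀ a ∈ J, ∀ b ∈ J, dist (It F (N - n) a) (It F (N - n) b) ≤ η) 
    (h : It F n x = w + zr p) (hw : w ∈ J) {y : R2} (hy : y ∈ tr p (It F (-n) '' J)) :
    dist (It F N y) (It F N x) ≤ η := by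
  obtain ⟨_, ⟨j, hj, rfl⟩, rfl⟩ := hy
  have h2 : It F N x = It F (N - n) w + zr p := by
    have : N = (N - n) + n := by ring
    rw [this, It_add, h, hF.itper]; simp
  have h3 : It F N (It F (-n) j + zr p) = It F (N - n) j + zr p := by
    rw [hF.itper, ← It_add, ← sub_eq_add_neg]
  simp only
  rw [h2, h3, dist_add_right]
  exact hη _ hj _ hw

theorem full_rep' (hF : Frice F) {n : ℤ} {η : ℝ} (hη0 : 0 ≤ η) 
    (hη : ∀ a ∈ J, ∀ b ∈ J, dist (It F n a) (It F n b) ≤ η) {v : ℤ × ℤ} {X : Set R2} (hX : WC J ρ v X) :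
    ∀ x ∈ full J v X, ∃ y ∈ X, dist (It F n x) (It F n y) ≤ η := by
  obtain ⟨a, ha, haJ⟩ := hX.2.2.1
  obtain ⟨b, hb, hbJ⟩ := hX.2.2.2
  rintro x (hx | hx | hx)
  · exact ⟨x, hx, by rwa [dist_self]⟩
  · exact ⟨a, ha, hη _ hx _ haJ⟩
  · refine ⟨b, hb, ?_⟩
    rw [mem_tr] at hx
    have := hη _ hx _ hbJ
    rwa [sub_eq_add_neg, sub_eq_add_neg, ← map_neg, hF.itper, hF.itper, dist_add_right] at this

theorem small (hk : Kit F J rt ρ M M' i1) (hF : Frice F) (η : ℝ) (hη : 0 < η) : ∃ T : ℕ, ∀ n : ℤ, T ≤ n → 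
    ∀ a ∈ J, ∀ b ∈ J, dist (It F n a) (It F n b) ≤ η := by
  obtain ⟨MJ, hMJ⟩ := hk.sc.2
  obtain ⟨T, hT⟩ := hF.E1 MJ η hη
  refine ⟨T, fun n hn a ha b hb => ?_⟩
  lift n to ℕ using (by omega)
  exact (hT J hk.sc.1 hMJ n (by exact_mod_cast hn) a ha b hb).le

theorem pigeon (k : ℕ) (hk : 0 < k) (p : ℕ → ℤ × ℤ) : ∃ a b : ℕ, a ≤ k * k ∧ b ≤ k * k ∧ a ≠ b ∧ 
    (k:ℤ) ∣ (p b - p a).1 ∧ (k:ℤ) ∣ (p b - p a).2 := by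
  haveI : NeZero k := ⟨hk.ne'⟩
  obtain ⟨a, b, hab, h⟩ := Fintype.exists_ne_map_eq_of_card_lt
    (fun j : Fin (k * k + 1) => (((p j).1 : ZMod k), ((p j).2 : ZMod k))) (by
      rw [Fintype.card_prod, ZMod.card, Fintype.card_fin]; omega)
  simp only [Prod.mk.injEq, ZMod.intCast_eq_intCast_iff_dvd_sub] at h
  exact ⟨a, b, by omega, by omega, fun h => hab (Fin.ext h), h.1, h.2⟩

theorem detne (R : ℤ) (hR : 0 ≤ R) (x y e f : ℤ) (hx : 2 * R + 1 ≤ |x|) (hy : 2 * R + 1 ≤ |y|) (he : |e| ≤ 2 * R) (hf : |f| ≤ 2 * R) :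
    x * y - e * f ≠ 0 := by
  intro h
  have h1 : |x| * |y| = |e| * |f| := by rw [← abs_mul, ← abs_mul]; congr 1; linarith
  have h2 : (2 * R + 1) * (2 * R + 1) ≤ |x| * |y| := mul_le_mul hx hy (by linarith) (by positivity)
  have h3 : |e| * |f| ≤ (2 * R) * (2 * R) := mul_le_mul he hf (by positivity) (by linarith)
  nlinarith

theorem bigc (R S : ℤ) (hS : S = 4 * R + 1) (hR : 0 ≤ R) (a b : ℕ) (hab : a ≠ b) (x y : ℤ) (hx : |x - S * a| ≤ R) (hy : |y - S * b| ≤ R) :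
    2 * R + 1 ≤ |y - x| := by
  have h1 : (1:ℤ) ≤ |(b:ℤ) - a| := Int.one_le_abs (by omega)
  have h2 : S ≤ |S * b - S * a| := by
    rw [← mul_sub, abs_mul, abs_of_nonneg (by omega : 0 ≤ S)]; nlinarith
  have h3 : |S * b - S * a| ≤ |y - x| + |x - S * a| + |y - S * b| := by
    have e : S * b - S * a = (y - x) + (x - S * a) - (y - S * b) := by ring
    rw [e]
    exact (abs_sub _ _).trans (by gcongr; exact abs_add_le _ _)
  linarith

theorem smallc (R : ℤ) (x y : ℤ) (hx : |x - 0| ≤ R) (hy : |y - 0| ≤ R) : |y - x| ≤ 2 * R := by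
  rw [sub_zero] at hx hy
  have := abs_sub y x
  linarith

theorem h2core (hk : Kit F J rt ρ M M' i1) (hF : Frice F) (z : R2) (r0 : ℝ) (hr0 : 0 < r0) (k : ℕ) (hk0 : 0 < k) :
    ∃ s0 : ℕ, ∀ s : ℕ, s0 ≤ s → ∀ v, Ty rt v → ∀ Y, WC J ρ v Y → ∀ w : ℤ × ℤ, ∃ y ∈ Y, ∃ q : ℤ × ℤ,
      (k:ℤ) ∣ q.1 - w.1 ∧ (k:ℤ) ∣ q.2 - w.2 ∧ dist (It F s y) (z + zr q) ≤ r0 := by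
  obtain ⟨R, i, hi, hreach⟩ := hk.reach hF
  set S : ℕ := 4 * R + 1 with hS
  set mt : ℕ := (S * (k * k)) ^ 2 with hmt
  set τ : ℕ := i * mt with hτ
  set Q : ℝ := S * (k * k) + R with hQ
  have hQ0 : 0 ≤ Q := by positivity
  obtain ⟨B2, hB2, hB2d⟩ := hF.disp (-(τ:ℤ))
  set a : ℝ := 2 * Q with ha
  set ρ' : ℝ := ρ + B2 + Q with hρ'
  obtain ⟨T0, hT0⟩ := hk.small hF (r0 / 2) (by positivity)
  obtain ⟨J', rt', ρ'', Mm, Mm', ii, hk'⟩ := hF.inv.kit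
  obtain ⟨s1, hs1⟩ := hk'.bigBall hF.inv z (r0 / 2) (by positivity) (2 * a * (4 * a * (2 * ρ') + 2 * a ^ 2 + 1))
  have hρ2 := hk.rho2
  refine ⟨s1 + τ + T0, ?_⟩
  intro s hs v hv Y hY w
  -- the hits
  have hits : ∀ t : ℤ × ℤ, t.1 ^ 2 + t.2 ^ 2 ≤ mt → ∃ p : ℤ × ℤ, (∃ x ∈ Y, ∃ w ∈ J, It F τ x = w + zr p) ∧
      |p.1 - t.1| ≤ R ∧ |p.2 - t.2| ≤ R := by
    intro t ht
    obtain ⟨p, v', Y', hH, h1⟩ := hreach mt v hv Y hY t ht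
    exact ⟨p, hitE hH, h1⟩
  have hsq : ∀ j : ℕ, j ≤ k * k → ((S:ℤ) * j) ^ 2 ≤ mt := by
    intro j hj
    rw [hmt]
    push_cast
    have : (j:ℤ) ≤ k * k := by exact_mod_cast hj
    gcongr
  have hH1 : ∀ j : ℕ, ∃ p : ℤ × ℤ, j ≤ k * k → (∃ x ∈ Y, ∃ w ∈ J, It F τ x = w + zr p) ∧
      |p.1 - S * j| ≤ R ∧ |p.2 - 0| ≤ R := by
    intro j
    by_cases hj : j ≤ k * k
    · obtain ⟨p, hp⟩ := hits ((S:ℤ) * j, 0) (by simpa using hsq j hj)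
      exact ⟨p, fun _ => hp⟩
    · exact ⟨0, fun h => absurd h hj⟩
  have hH2 : ∀ j : ℕ, ∃ p : ℤ × ℤ, j ≤ k * k → (∃ x ∈ Y, ∃ w ∈ J, It F τ x = w + zr p) ∧
      |p.1 - 0| ≤ R ∧ |p.2 - S * j| ≤ R := by
    intro j
    by_cases hj : j ≤ k * k
    · obtain ⟨p, hp⟩ := hits (0, (S:ℤ) * j) (by simpa using hsq j hj)
      exact ⟨p, fun _ => hp⟩
    · exact ⟨0, fun h => absurd h hj⟩
  choose p hp using hH1
  choose q hq using hH2
  obtain ⟨j1, j2, hj1, hj2, hj12, hd1, hd1'⟩ := pigeon k hk0 p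
  obtain ⟨j3, j4, hj3, hj4, hj34, hd2, hd2'⟩ := pigeon k hk0 q
  have bnd : ∀ (x : ℤ) (j : ℕ), j ≤ k * k → |x - S * j| ≤ R → |(x:ℝ)| ≤ Q := by
    intro x j hj hx
    have h1 : |(x:ℝ) - S * j| ≤ R := by exact_mod_cast hx
    have h2 : (j:ℝ) ≤ k * k := by exact_mod_cast hj
    have h3 : (S:ℝ) * j ≤ S * (k * k) := by gcongr
    have h4 : (0:ℝ) ≤ (S:ℝ) * j := by positivity
    rw [abs_le] at h1 ⊢
    have : (0:ℝ) ≤ S * (k * k) := by positivity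
    constructor <;> linarith
  have bnd0 : ∀ (x : ℤ), |x - 0| ≤ R → |(x:ℝ)| ≤ Q := by
    intro x hx
    have h1 : |(x:ℝ)| ≤ R := by rw [sub_zero] at hx; exact_mod_cast hx
    have : (0:ℝ) ≤ S * (k * k) := by positivity
    linarith
  have zb : ∀ l : ℤ × ℤ, |(l.1:ℝ)| ≤ Q → |(l.2:ℝ)| ≤ Q → dist (zr l) 0 ≤ Q := by
    intro l h1 h2
    rw [Prod.dist_eq, Real.dist_eq, Real.dist_eq]
    simpa using ⟨h1, h2⟩
  have hpb : ∀ j, j ≤ k * k → |((p j).1:ℝ)| ≤ Q ∧ |((p j).2:ℝ)| ≤ Q := fun j hj =>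
    ⟨bnd _ j hj (hp j hj).2.1, bnd0 _ (hp j hj).2.2⟩
  have hqb : ∀ j, j ≤ k * k → |((q j).1:ℝ)| ≤ Q ∧ |((q j).2:ℝ)| ≤ Q := fun j hj =>
    ⟨bnd0 _ (hq j hj).2.1, bnd _ j hj (hq j hj).2.2⟩
  have sb : ∀ x y : ℤ, |(x:ℝ)| ≤ Q → |(y:ℝ)| ≤ Q → |((x - y : ℤ):ℝ)| ≤ a := by
    intro x y h1 h2
    push_cast
    have := abs_sub (x:ℝ) y
    linarith
  set E := It F (-(τ:ℤ)) '' J with hE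
  have hEc : IsContinuum E := hk.sc.1.image (It_cont _ _)
  have hEb : ∀ l, dist (zr l) 0 ≤ Q → ∀ x ∈ tr l E, dist x 0 ≤ ρ' := by
    rintro l hl _ ⟨_, ⟨j, hj, rfl⟩, rfl⟩
    have h1 := hB2d j
    have h2 := hk.jb j hj
    have h3 := dist_triangle (It F (-(τ:ℤ)) j) j 0
    rw [dist_zero_right] at hl h3 ⊢
    have := norm_add_le (It F (-(τ:ℤ)) j) (zr l)
    simp only
    linarith
  obtain ⟨x1, hx1, w1, hw1, e1⟩ := (hp j1 hj1).1
  obtain ⟨x2, hx2, w2, hw2, e2⟩ := (hp j2 hj2).1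
  obtain ⟨x3, hx3, w3, hw3, e3⟩ := (hq j3 hj3).1
  obtain ⟨x4, hx4, w4, hw4, e4⟩ := (hq j4 hj4).1
  obtain ⟨j0, hj0⟩ := hk.sc.1.2.1
  set K := Y ∪ tr (p j1) E ∪ tr (p j2) E ∪ tr (q j3) E ∪ tr (q j4) E with hK
  have hKc : IsContinuum K := (((hY.1.union (hEc.tr _) ⟨x1, hx1, memE hF e1 hw1⟩).union (hEc.tr _)
    ⟨x2, Or.inl hx2, memE hF e2 hw2⟩).union (hEc.tr _) ⟨x3, Or.inl (Or.inl hx3), memE hF e3 hw3⟩).union (hEc.tr _)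
    ⟨x4, Or.inl (Or.inl (Or.inl hx4)), memE hF e4 hw4⟩
  have hKb : ∀ x ∈ K, dist x 0 ≤ ρ' := by
    rintro x ((((hx | hx) | hx) | hx) | hx)
    · have := hY.2.1 x hx
      linarith
    · exact hEb _ (zb _ (hpb j1 hj1).1 (hpb j1 hj1).2) x hx
    · exact hEb _ (zb _ (hpb j2 hj2).1 (hpb j2 hj2).2) x hx
    · exact hEb _ (zb _ (hqb j3 hj3).1 (hqb j3 hj3).2) x hx
    · exact hEb _ (zb _ (hqb j4 hj4).1 (hqb j4 hj4).2) x hx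
  set d1 := p j2 - p j1 with hd1e
  set d2 := q j4 - q j3 with hd2e
  have hret : ∀ l l' : ℤ × ℤ, It F (-(τ:ℤ)) j0 + zr l + zr (l' - l) ∈ tr l' E := by
    intro l l'
    rw [mem_tr]
    exact ⟨j0, hj0, by rw [map_sub]; abel⟩
  have hSR : (S:ℤ) = 4 * R + 1 := by rw [hS]; push_cast; ring
  have hdet : d1.1 * d2.2 - d1.2 * d2.1 ≠ 0 := by
    apply detne (R:ℤ) (by positivity)
    · exact bigc R S hSR (by positivity) j1 j2 hj12 _ _ (hp j1 hj1).2.1 (hp j2 hj2).2.1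
    · exact bigc R S hSR (by positivity) j3 j4 hj34 _ _ (hq j3 hj3).2.2 (hq j4 hj4).2.2
    · exact smallc R _ _ (hp j1 hj1).2.2 (hp j2 hj2).2.2
    · exact smallc R _ _ (hq j3 hj3).2.1 (hq j4 hj4).2.1
  obtain ⟨b1, hb1, b2, hb2, hbb⟩ := hs1 s (by omega)
  rw [It_inv, It_inv] at hbb
  set C := It F (-(s:ℤ)) '' closedBall (z + zr w) (r0 / 2) with hC
  have hCc : IsContinuum C := (isContinuum_closedBall _ (by positivity)).image (It_cont _ _)
  have hbC : ∀ b ∈ closedBall z (r0 / 2), It F (-(s:ℤ)) b + zr w ∈ C := by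
    intro b hb
    refine ⟨b + zr w, ?_, hF.itper _ _ _⟩
    rw [mem_closedBall, dist_add_right]; exact hb
  obtain ⟨m1, m2, y, hy, c, hc, hce⟩ := NL K hKc d1 d2 a (2 * ρ') (sb _ _ (hpb j2 hj2).1 (hpb j1 hj1).1) (sb _ _ (hpb j2 hj2).2 (hpb j1 hj1).2)
    (sb _ _ (hqb j4 hj4).1 (hqb j3 hj3).1) (sb _ _ (hqb j4 hj4).2 (hqb j3 hj3).2) hdet
    (fun x hx y hy => (dist_triangle_right x y 0).trans (by linarith [hKb x hx, hKb y hy]))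
    ⟨_, Or.inl (Or.inl (Or.inl (Or.inr (add_mem_tr ⟨j0, hj0, rfl⟩)))), Or.inl (Or.inl (Or.inr (hret _ _)))⟩
    ⟨_, Or.inl (Or.inr (add_mem_tr ⟨j0, hj0, rfl⟩)), Or.inr (hret _ _)⟩
    C hCc.1 hCc.2.2 _ _ (hbC b1 hb1) (hbC b2 hb2) (by rw [dist_add_right]; exact hbb)
  set lam := m1 • d1 + m2 • d2 with hlam
  have hys : It F s y + zr lam = c := by
    rw [← hF.itper, ← hce, It_neg_cancel']
  have hsm : ∀ a ∈ J, ∀ b ∈ J, dist (It F ((s:ℤ) - τ) a) (It F ((s:ℤ) - τ) b) ≤ r0 / 2 := hT0 _ (by omega)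
  have hrep : ∃ y' ∈ Y, dist (It F s y) (It F s y') ≤ r0 / 2 := by
    rcases hy with (((hy | hy) | hy) | hy) | hy
    · exact ⟨y, hy, by rw [dist_self]; positivity⟩
    · exact ⟨x1, hx1, repE hF hsm e1 hw1 hy⟩
    · exact ⟨x2, hx2, repE hF hsm e2 hw2 hy⟩
    · exact ⟨x3, hx3, repE hF hsm e3 hw3 hy⟩
    · exact ⟨x4, hx4, repE hF hsm e4 hw4 hy⟩
  obtain ⟨y', hy', hyy⟩ := hrep
  refine ⟨y', hy', w - lam, ?_, ?_, ?_⟩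
  · have : (w - lam).1 - w.1 = -(m1 * d1.1 + m2 * d2.1) := by simp [hlam]
    rw [this]
    exact (dvd_add (hd1.mul_left _) (hd2.mul_left _)).neg_right
  · have : (w - lam).2 - w.2 = -(m1 * d1.2 + m2 * d2.2) := by simp [hlam]
    rw [this]
    exact (dvd_add (hd1'.mul_left _) (hd2'.mul_left _)).neg_right
  · have h1 : dist (It F s y) (z + zr (w - lam)) ≤ r0 / 2 := by
      rw [mem_closedBall, ← hys] at hc
      rw [map_sub, ← dist_add_right _ _ (zr lam)]
      convert hc using 2; abel
    have := dist_triangle_left (It F s y') (z + zr (w - lam)) (It F s y)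
    linarith

end Kit

/-- full crossing -/
def FX (J : Set R2) (ρ : ℝ) (v : ℤ × ℤ) (X : Set R2) : Prop :=
  IsContinuum X ∧ (∀ x ∈ X, dist x 0 < ρ) ∧ J ⊆ X ∧ tr v J ⊆ X

def WW (F : R2 ≃ₜ R2) (J : Set R2) (ρ : ℝ) (z : R2) (r : ℝ) (n : ℕ) (v : ℤ × ℤ) : Set (ℤ × ℤ) :=
  {q | ∀ X, FX J ρ v X → ∃ x ∈ X, dist (It F n x) (z + zr q) ≤ r}

theorem finite_zr (P : ℝ) : {v : ℤ × ℤ | dist (zr v) 0 ≤ P}.Finite := by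
  refine ((Set.finite_Icc (-⌈P⌉) ⌈P⌉).prod (Set.finite_Icc (-⌈P⌉) ⌈P⌉)).subset ?_
  intro v hv
  have := coord_zr hv
  have aux : ∀ x : ℤ, |(x:ℝ)| ≤ P → x ∈ Icc (-⌈P⌉) ⌈P⌉ := by
    intro x hx
    have h1 : |(x:ℝ)| ≤ (⌈P⌉:ℝ) := hx.trans (Int.le_ceil P)
    have h2 : |x| ≤ ⌈P⌉ := by exact_mod_cast h1
    exact abs_le.1 h2
  exact ⟨aux _ this.1, aux _ this.2⟩

theorem one_le_dist_zr {u v : ℤ × ℤ} (h : u ≠ v) : 1 ≤ dist (zr u) (zr v) := by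
  have hc := coord_le (zr u) (zr v)
  simp only [zr_fst, zr_snd] at hc
  have aux : ∀ x y : ℤ, x ≠ y → (1:ℝ) ≤ |(x:ℝ) - y| := by
    intro x y hxy
    have : (1:ℤ) ≤ |x - y| := Int.one_le_abs (sub_ne_zero.2 hxy)
    exact_mod_cast this
  by_cases h1 : u.1 = v.1
  · have h2 : u.2 ≠ v.2 := fun h2 => h (Prod.ext h1 h2)
    exact (aux _ _ h2).trans hc.2
  · exact (aux _ _ h1).trans hc.1

namespace Kit
variable {F : R2 ≃ₜ R2} {J : Set R2} {rt ρ M M' : ℝ} {i1 : ℕ}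

theorem fx_wc (hk : Kit F J rt ρ M M' i1) {v : ℤ × ℤ} {X : Set R2} (h : FX J ρ v X) : WC J ρ v X := by
  obtain ⟨j, hj⟩ := hk.sc.1.2.1
  exact ⟨h.1, h.2.1, ⟨j, h.2.2.1 hj, hj⟩, ⟨_, h.2.2.2 (add_mem_tr hj), by simpa using hj⟩⟩

theorem full_fx (hk : Kit F J rt ρ M M' i1) {v : ℤ × ℤ} (hv : Ty rt v) {X : Set R2} (h : WC J ρ v X) :
    FX J ρ v (full J v X) :=
  ⟨hk.full_cont h, hk.full_bdd hv h, fun _ hx => Or.inr (Or.inl hx), fun _ hx => Or.inr (Or.inr hx)⟩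

theorem exact (hk : Kit F J rt ρ M M' i1) (hF : Frice F) (z : R2) (r : ℝ) (hr : r < 1 / 2) (n : ℕ) (v : ℤ × ℤ) (hv : Ty rt v) :
    ∃ X, FX J ρ v X ∧ ∀ q, ∀ x ∈ X, dist (It F n x) (z + zr q) ≤ r → q ∈ WW F J ρ z r n v := by
  obtain ⟨B, hB, hBd⟩ := hF.disp (n:ℤ)
  have hfin : {q : ℤ × ℤ | q ∉ WW F J ρ z r n v ∧ ∃ x ∈ ball (0:R2) ρ, dist (It F n x) (z + zr q) ≤ r}.Finite := by
    refine (finite_zr (r + B + ρ + ‖z‖)).subset ?_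
    rintro q ⟨-, x, hx, hxd⟩
    have h1 := hBd x
    rw [mem_ball] at hx
    have h2 := dist_triangle4 (z + zr q) (It F n x) x 0
    rw [dist_comm (z + zr q) (It F n x)] at h2
    rw [dist_zero_right (z + zr q)] at h2
    have h3 := norm_sub_le (z + zr q) z
    rw [add_sub_cancel_left] at h3
    simp only [mem_setOf_eq, dist_zero_right]
    linarith
  set s := hfin.toFinset with hs
  have hsm : ∀ q ∈ s, q ∉ WW F J ρ z r n v := fun q hq => ((Set.Finite.mem_toFinset _).1 hq).1
  set Y : ℤ × ℤ → Set R2 := fun q => It F n ⁻¹' closedBall (z + zr q) r with hY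
  have hYc : ∀ q, IsClosed (Y q) := fun q => isClosed_closedBall.preimage (It_cont _ _)
  obtain ⟨j, hj⟩ := hk.sc.1.2.1
  have hav : ∀ q ∈ s, ∃ X, FX J ρ v X ∧ Disjoint X (Y q) := by
    intro q hq
    have h1 := hsm q hq
    simp only [WW, mem_setOf_eq, not_forall, not_exists, not_and] at h1
    obtain ⟨X, hX, h2⟩ := h1
    exact ⟨X, hX, Set.disjoint_left.2 fun x hx hxY => h2 x hx hxY⟩
  have hjoin := duality (ball (0:R2) ρ) isOpen_ball (convex_ball _ _) Y s (fun q _ => hYc q)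
    (by
      intro q _ q' _ hqq
      refine Set.disjoint_left.2 fun x hx hx' => ?_
      simp only [hY, mem_preimage, mem_closedBall] at hx hx'
      have h1 := dist_triangle_left (z + zr q) (z + zr q') (It F n x)
      rw [dist_add_left] at h1
      have := one_le_dist_zr hqq
      linarith) j (j + zr v)
    (by rw [mem_ball]; exact hk.jb j hj) (by rw [mem_ball]; exact hk.jv v hv j hj)
    (by
      intro q hq
      obtain ⟨X, hX, hd⟩ := hav q hq
      have hop : IsOpen (ball (0:R2) ρ \ Y q) := isOpen_ball.sdiff (hYc q)
      have hsub : X ⊆ ball (0:R2) ρ \ Y q := fun x hx => ⟨hX.2.1 x hx, Set.disjoint_left.1 hd hx⟩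
      obtain ⟨δ, hδ, hth⟩ := hX.1.1.exists_thickening_subset_open hop hsub
      obtain ⟨α, hα, h0, h1, hm⟩ := thick_joined hX.1.2.2 hδ (hX.2.2.1 hj) (hX.2.2.2 (add_mem_tr hj))
      exact ⟨⟨⟨fun t => α t, by fun_prop⟩, by simpa using h0, by simpa using h1⟩, fun t => hth (hm _)⟩)
  obtain ⟨γ, hγ⟩ := hjoin
  have hγc : IsContinuum (Set.range γ) := ⟨isCompact_range γ.continuous, isConnected_range γ.continuous⟩
  have hγw : WC J ρ v (Set.range γ) := by
    refine ⟨hγc, ?_, ⟨j, ⟨0, by simp⟩, hj⟩, ⟨j + zr v, ⟨1, by simp⟩, by simpa using hj⟩⟩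
    rintro _ ⟨t, rfl⟩
    exact (hγ t).1
  refine ⟨_, hk.full_fx hv hγw, ?_⟩
  intro q x hx hxd
  by_contra hq
  have hqs : q ∈ s := (Set.Finite.mem_toFinset _).2 ⟨hq, x, (hk.full_fx hv hγw).2.1 x hx, hxd⟩
  obtain ⟨X, hX, hd⟩ := hav q hqs
  have hxY : x ∈ Y q := hxd
  rcases hx with ⟨t, rfl⟩ | hx | hx
  · exact (hγ t).2 (mem_biUnion (show q ∈ (s : Set (ℤ × ℤ)) from hqs) hxY)
  · exact Set.disjoint_left.1 hd (hX.2.2.1 hx) hxY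
  · exact Set.disjoint_left.1 hd (hX.2.2.2 hx) hxY

theorem allhit (hk : Kit F J rt ρ M M' i1) (hF : Frice F) (z : R2) (r1 : ℝ) (hr1 : 0 < r1) (hr1' : r1 < 1 / 2) :
    ∃ n0 : ℕ, ∀ n : ℕ, n0 ≤ n → ∀ v, Ty rt v → ∀ X, FX J ρ v X → ∃ x ∈ X, dist (It F n x) z ≤ r1 := by
  have hfinT : {v : ℤ × ℤ | Ty rt v}.Finite := (finite_zr rt).subset fun v hv => hv.2
  haveI : Fintype {v : ℤ × ℤ // Ty rt v} := hfinT.fintype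
  obtain ⟨R, i, hi, hreach⟩ := hk.reach hF
  obtain ⟨n0, hn0⟩ := combi (κT := {v : ℤ × ℤ // Ty rt v}) (fun r n v => WW F J ρ z r n v.1) R (r1 / 2) r1 (by linarith)
    (by
      intro r r' n v hr q hq X hX
      obtain ⟨x, hx, h⟩ := hq X hX
      exact ⟨x, hx, h.trans hr⟩)
    (by
      intro T
      refine ⟨i * (T ^ 2 + T ^ 2), ?_⟩
      intro r r' hr hrr hr'
      obtain ⟨T0, hT0⟩ := hk.small hF (r' - r) (by linarith)
      refine ⟨T0, ?_⟩
      rintro n hn ⟨v, hv⟩ t ht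
      obtain ⟨X0, hX0, hex⟩ := hk.exact hF z r' (by linarith) (n + i * (T ^ 2 + T ^ 2)) v hv
      rw [mem_bx] at ht
      simp only [Prod.fst_zero, Prod.snd_zero, zero_sub, zero_add] at ht
      obtain ⟨p, v', Y, hH, hp1, hp2⟩ := hreach (T ^ 2 + T ^ 2) v hv X0 (hk.fx_wc hX0) t (by
        push_cast
        exact add_le_add (sq_le_sq' ht.1.1 ht.1.2) (sq_le_sq' ht.2.1 ht.2.2))
      refine ⟨p, ⟨v', hH.1⟩, ?_, ?_⟩
      · rw [mem_bx]
        rw [abs_le] at hp1 hp2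
        refine ⟨⟨?_, ?_⟩, ?_, ?_⟩ <;> linarith
      · intro q hq
        obtain ⟨x, hx, hxd⟩ := hq _ (hk.full_fx hH.1 hH.2.1)
        obtain ⟨y, hy, hyd⟩ := full_rep' hF (by linarith : 0 ≤ r' - r) (hT0 n (by exact_mod_cast hn)) hH.2.1 x hx
        obtain ⟨x', hx', e⟩ := hH.2.2 y hy
        refine hex (p + q) x' hx' ?_
        have e2 : It F ((n + i * (T ^ 2 + T ^ 2) : ℕ) : ℤ) x' = It F n y + zr p := by
          rw [Nat.cast_add, It_add, e, hF.itper]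
        rw [e2]
        have e3 : z + zr (p + q) = z + zr q + zr p := by rw [map_add]; abel
        rw [e3, dist_add_right]
        have := dist_triangle_left (It F n y) (z + zr q) (It F n x)
        linarith)
    (by
      intro k hk0
      obtain ⟨s0, hs0⟩ := hk.h2core hF z (r1 / 2) (by linarith) k hk0
      have hB : ∀ s : ℕ, ∃ B : ℝ, 0 < B ∧ ∀ x, dist (It F s x) x ≤ B := fun s => hF.disp s
      choose B hBp hB using hB
      set BB := ∑ s ∈ Finset.range (s0 + i), B s with hBB
      obtain ⟨l, hl⟩ := exists_nat_ge (r1 / 2 + BB + ρ + ‖z‖ + R)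
      refine ⟨l, s0, ?_⟩
      rintro m hm ⟨v, hv⟩ w
      obtain ⟨X0, hX0, hex⟩ := hk.exact hF z (r1 / 2) (by linarith) m v hv
      set st := (m - s0) / i with hst
      set s := s0 + (m - s0) % i with hs
      have hms : m = s + i * st := by
        have := Nat.div_add_mod (m - s0) i
        rw [← hst] at this
        omega
      have hsi : s ∈ Finset.range (s0 + i) := by
        have := Nat.mod_lt (m - s0) hi
        rw [Finset.mem_range]; omega
      obtain ⟨p, v', Y, hH, hp1, hp2⟩ := hreach st v hv X0 (hk.fx_wc hX0) 0 (by simp)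
      obtain ⟨y, hy, q, hq1, hq2, hqd⟩ := hs0 s (by omega) v' hH.1 Y hH.2.1 (w - p)
      obtain ⟨x, hx, e⟩ := hH.2.2 y hy
      refine ⟨q + p, ?_, ?_, ?_, ?_⟩
      · refine hex _ x hx ?_
        have e2 : It F (m : ℤ) x = It F s y + zr p := by
          rw [hms, Nat.cast_add, It_add, e, hF.itper]
        rw [e2, map_add, ← add_assoc, dist_add_right]
        exact hqd
      · have h1 := hB s y
        have h1' : B s ≤ BB := Finset.single_le_sum (f := B) (fun s _ => (hBp s).le) hsi
        have h2 := hH.2.1.2.1 y hy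
        have h3 := dist_triangle4 (z + zr q) (It F s y) y 0
        rw [dist_comm (z + zr q) (It F s y)] at h3
        rw [dist_zero_right (z + zr q)] at h3
        have h4 := norm_sub_le (z + zr q) z
        rw [add_sub_cancel_left] at h4
        have h5 := coord_zr (v := q) (P := r1 / 2 + BB + ρ + ‖z‖) (by rw [dist_zero_right]; linarith)
        simp only [Prod.fst_zero, Prod.snd_zero, sub_zero] at hp1 hp2
        have h6 : |(p.1:ℝ)| ≤ R := by exact_mod_cast hp1
        have h7 : |(p.2:ℝ)| ≤ R := by exact_mod_cast hp2
        have h8 : |((q + p).1:ℝ)| ≤ l := by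
          rw [Prod.fst_add]; push_cast
          have := abs_add_le (q.1:ℝ) p.1
          linarith [h5.1]
        have h9 : |((q + p).2:ℝ)| ≤ l := by
          rw [Prod.snd_add]; push_cast
          have := abs_add_le (q.2:ℝ) p.2
          linarith [h5.2]
        have h8' : |(q + p).1| ≤ (l:ℤ) := by exact_mod_cast h8
        have h9' : |(q + p).2| ≤ (l:ℤ) := by exact_mod_cast h9
        rw [abs_le] at h8' h9'
        rw [mem_bx]
        simp only [Prod.fst_zero, Prod.snd_zero, zero_sub, zero_add]
        exact ⟨h8', h9'⟩
      · convert hq1 using 1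
        simp only [Prod.fst_add, Prod.fst_sub]; ring
      · convert hq2 using 1
        simp only [Prod.snd_add, Prod.snd_sub]; ring)
  refine ⟨n0, fun n hn v hv X hX => ?_⟩
  obtain ⟨x, hx, h⟩ := hn0 n hn ⟨v, hv⟩ X hX
  exact ⟨x, hx, by simpa using h⟩

end Kit

/-- mixing of a frice lift -/
theorem Frice.mixing {F : R2 ≃ₜ R2} (hF : Frice F) (U V : Set R2) (hU : IsOpen U) (hV : IsOpen V) (hUn : U.Nonempty) (hVn : V.Nonempty) :
    ∃ n0 : ℕ, ∀ n : ℕ, n0 ≤ n → ∃ x ∈ U, It F n x ∈ V := by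
  obtain ⟨J, rt, ρ, M, M', i1, hk⟩ := hF.kit
  obtain ⟨u, hu⟩ := hUn
  obtain ⟨w, hw⟩ := hVn
  obtain ⟨ε, hε, hεU⟩ := Metric.nhds_basis_closedBall.mem_iff.1 (hU.mem_nhds hu)
  obtain ⟨ε', hε', hεV⟩ := Metric.nhds_basis_closedBall.mem_iff.1 (hV.mem_nhds hw)
  obtain ⟨n1, p, v, Y, hH⟩ := hk.start hF u ε hε
  set r := min (ε' / 2) (1 / 4) with hr
  have hr0 : 0 < r := by positivity
  obtain ⟨n0, hn0⟩ := hk.allhit hF (w - zr p) r hr0 (lt_of_le_of_lt (min_le_right _ _) (by norm_num))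
  obtain ⟨T0, hT0⟩ := hk.small hF (ε' / 2) (by positivity)
  refine ⟨n1 + n0 + T0, fun n hn => ?_⟩
  obtain ⟨k, rfl⟩ := Nat.exists_eq_add_of_le (show n1 ≤ n by omega)
  obtain ⟨x, hx, hxd⟩ := hn0 k (by omega) v hH.1 _ (hk.full_fx hH.1 hH.2.1)
  obtain ⟨y, hy, hyd⟩ := Kit.full_rep' hF (by positivity : 0 ≤ ε' / 2) (hT0 k (by omega)) hH.2.1 x hx
  obtain ⟨a, ha, e⟩ := hH.2.2 y hy
  refine ⟨a, hεU ha, hεV ?_⟩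
  have e2 : It F ((n1 + k : ℕ) : ℤ) a = It F k y + zr p := by
    rw [Nat.cast_add, add_comm, It_add, e, hF.itper]
  rw [mem_closedBall, e2]
  have h1 := dist_triangle_left (It F k y) (w - zr p) (It F k x)
  have h2 := min_le_left (ε' / 2) (1 / 4)
  rw [← dist_add_right _ _ (zr p)] at h1
  simp only [sub_add_cancel] at h1
  linarith

/-! ### From the hypotheses on `G` to `Frice F` -/

theorem It_nat (F : R2 ≃ₜ R2) (n : ℕ) (x : R2) : It F n x = (⇑F)^[n] x := by
  induction n generalizing x with
  | zero => simp
  | succ n ih =>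
    push_cast
    rw [It_add, It_one, ih, Function.iterate_succ_apply]

theorem symm_iter (F : R2 ≃ₜ R2) (n : ℕ) (x : R2) : (⇑F)^[n] ((⇑F.symm)^[n] x) = x := by
  have h : Function.LeftInverse (⇑F) (⇑F.symm) := F.apply_symm_apply
  exact h.iterate n x

theorem It_iterZ (F : R2 ≃ₜ R2) (j : ℤ) (x : R2) : iterZ F j x = It F j x := by
  cases j with
  | ofNat n => exact (It_nat F n x).symm
  | negSucc n =>
    show (⇑F.symm)^[n+1] x = It F (Int.negSucc n) x
    apply It_inj F ((n+1 : ℕ) : ℤ)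
    rw [← It_add, It_nat, symm_iter]
    have : ((n+1 : ℕ) : ℤ) + Int.negSucc n = 0 := by omega
    rw [this, It_zero]

theorem itperG {F : R2 ≃ₜ R2} (hF : ∀ x v, F (x + zr v) = F x + zr v) (j : ℤ) (x : R2) (v : ℤ × ℤ) :
    It F j (x + zr v) = It F j x + zr v := by
  have h1 : ∀ n : ℕ, ∀ x, It F n (x + zr v) = It F n x + zr v := by
    intro n
    induction n with
    | zero => simp
    | succ n ih =>
      intro x
      push_cast
      rw [It_add, It_add, It_one, It_one, hF, ih]
  rcases le_total 0 j with h | h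
  · lift j to ℕ using h
    exact h1 j x
  · obtain ⟨n, hn⟩ := Int.eq_ofNat_of_zero_le (neg_nonneg.2 h)
    apply It_inj F n
    have e : j = -(n:ℤ) := by omega
    subst e
    rw [It_neg_cancel', h1, It_neg_cancel']

theorem dispG {F : R2 ≃ₜ R2} (hF : ∀ x v, F (x + zr v) = F x + zr v) (j : ℤ) :
    ∃ M : ℝ, 0 < M ∧ ∀ x, dist (It F j x) x ≤ M := by
  obtain ⟨M, hM⟩ := ((isCompact_closedBall (0:R2) 1).image (f := fun x => dist (It F j x) x)
    (by have := It_cont F j; fun_prop)).isBounded.bddAbove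
  refine ⟨max M 1, by positivity, fun x => ?_⟩
  obtain ⟨v, hv, -⟩ := exists_zr_near x
  have := hM ⟨x + zr v, hv, rfl⟩
  simp only [itperG hF, dist_add_right] at this
  exact this.trans (le_max_left _ _)

/-- A common displacement bound for the iterates `0 ≤ r < N`. -/
theorem dispGN {F : R2 ≃ₜ R2} (hF : ∀ x v, F (x + zr v) = F x + zr v) (N : ℕ) :
    ∃ M : ℝ, 0 < M ∧ ∀ r : ℕ, r < N → ∀ x, dist (It F r x) x ≤ M := by
  choose B hB hBd using fun r : ℕ => dispG hF (r : ℤ)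
  refine ⟨1 + ∑ r ∈ Finset.range N, B r, ?_, fun r hr x => ?_⟩
  · have : 0 ≤ ∑ r ∈ Finset.range N, B r := Finset.sum_nonneg (fun r _ => (hB r).le)
    linarith
  · have := Finset.single_le_sum (f := B) (fun s _ => (hB s).le) (Finset.mem_range.2 hr)
    have := hBd r x
    linarith

/-- The renormalised power `G^j - w`. -/
def shiftPow (G : R2 ≃ₜ R2) (j : ℕ) (w : ℤ × ℤ) : R2 ≃ₜ R2 :=
  (G ^ (j:ℤ) : R2 ≃ₜ R2).trans (Homeomorph.addRight (zr (-w)))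

theorem shiftPow_apply (G : R2 ≃ₜ R2) (j : ℕ) (w : ℤ × ℤ) (x : R2) :
    shiftPow G j w x = It G j x + zr (-w) := rfl

theorem It_shiftPow {G : R2 ≃ₜ R2} (hG : ∀ x v, G (x + zr v) = G x + zr v) (j : ℕ) (w : ℤ × ℤ)
    (n : ℤ) (x : R2) : It (shiftPow G j w) n x = It G (j * n) x + zr (n • (-w)) := by
  have h1 : ∀ n : ℕ, ∀ x, It (shiftPow G j w) n x = It G (j * n) x + zr ((n : ℤ) • (-w)) := by
    intro n
    induction n with
    | zero => intro x; simp
    | succ n ih =>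
      intro x
      push_cast
      rw [It_add, It_one, shiftPow_apply, ih, itperG hG, ← It_add, add_assoc, ← map_add,
        add_zsmul, one_zsmul]
      congr 2
      ring
  rcases le_total 0 n with h | h
  · lift n to ℕ using h
    exact h1 n x
  · obtain ⟨m, hm⟩ := Int.eq_ofNat_of_zero_le (neg_nonneg.2 h)
    have e : n = -(m:ℤ) := by omega
    subst e
    apply It_inj (shiftPow G j w) m
    rw [It_neg_cancel', h1, itperG hG, ← It_add, add_assoc, ← map_add, ← add_zsmul]
    simp

theorem drift_up {G : R2 ≃ₜ R2} (hG : ∀ x v, G (x + zr v) = G x + zr v) (N : ℕ) (hN : 0 < N)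
    (e : R2) (A : ℝ) (h : ∀ z, (It G N z - z).1 * e.1 + (It G N z - z).2 * e.2 ≤ A) :
    ∀ v ∈ rotSet G, v.1 * e.1 + v.2 * e.2 ≤ A / N := by
  have hN' : (0:ℝ) < N := by exact_mod_cast hN
  obtain ⟨B, hB, hBd⟩ := dispGN hG N
  have hq : ∀ q : ℕ, ∀ z, (It G (q * N : ℕ) z - z).1 * e.1 + (It G (q * N : ℕ) z - z).2 * e.2 ≤ q * A := by
    intro q
    induction q with
    | zero => intro z; simp
    | succ q ih =>
      intro z
      have e1 : (((q + 1) * N : ℕ) : ℤ) = (N : ℤ) + (q * N : ℕ) := by push_cast; ring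
      rw [e1, It_add]
      have h1 := h (It G (q * N : ℕ) z)
      have h2 := ih z
      simp only [Prod.fst_sub, Prod.snd_sub] at h1 h2 ⊢
      push_cast
      push_cast at h1 h2
      linarith
  set C : ℝ := |A| + B * (|e.1| + |e.2|) with hC
  have hm : ∀ m : ℕ, ∀ z, (It G m z - z).1 * e.1 + (It G m z - z).2 * e.2 ≤ m * (A / N) + C := by
    intro m z
    have e0 := Nat.mod_add_div m N
    have hr := Nat.mod_lt m hN
    set r := m % N
    set q := m / N
    have e1 : (m : ℤ) = (r : ℤ) + (q * N : ℕ) := by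
      push_cast; rw [← e0]; push_cast; ring
    have e2 : (m : ℝ) = r + q * N := by rw [← e0]; push_cast; ring
    have h1 := hq q z
    have h2 := hBd r hr (It G (q * N : ℕ) z)
    rw [e1, It_add, e2]
    set y := It G (q * N : ℕ) z
    set x := It G r y
    have h3 : |(x - y).1| ≤ B := by
      rw [dist_eq_norm] at h2; exact (norm_fst_le _).trans h2
    have h4 : |(x - y).2| ≤ B := by
      rw [dist_eq_norm] at h2; exact (norm_snd_le _).trans h2
    have h5 : (x - y).1 * e.1 ≤ B * |e.1| := by
      refine (le_abs_self _).trans ?_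
      rw [abs_mul]
      exact mul_le_mul_of_nonneg_right h3 (abs_nonneg _)
    have h6 : (x - y).2 * e.2 ≤ B * |e.2| := by
      refine (le_abs_self _).trans ?_
      rw [abs_mul]
      exact mul_le_mul_of_nonneg_right h4 (abs_nonneg _)
    have h7 : ((r:ℝ) + q * N) * (A / N) = r * (A / N) + q * A := by field_simp
    have h8 : -|A| ≤ r * (A / N) := by
      have hr1 : (r:ℝ) / N ≤ 1 := by
        rw [div_le_one hN']; exact_mod_cast hr.le
      have hr0 : 0 ≤ (r:ℝ) / N := by positivity
      have : |(r:ℝ) / N * A| ≤ |A| := by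
        rw [abs_mul, abs_of_nonneg hr0]
        exact mul_le_of_le_one_left (abs_nonneg _) hr1
      have e3 : (r:ℝ) * (A / N) = r / N * A := by ring
      rw [e3]
      exact (abs_le.1 this).1
    simp only [Prod.fst_sub, Prod.snd_sub] at h1 h5 h6 ⊢
    rw [h7, hC]
    linarith
  rintro v ⟨z, n, hn, hz⟩
  have hn' : Tendsto (fun k => (n k : ℝ)) atTop atTop := tendsto_natCast_atTop_atTop.comp hn
  have hl : Tendsto (fun k => (((n k : ℝ))⁻¹ • ((⇑G)^[n k] (z k) - z k)).1 * e.1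
      + (((n k : ℝ))⁻¹ • ((⇑G)^[n k] (z k) - z k)).2 * e.2) atTop (𝓝 (v.1 * e.1 + v.2 * e.2)) := by
    have hc : Continuous (fun x : R2 => x.1 * e.1 + x.2 * e.2) := by fun_prop
    exact (hc.tendsto v).comp hz
  have hr : Tendsto (fun k => A / N + ((n k : ℝ))⁻¹ * C) atTop (𝓝 (A / N + 0 * C)) :=
    tendsto_const_nhds.add ((tendsto_inv_atTop_zero.comp hn').mul_const C)
  rw [zero_mul, add_zero] at hr
  refine le_of_tendsto_of_tendsto hl hr ?_
  filter_upwards [hn'.eventually_gt_atTop 0] with k hk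
  have h1 := hm (n k) (z k)
  rw [It_nat] at h1
  simp only [Prod.smul_fst, Prod.smul_snd, smul_eq_mul]
  have h2 := mul_le_mul_of_nonneg_left h1 (inv_pos.2 hk).le
  have e3 : ((n k : ℝ))⁻¹ * (n k * (A / N) + C) = A / N + ((n k : ℝ))⁻¹ * C := by
    field_simp
  rw [e3] at h2
  linarith

theorem frice_of {G : R2 ≃ₜ R2} (hG : ∀ x v, G (x + zr v) = G x + zr v)
    (hrot : (interior (rotSet G)).Nonempty)
    (hexp : ∀ K : Set R2, IsContinuum K → K.Nontrivial → dynDiam G K = ⊤) :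
    ∃ j : ℕ, 1 ≤ j ∧ ∃ w : ℤ × ℤ, Frice (shiftPow G j w) := by
  obtain ⟨p, hp⟩ := hrot
  obtain ⟨ε, hε, hb⟩ := Metric.isOpen_iff.1 isOpen_interior p hp
  obtain ⟨j, hj⟩ := exists_nat_gt (2 / ε)
  have hj0 : (0:ℝ) < j := lt_trans (by positivity) hj
  have hj1 : 1 ≤ j := by
    have : 0 < j := by exact_mod_cast hj0
    exact this
  have hjε : 1 / (j:ℝ) < ε / 2 := by
    rw [div_lt_iff₀ hε] at hj
    rw [div_lt_iff₀ hj0]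
    linarith
  set w : ℤ × ℤ := (⌊j * p.1⌋, ⌊j * p.2⌋) with hw
  have hfl : ∀ t : ℝ, |(⌊j * t⌋ : ℝ) / j - t| ≤ 1 / j := by
    intro t
    have h1 := Int.floor_le (j * t)
    have h2 := Int.lt_floor_add_one (j * t)
    have e1 : (⌊j * t⌋ : ℝ) / j - t = (⌊j * t⌋ - j * t) / j := by field_simp
    rw [e1, abs_div, abs_of_pos hj0]
    refine div_le_div_of_nonneg_right ?_ hj0.le
    rw [abs_le]
    constructor <;> linarith
  refine ⟨j, hj1, w, ?_, ?_, ?_⟩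
  · intro x v
    rw [shiftPow_apply, shiftPow_apply, itperG hG]
    abel
  · refine ⟨ε / 8, by positivity, fun n e => ?_⟩
    by_contra! hcon
    rcases Nat.eq_zero_or_pos n with rfl | hn
    · have := hcon 0
      simp at this
    have hn0 : (0:ℝ) < n := by exact_mod_cast hn
    have hN : 0 < j * n := Nat.mul_pos hj1 hn
    set S := |e.1| + |e.2| with hS
    have hSp : 0 < S := by
      have h0 : 0 ≤ S := by positivity
      rcases h0.lt_or_eq with h | h
      · exact h
      · exfalso
        have a1 := abs_nonneg e.1
        have a2 := abs_nonneg e.2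
        have b1 : e.1 = 0 := abs_eq_zero.1 (by linarith)
        have b2 : e.2 = 0 := abs_eq_zero.1 (by linarith)
        have := hcon 0
        rw [← h, b1, b2] at this
        simp at this
    have hup := drift_up hG (j * n) hN e (ε / 8 * n * S + n * (w.1 * e.1 + w.2 * e.2)) (by
      intro z
      have h1 := hcon z
      rw [It_shiftPow hG] at h1
      have e1 : ((j * n : ℕ) : ℤ) = j * n := by push_cast; rfl
      rw [e1]
      simp only [zr_def, Prod.fst_sub, Prod.snd_sub, Prod.fst_add, Prod.snd_add, Prod.smul_fst,
        Prod.smul_snd, Prod.fst_neg, Prod.snd_neg, smul_eq_mul] at h1 ⊢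
      push_cast at h1
      linarith)
    have hs : ∀ t : ℝ, ∃ s : ℝ, |s| ≤ 1 ∧ s * t = |t| := by
      intro t
      rcases le_total 0 t with h | h
      · exact ⟨1, by simp, by rw [abs_of_nonneg h, one_mul]⟩
      · exact ⟨-1, by simp, by rw [abs_of_nonpos h]; ring⟩
    obtain ⟨s1, hs1, hs1'⟩ := hs e.1
    obtain ⟨s2, hs2, hs2'⟩ := hs e.2
    have hmem : (((w.1:ℝ) / j + ε / 4 * s1, (w.2:ℝ) / j + ε / 4 * s2) : R2) ∈ rotSet G := by
      apply interior_subset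
      apply hb
      have key : ∀ (t s : ℝ), |s| ≤ 1 → |(⌊j * t⌋ : ℝ) / j + ε / 4 * s - t| < ε := by
        intro t s hs
        have h1 := abs_le.1 (hfl t)
        have h2 := abs_le.1 hs
        rw [abs_lt]
        constructor <;> nlinarith
      rw [mem_ball, Prod.dist_eq, max_lt_iff, Real.dist_eq, Real.dist_eq]
      exact ⟨key p.1 s1 hs1, key p.2 s2 hs2⟩
    have h1 := hup _ hmem
    simp only at h1
    have e2 : (ε / 8 * n * S + n * (w.1 * e.1 + w.2 * e.2)) / ((j * n : ℕ) : ℝ)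
        = ε / 8 * S / j + (w.1 / j * e.1 + w.2 / j * e.2) := by
      push_cast
      field_simp
    rw [e2] at h1
    have h3 : ε / 8 * S / j ≤ ε / 8 * S := by
      apply div_le_self (by positivity)
      exact_mod_cast hj1
    have e3 : ε / 4 * s1 * e.1 + ε / 4 * s2 * e.2 = ε / 4 * S := by
      rw [hS, ← hs1', ← hs2']; ring
    have h4 : 0 < ε * S := by positivity
    nlinarith
  · intro K hK hKn M
    by_contra! hcon
    obtain ⟨B, hB, hBd⟩ := dispGN hG j
    have hle : dynDiam G K ≤ ENNReal.ofReal (M + 2 * B) := by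
      refine iSup_le fun i => ?_
      refine EMetric.diam_le ?_
      rintro _ ⟨x, hx, rfl⟩ _ ⟨y, hy, rfl⟩
      rw [It_iterZ, It_iterZ, edist_dist]
      apply ENNReal.ofReal_le_ofReal
      have hjz : (0:ℤ) < j := by exact_mod_cast hj1
      have e0 := Int.emod_add_mul_ediv i j
      have hr0 := Int.emod_nonneg i hjz.ne'
      have hr1 := Int.emod_lt_of_pos i hjz
      obtain ⟨r, hr⟩ := Int.eq_ofNat_of_zero_le hr0
      rw [hr] at hr1 e0
      rw [← e0, It_add, It_add]
      have h1 := hcon (i / j) x hx y hy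
      rw [It_shiftPow hG, It_shiftPow hG, dist_add_right] at h1
      have hrj : r < j := by exact_mod_cast hr1
      have h2 := hBd r hrj (It G (j * (i / j)) x)
      have h3 := hBd r hrj (It G (j * (i / j)) y)
      have h4 := dist_triangle4 (It G r (It G (j * (i / j)) x)) (It G (j * (i / j)) x)
        (It G (j * (i / j)) y) (It G r (It G (j * (i / j)) y))
      rw [dist_comm (It G (j * (i / j)) y) (It G r _)] at h4
      linarith
    rw [hexp K hK hKn, top_le_iff] at hle
    exact ENNReal.ofReal_ne_top hle

/-! ### The projection and the final step -/

theorem proj_cont : Continuous proj := by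
  unfold proj
  exact ((AddCircle.continuous_mk' 1).comp continuous_fst).prodMk
    ((AddCircle.continuous_mk' 1).comp continuous_snd)

theorem proj_surj : Function.Surjective proj := by
  rintro ⟨a, b⟩
  obtain ⟨x, rfl⟩ := QuotientAddGroup.mk_surjective a
  obtain ⟨y, rfl⟩ := QuotientAddGroup.mk_surjective b
  exact ⟨(x, y), rfl⟩

theorem proj_add_zr (x : R2) (v : ℤ × ℤ) : proj (x + zr v) = proj x := by
  have h : ∀ (t : ℝ) (k : ℤ), ((t + k : ℝ) : AddCircle (1:ℝ)) = (t : AddCircle (1:ℝ)) := by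
    intro t k
    rw [AddCircle.coe_add, add_eq_left, AddCircle.coe_eq_zero_iff]
    exact ⟨k, by simp⟩
  unfold proj
  rw [zr_def]
  exact Prod.ext (h _ _) (h _ _)

theorem proj_iter {f : Torus → Torus} {F : R2 → R2} (h : ∀ x, proj (F x) = f (proj x)) (n : ℕ) (x : R2) :
    proj (F^[n] x) = f^[n] (proj x) := by
  have : Function.Semiconj proj F f := h
  exact (this.iterate_right n) x

/-- **Frice homeomorphisms are rotationally mixing:** some power of `g` has a
topologically mixing lift; in particular `g` itself is topologically mixing. -/
theorem frice_rotationally_mixing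
    (g : Torus ≃ₜ Torus) (G : R2 ≃ₜ R2) (hG : IsLiftFun ⇑g ⇑G)
    (hrot : (interior (rotSet G)).Nonempty)
    (hexp : ∀ K : Set R2, IsContinuum K → K.Nontrivial → dynDiam G K = ⊤) :
    (∃ j : ℕ, 1 ≤ j ∧ ∃ Gj : R2 ≃ₜ R2, IsLiftFun ((⇑g)^[j]) ⇑Gj ∧
      TopologicallyMixing ⇑Gj) ∧
    TopologicallyMixing ⇑g := by
  have hper : ∀ x v, G (x + zr v) = G x + zr v := fun x v => hG.2 x v
  obtain ⟨j, hj, w, hF⟩ := frice_of hper hrot hexp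
  set F := shiftPow G j w with hFdef
  have hlift : IsLiftFun ((⇑g)^[j]) ⇑F := by
    refine ⟨fun x => ?_, fun x v => hF.per x v⟩
    rw [hFdef, shiftPow_apply, proj_add_zr, It_nat]
    exact proj_iter hG.1 j x
  refine ⟨⟨j, hj, F, hlift, ?_⟩, ?_⟩
  · intro U V hU hV hUn hVn
    obtain ⟨n0, h⟩ := hF.mixing U V hU hV hUn hVn
    refine ⟨n0, fun n hn => ?_⟩
    obtain ⟨x, hx, hxV⟩ := h n hn
    rw [It_nat] at hxV
    exact ⟨_, ⟨x, hx, rfl⟩, hxV⟩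
  · intro U V hU hV hUn hVn
    have hUn' : (proj ⁻¹' U).Nonempty := hUn.preimage proj_surj
    have hV' : ∀ r : ℕ, ∃ n0 : ℕ, ∀ n : ℕ, n0 ≤ n → ∃ x ∈ proj ⁻¹' U,
        It F n x ∈ proj ⁻¹' ((⇑g)^[r] ⁻¹' V) := fun r =>
      hF.mixing _ _ (hU.preimage proj_cont)
        ((hV.preimage (g.continuous.iterate r)).preimage proj_cont) hUn'
        ((hVn.preimage (g.surjective.iterate r)).preimage proj_surj)
    choose n0 hn0 using hV'
    refine ⟨j * ∑ r ∈ Finset.range j, n0 r, fun n hn => ?_⟩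
    have hr : n % j < j := Nat.mod_lt _ hj
    have h1 : n0 (n % j) ≤ ∑ r ∈ Finset.range j, n0 r :=
      Finset.single_le_sum (f := n0) (fun _ _ => Nat.zero_le _) (Finset.mem_range.2 hr)
    have h2 : ∑ r ∈ Finset.range j, n0 r ≤ n / j := by
      rw [Nat.le_div_iff_mul_le hj, mul_comm]; exact hn
    obtain ⟨x, hx, hxV⟩ := hn0 (n % j) (n / j) (h1.trans h2)
    refine ⟨(⇑g)^[n] (proj x), ⟨proj x, hx, rfl⟩, ?_⟩
    rw [It_nat] at hxV
    have e : (⇑g)^[n] (proj x) = (⇑g)^[n % j] (proj ((⇑F)^[n / j] x)) := by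
      rw [proj_iter hlift.1, ← Function.iterate_mul, ← Function.iterate_add_apply, Nat.mod_add_div]
    rw [e]
    exact hxV
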